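/- For every t ∈ (1,2] and every s ∈ [t−1, (2t−1)/3] there exists a compact set K ⊂ ℝ² with dimH(K) = t such that for every e ∈ S¹ one has dimH(H(K,e,s)) = min{2t−3s, t}. -/

import Mathlib

open MeasureTheory Metric Set
open scoped ENNReal NNReal

noncomputable section

/-- The Euclidean plane ℝ². -/
abbrev Plane := EuclideanSpace ℝ (Fin 2)

/-- The unit circle S¹ ⊆ ℝ². -/
def unitCircle : Set Plane := Metric.sphere (0 : Plane) 1

/-- The line `ℓ_{e,z} = z + span(e)` through `z` in direction `e`. -/
def lineThrough (e z : Plane) : Set Plane := {w | ∃ r : ℝ, w = z + r • e}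


/-- The `s`-heavy part of `A` in direction `e`:
`H(A,e,s) = {z ∈ A : dimH (A ∩ ℓ_{e,z}) ≥ s}`. -/
def heavyPart (A : Set Plane) (e : Plane) (s : ℝ) : Set Plane :=
  {z | z ∈ A ∧ ENNReal.ofReal s ≤ dimH (A ∩ lineThrough e z)}


namespace HP

open Filter Topology

/-- Upper bound of the dimension by finite covers. -/
lemma dimH_le_of_covers {X : Type*} [MetricSpace X] [MeasurableSpace X] [BorelSpace X]
    (A : Set X) (v : ℝ) (hv : 0 ≤ v)
    (h : ∀ η : ℝ, 0 < η → ∃ (ι : Type) (T : Finset ι) (U : ι → Set X) (ρ : ℝ),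
      0 < ρ ∧ ρ ≤ η ∧ A ⊆ ⋃ i ∈ T, U i ∧ (∀ i ∈ T, ediam (U i) ≤ ENNReal.ofReal ρ) ∧
      (T.card : ℝ) * ρ ^ v ≤ 1) : dimH A ≤ ENNReal.ofReal v := by
  have h' : ∀ n : ℕ, _ := fun n => h (1 / ((n : ℝ) + 1)) (by positivity)
  choose ι T U ρ hρ hρη hA hd hc using h'
  have hr : Tendsto (fun n => ENNReal.ofReal (ρ n)) atTop (𝓝 0) := by
    rw [← ENNReal.ofReal_zero]
    apply ENNReal.tendsto_ofReal
    exact squeeze_zero (fun n => (hρ n).le) hρη tendsto_one_div_add_atTop_nhds_zero_nat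
  have key := Measure.hausdorffMeasure_le_liminf_sum (X := X) (β := ℕ) (ι := fun n => T n) v A
    (fun n => ENNReal.ofReal (ρ n)) hr (fun n i => U n i)
    (Eventually.of_forall fun n i => hd n i i.2)
    (Eventually.of_forall fun n => by
      intro x hx
      have := hA n hx
      simp only [mem_iUnion] at this ⊢
      obtain ⟨i, hi, hx⟩ := this
      exact ⟨⟨i, hi⟩, hx⟩)
  have hle : ∀ n, ∑ i : T n, ediam (U n i) ^ v ≤ 1 := by
    intro n
    calc ∑ i : T n, ediam (U n i) ^ v ≤ ∑ i : T n, ENNReal.ofReal (ρ n) ^ v :=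
          Finset.sum_le_sum fun i _ => ENNReal.rpow_le_rpow (hd n i i.2) hv
      _ = ENNReal.ofReal ((T n).card * (ρ n) ^ v) := by
          rw [ENNReal.ofReal_mul (by positivity), ENNReal.ofReal_rpow_of_pos (hρ n)]
          simp
      _ ≤ 1 := by
          rw [← ENNReal.ofReal_one]; exact ENNReal.ofReal_le_ofReal (hc n)
  have h1 : μH[v] A ≤ 1 := by
    refine key.trans ?_
    calc liminf (fun n => ∑ i : T n, ediam (U n i) ^ v) atTop
        ≤ liminf (fun _ : ℕ => (1 : ℝ≥0∞)) atTop :=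
          liminf_le_liminf (Eventually.of_forall hle)
      _ = 1 := liminf_const _
  have h2 : μH[(v.toNNReal : ℝ)] A ≠ ∞ := by
    rw [Real.coe_toNNReal v hv]
    exact (h1.trans_lt ENNReal.one_lt_top).ne
  exact dimH_le_of_hausdorffMeasure_ne_top h2

/-- Product with a unit interval raises the dimension by at most one. -/
lemma dimH_prod_Icc_le (A : Set ℝ) (a b : ℝ) (hab : a ≤ b) (hb : b ≤ a + 1) :
    dimH (A ×ˢ Icc a b : Set (ℝ × ℝ)) ≤ dimH A + 1 := by
  by_contra hcon
  push Not at hcon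
  have h1 : dimH A < dimH (A ×ˢ Icc a b : Set (ℝ × ℝ)) - 1 := by
    rwa [lt_tsub_iff_right]
  obtain ⟨v, hv1, hv2⟩ := ENNReal.lt_iff_exists_nnreal_btwn.1 h1
  rw [lt_tsub_iff_right] at hv2
  have hv0 : (0 : ℝ) < v := by
    have : (0 : ℝ≥0∞) < v := lt_of_le_of_lt (zero_le) hv1
    exact_mod_cast this
  have hz : μH[(v : ℝ)] A = 0 := hausdorffMeasure_of_dimH_lt hv1
  have hcov : ∀ n : ℕ, ∃ t : ℕ → Set ℝ, A ⊆ ⋃ i, t i ∧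
      (∀ i, ediam (t i) ≤ ENNReal.ofReal (1 / ((n : ℝ) + 1))) ∧
      ∑' i, ediam (t i) ^ (v : ℝ) ≤ 1 := by
    intro n
    rw [Measure.hausdorffMeasure_apply] at hz
    have hpos : (0 : ℝ≥0∞) < ENNReal.ofReal (1 / ((n : ℝ) + 1)) := by
      rw [ENNReal.ofReal_pos]; positivity
    have h2 := le_iSup₂ (f := fun (r : ℝ≥0∞) (_ : 0 < r) =>
        ⨅ (t : ℕ → Set ℝ) (_ : A ⊆ ⋃ n, t n) (_ : ∀ n, ediam (t n) ≤ r),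
          ∑' n, ⨆ _ : (t n).Nonempty, ediam (t n) ^ (v : ℝ)) _ hpos
    rw [hz] at h2
    have h3 := lt_of_le_of_lt h2 (zero_lt_one)
    simp only [iInf_lt_iff] at h3
    obtain ⟨t, ht1, ht2, ht3⟩ := h3
    refine ⟨t, ht1, ht2, le_trans (ENNReal.tsum_le_tsum fun i => ?_) ht3.le⟩
    rcases (t i).eq_empty_or_nonempty with he | hne
    · rw [he]; simp [hv0]
    · simp [hne]
  choose t ht1 ht2 ht3 using hcov
  -- radii
  let τ : ℕ → ℕ → ℝ := fun n i => min (1 / ((n : ℝ) + 1)) (((1 / 2 : ℝ) ^ (i + 1)) ^ (1 / (v : ℝ)))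
  have hτ : ∀ n i, 0 < τ n i := fun n i => lt_min (by positivity) (by positivity)
  have hτv : ∀ n i, (τ n i) ^ (v : ℝ) ≤ (1 / 2 : ℝ) ^ (i + 1) := by
    intro n i
    calc (τ n i) ^ (v : ℝ) ≤ ((((1 / 2 : ℝ) ^ (i + 1)) ^ (1 / (v : ℝ)))) ^ (v : ℝ) :=
          Real.rpow_le_rpow (hτ n i).le (min_le_right _ _) hv0.le
      _ = _ := by
          rw [← Real.rpow_mul (by positivity), one_div_mul_cancel hv0.ne', Real.rpow_one]
  have hfin : ∀ n i, ediam (t n i) ≠ ∞ := fun n i => ((ht2 n i).trans_lt ENNReal.ofReal_lt_top).ne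
  let ρ : ℕ → ℕ → ℝ := fun n i => max (ediam (t n i)).toReal (τ n i)
  have hρ : ∀ n i, 0 < ρ n i := fun n i => lt_max_of_lt_right (hτ n i)
  have hρle : ∀ n i, ρ n i ≤ 1 / ((n : ℝ) + 1) := fun n i => by
    refine max_le ?_ (min_le_left _ _)
    exact ENNReal.toReal_le_of_le_ofReal (by positivity) (ht2 n i)
  have hρ1 : ∀ n i, ρ n i ≤ 1 := fun n i => (hρle n i).trans (by
    rw [div_le_one (by positivity)]; linarith [(Nat.cast_nonneg n : (0 : ℝ) ≤ n)])
  have hdρ : ∀ n i, ediam (t n i) ≤ ENNReal.ofReal (ρ n i) := fun n i => by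
    rw [← ENNReal.ofReal_toReal (hfin n i)]
    exact ENNReal.ofReal_le_ofReal (le_max_left _ _)
  have hρv : ∀ n i, ENNReal.ofReal ((ρ n i) ^ (v : ℝ)) ≤
      ediam (t n i) ^ (v : ℝ) + ENNReal.ofReal ((1 / 2 : ℝ) ^ (i + 1)) := by
    intro n i
    rcases le_total (ediam (t n i)).toReal (τ n i) with hle | hle
    · refine le_trans ?_ le_add_self
      apply ENNReal.ofReal_le_ofReal
      simp only [ρ, max_eq_right hle]; exact hτv n i
    · refine le_trans ?_ le_self_add
      simp only [ρ, max_eq_left hle]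
      rw [← ENNReal.ofReal_rpow_of_nonneg ENNReal.toReal_nonneg hv0.le,
        ENNReal.ofReal_toReal (hfin n i)]
  have hsumρ : ∀ n, ∑' i, ENNReal.ofReal ((ρ n i) ^ (v : ℝ)) ≤ 2 := by
    intro n
    calc _ ≤ ∑' i, (ediam (t n i) ^ (v : ℝ) + ENNReal.ofReal ((1 / 2 : ℝ) ^ (i + 1))) :=
          ENNReal.tsum_le_tsum (hρv n)
      _ = ∑' i, ediam (t n i) ^ (v : ℝ) + ∑' i : ℕ, ENNReal.ofReal ((1 / 2 : ℝ) ^ (i + 1)) :=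
          ENNReal.tsum_add
      _ ≤ 1 + 1 := by
          gcongr
          · exact ht3 n
          · have : ∀ i : ℕ, ENNReal.ofReal ((1 / 2 : ℝ) ^ (i + 1)) = (2 : ℝ≥0∞)⁻¹ ^ (i + 1) := by
              intro i
              rw [ENNReal.ofReal_pow (by norm_num)]
              congr 1
              rw [one_div, ENNReal.ofReal_inv_of_pos (by norm_num)]; norm_num
            simp_rw [this]
            rw [ENNReal.tsum_geometric_add_one]
            rw [ENNReal.one_sub_inv_two, inv_inv]
            rw [ENNReal.inv_mul_cancel (by norm_num) (by norm_num)]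
      _ = 2 := by norm_num
  have key := Measure.hausdorffMeasure_le_liminf_tsum (X := ℝ × ℝ) (β := ℕ)
    (ι := fun n => Σ i : ℕ, Fin (⌈1 / ρ n i⌉₊ + 1)) ((v : ℝ) + 1) (A ×ˢ Icc a b : Set (ℝ × ℝ))
    (l := atTop) (fun n => ENNReal.ofReal (1 / ((n : ℝ) + 1)))
    (by
      rw [← ENNReal.ofReal_zero]
      exact ENNReal.tendsto_ofReal tendsto_one_div_add_atTop_nhds_zero_nat)
    (fun n p => t n p.1 ×ˢ Icc (a + p.2 * ρ n p.1) (a + (p.2 + 1) * ρ n p.1))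
  have hdU : ∀ n (p : Σ i : ℕ, Fin (⌈1 / ρ n i⌉₊ + 1)),
      ediam (t n p.1 ×ˢ Icc (a + p.2 * ρ n p.1) (a + (p.2 + 1) * ρ n p.1)) ≤
        ENNReal.ofReal (ρ n p.1) := by
    intro n p
    apply Metric.ediam_le
    rintro ⟨x1, x2⟩ ⟨hx1, hx2⟩ ⟨y1, y2⟩ ⟨hy1, hy2⟩
    rw [Prod.edist_eq]
    refine max_le ((edist_le_ediam_of_mem hx1 hy1).trans (hdρ n p.1)) ?_
    refine (edist_le_ediam_of_mem hx2 hy2).trans ?_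
    rw [Real.ediam_Icc]
    apply ENNReal.ofReal_le_ofReal
    ring_nf; rfl
  have key2 := key (Eventually.of_forall fun n p => (hdU n p).trans
      (ENNReal.ofReal_le_ofReal (hρle n p.1)))
    (Eventually.of_forall fun n => by
      rintro ⟨x, y⟩ ⟨hx, hy⟩
      obtain ⟨i, hi⟩ := mem_iUnion.1 (ht1 n hx)
      have hy0 : 0 ≤ (y - a) / ρ n i := div_nonneg (by linarith [hy.1]) (hρ n i).le
      have hlt : ⌊(y - a) / ρ n i⌋₊ < ⌈1 / ρ n i⌉₊ + 1 := by
        apply Nat.lt_succ_of_le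
        have : (y - a) / ρ n i ≤ 1 / ρ n i := by
          gcongr
          linarith [hy.2]
        exact (Nat.floor_mono this).trans (Nat.floor_le_ceil _)
      refine mem_iUnion.2 ⟨⟨i, ⟨_, hlt⟩⟩, hi, ?_, ?_⟩
      · have := Nat.floor_le hy0
        rw [le_div_iff₀ (hρ n i)] at this
        simp only; linarith
      · have := Nat.lt_floor_add_one ((y - a) / ρ n i)
        rw [div_lt_iff₀ (hρ n i)] at this
        simp only; linarith)
  have hsum : ∀ n, ∑' p : (Σ i : ℕ, Fin (⌈1 / ρ n i⌉₊ + 1)),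
      ediam (t n p.1 ×ˢ Icc (a + p.2 * ρ n p.1) (a + (p.2 + 1) * ρ n p.1)) ^ ((v : ℝ) + 1) ≤ 6 := by
    intro n
    calc _ ≤ ∑' p : (Σ i : ℕ, Fin (⌈1 / ρ n i⌉₊ + 1)),
          ENNReal.ofReal (ρ n p.1) ^ ((v : ℝ) + 1) :=
          ENNReal.tsum_le_tsum fun p => ENNReal.rpow_le_rpow (hdU n p) (by positivity)
      _ = ∑' i, ∑' _ : Fin (⌈1 / ρ n i⌉₊ + 1), ENNReal.ofReal (ρ n i) ^ ((v : ℝ) + 1) :=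
          ENNReal.tsum_sigma' _
      _ ≤ ∑' i, 3 * ENNReal.ofReal ((ρ n i) ^ (v : ℝ)) := by
          refine ENNReal.tsum_le_tsum fun i => ?_
          rw [tsum_fintype, Finset.sum_const, Finset.card_univ, Fintype.card_fin, nsmul_eq_mul,
            ENNReal.ofReal_rpow_of_pos (hρ n i)]
          have h3 : (3 : ℝ≥0∞) = ENNReal.ofReal 3 := by norm_num
          rw [h3, ← ENNReal.ofReal_natCast, ← ENNReal.ofReal_mul (by positivity),
            ← ENNReal.ofReal_mul (by positivity)]
          apply ENNReal.ofReal_le_ofReal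
          rw [Real.rpow_add (hρ n i), Real.rpow_one]
          have h4 : ((⌈1 / ρ n i⌉₊ + 1 : ℕ) : ℝ) * ρ n i ≤ 3 := by
            push_cast
            have h5 := Nat.ceil_lt_add_one (a := 1 / ρ n i) (by have := hρ n i; positivity)
            have h6 : (1 / ρ n i) * ρ n i = 1 := one_div_mul_cancel (hρ n i).ne'
            nlinarith [hρ n i, hρ1 n i]
          have h7 : 0 ≤ (ρ n i) ^ (v : ℝ) := by have := hρ n i; positivity
          nlinarith
      _ = 3 * ∑' i, ENNReal.ofReal ((ρ n i) ^ (v : ℝ)) := ENNReal.tsum_mul_left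
      _ ≤ 3 * 2 := by gcongr; exact hsumρ n
      _ = 6 := by norm_num
  have h6 : μH[((v + 1 : ℝ≥0) : ℝ)] (A ×ˢ Icc a b : Set (ℝ × ℝ)) ≤ 6 := by
    push_cast
    refine key2.trans ?_
    refine (liminf_le_liminf (Eventually.of_forall hsum)).trans ?_
    rw [liminf_const]
  have h7 := dimH_le_of_hausdorffMeasure_ne_top
    (ne_of_lt (lt_of_le_of_lt h6 (by norm_num)))
  push_cast at h7
  exact absurd hv2 (not_lt.2 h7)

lemma dimH_prod_univ_le (A : Set ℝ) :
    dimH (A ×ˢ univ : Set (ℝ × ℝ)) ≤ dimH A + 1 := by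
  have : (A ×ˢ univ : Set (ℝ × ℝ)) ⊆ ⋃ n : ℤ, A ×ˢ Icc (n : ℝ) (n + 1) := by
    rintro ⟨x, y⟩ ⟨hx, -⟩
    exact mem_iUnion.2 ⟨⌊y⌋, hx, Int.floor_le y, (Int.lt_floor_add_one y).le⟩
  refine (dimH_mono this).trans ?_
  rw [dimH_iUnion]
  exact iSup_le fun n => dimH_prod_Icc_le A _ _ (by linarith) le_rfl

/-- Lower bound of the dimension by counting. -/
lemma le_dimH_of_counting {X : Type*} [MetricSpace X] [MeasurableSpace X] [BorelSpace X]
    (F : ℕ → Set X) (hF : ∀ j, IsCompact (F j)) (hanti : Antitone F)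
    (δ : ℕ → ℝ) (hδ0 : Tendsto δ atTop (𝓝 0))
    (d C : ℝ) (hd : 0 < d) (hC : 0 < C)
    {ι : Type*} (T : ℕ → Finset ι) (hT : ∀ j, (T j).Nonempty) (q : ℕ → ι → X)
    (hq : ∀ j, ∀ n ∈ T j, q j n ∈ F j)
    (hcount : ∀ j (ρ : ℝ) (I : Finset ι) (_ : I ⊆ T j), δ j ≤ ρ → ρ ≤ 1 →
      (∀ n ∈ I, ∀ m ∈ I, dist (q j n) (q j m) ≤ ρ) → (I.card : ℝ) ≤ C * ρ ^ d * (T j).card) :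
    ENNReal.ofReal d ≤ dimH (⋂ j, F j) := by
  classical
  -- the constant
  let c : ℝ := 1 / (4 * C * 2 ^ d)
  have hc : 0 < c := by positivity
  have hcC : C * 2 ^ d * (2 * c) = 1 / 2 := by
    have : (2 : ℝ) ^ d ≠ 0 := by positivity
    simp only [c]; field_simp; norm_num
  have hne : μH[(d.toNNReal : ℝ)] (⋂ j, F j) ≠ 0 := by
    rw [Real.coe_toNNReal d hd.le]
    intro hz
    rw [Measure.hausdorffMeasure_apply] at hz
    have hpos : (0 : ℝ≥0∞) < ENNReal.ofReal (1 / 8) := by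
      rw [ENNReal.ofReal_pos]; positivity
    have h2 := le_iSup₂ (f := fun (r : ℝ≥0∞) (_ : 0 < r) =>
        ⨅ (t : ℕ → Set X) (_ : (⋂ j, F j) ⊆ ⋃ n, t n) (_ : ∀ n, ediam (t n) ≤ r),
          ∑' n, ⨆ _ : (t n).Nonempty, ediam (t n) ^ d) _ hpos
    rw [hz] at h2
    have h3 := lt_of_le_of_lt h2 (ENNReal.ofReal_pos.2 hc)
    simp only [iInf_lt_iff] at h3
    obtain ⟨t, ht1, ht2, ht3⟩ := h3
    have hfin : ∀ i, ediam (t i) ≠ ∞ := fun i => ((ht2 i).trans_lt ENNReal.ofReal_lt_top).ne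
    let Di : ℕ → ℝ := fun i => (ediam (t i)).toReal
    have hDi8 : ∀ i, Di i ≤ 1 / 8 := fun i =>
      ENNReal.toReal_le_of_le_ofReal (by positivity) (ht2 i)
    have hDsum : ∀ I : Finset ℕ, ∑ i ∈ I, (Di i) ^ d ≤ c := by
      intro I
      have : ENNReal.ofReal (∑ i ∈ I, (Di i) ^ d) ≤ ENNReal.ofReal c := by
        rw [ENNReal.ofReal_sum_of_nonneg (fun i _ => by positivity)]
        refine le_trans ?_ ht3.le
        refine le_trans ?_ (ENNReal.sum_le_tsum I)
        refine Finset.sum_le_sum fun i _ => ?_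
        simp only [Di]
        rw [← ENNReal.ofReal_rpow_of_nonneg ENNReal.toReal_nonneg hd.le,
          ENNReal.ofReal_toReal (hfin i)]
        rcases (t i).eq_empty_or_nonempty with he | hne
        · rw [he]; simp [hd]
        · simp [hne]
      exact (ENNReal.ofReal_le_ofReal_iff hc.le).1 this
    let τ : ℕ → ℝ := fun i => min (1 / 8) ((c * (1 / 2 : ℝ) ^ (i + 1)) ^ (1 / d))
    have hτ : ∀ i, 0 < τ i := fun i => lt_min (by positivity) (by positivity)
    have hτd : ∀ i, (τ i) ^ d ≤ c * (1 / 2 : ℝ) ^ (i + 1) := by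
      intro i
      calc (τ i) ^ d ≤ ((c * (1 / 2 : ℝ) ^ (i + 1)) ^ (1 / d)) ^ d :=
            Real.rpow_le_rpow (hτ i).le (min_le_right _ _) hd.le
        _ = _ := by
            rw [← Real.rpow_mul (by positivity), one_div_mul_cancel hd.ne', Real.rpow_one]
    have hτsum : ∀ I : Finset ℕ, ∑ i ∈ I, (τ i) ^ d ≤ c := by
      intro I
      calc ∑ i ∈ I, (τ i) ^ d ≤ ∑ i ∈ I, c * (1 / 2 : ℝ) ^ (i + 1) :=
            Finset.sum_le_sum fun i _ => hτd i
        _ = (c / 2) * ∑ i ∈ I, (1 / 2 : ℝ) ^ i := by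
            rw [Finset.mul_sum]; refine Finset.sum_congr rfl fun i _ => ?_; ring
        _ ≤ (c / 2) * 2 := by
            gcongr
            exact (summable_geometric_two.sum_le_tsum I (fun i _ => by positivity)).trans_eq
              tsum_geometric_two
        _ = c := by ring
    let ρ : ℕ → ℝ := fun i => 2 * max (Di i) (τ i)
    have hρ : ∀ i, 0 < ρ i := fun i => by
      have := lt_max_of_lt_right (b := Di i) (hτ i)
      simp only [ρ]; positivity
    have hρ1 : ∀ i, ρ i ≤ 1 := fun i => by
      have : max (Di i) (τ i) ≤ 1 / 8 := max_le (hDi8 i) (min_le_left _ _)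
      simp only [ρ]; linarith
    have hρd : ∀ i, (ρ i) ^ d ≤ 2 ^ d * ((Di i) ^ d + (τ i) ^ d) := by
      intro i
      simp only [ρ]
      have hD0 : 0 ≤ Di i := ENNReal.toReal_nonneg
      rw [Real.mul_rpow (by norm_num) (le_max_of_le_left hD0)]
      gcongr
      rcases le_total (Di i) (τ i) with h | h
      · rw [max_eq_right h]; linarith [Real.rpow_nonneg hD0 d]
      · rw [max_eq_left h]; linarith [Real.rpow_nonneg (hτ i).le d]
    let V : ℕ → Set X := fun i => thickening (ρ i / 4) (t i)
    have hVd : ∀ i, ∀ x ∈ V i, ∀ y ∈ V i, dist x y ≤ ρ i := by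
      intro i x hx y hy
      obtain ⟨x', hx', hxx⟩ := mem_thickening_iff.1 hx
      obtain ⟨y', hy', hyy⟩ := mem_thickening_iff.1 hy
      have h1 : dist x' y' ≤ Di i := by
        rw [dist_edist]
        exact ENNReal.toReal_mono (hfin i) (edist_le_ediam_of_mem hx' hy')
      have h2 : Di i ≤ ρ i / 2 := by simp only [ρ]; linarith [le_max_left (Di i) (τ i)]
      have h3 := dist_triangle4 x x' y' y
      rw [dist_comm y' y] at h3
      linarith
    have hEc : IsCompact (⋂ j, F j) := (hF 0).of_isClosed_subset
      (isClosed_iInter fun j => (hF j).isClosed) (iInter_subset _ 0)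
    have hcovV : (⋂ j, F j) ⊆ ⋃ i, V i := by
      intro x hx
      obtain ⟨i, hi⟩ := mem_iUnion.1 (ht1 hx)
      exact mem_iUnion.2 ⟨i, self_subset_thickening (by have := hρ i; positivity) _ hi⟩
    obtain ⟨I, hI⟩ := hEc.elim_finite_subcover V (fun i => isOpen_thickening) hcovV
    obtain ⟨j0, hj0⟩ := exists_subset_nhds_of_isCompact (V := F)
      (fun i j => ⟨max i j, hanti (le_max_left _ _), hanti (le_max_right _ _)⟩) hF
      (U := ⋃ i ∈ I, V i)
      (fun x hx => IsOpen.mem_nhds (isOpen_biUnion fun i _ => isOpen_thickening) (hI hx))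
    have hev : ∀ᶠ j in atTop, ∀ i ∈ I, δ j ≤ ρ i := by
      rw [Filter.eventually_all_finset]
      intro i _
      exact (hδ0.eventually (gt_mem_nhds (hρ i))).mono fun j hj => le_of_lt hj
    obtain ⟨j, hj, hjj⟩ := (hev.and (eventually_ge_atTop j0)).exists
    have hsub : T j ⊆ I.biUnion fun i => (T j).filter fun n => q j n ∈ V i := by
      intro n hn
      have := hj0 (hanti hjj (hq j n hn))
      simp only [mem_iUnion] at this
      obtain ⟨i, hi, hx⟩ := this
      exact Finset.mem_biUnion.2 ⟨i, hi, Finset.mem_filter.2 ⟨hn, hx⟩⟩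
    have hTpos : (0 : ℝ) < (T j).card := by exact_mod_cast (hT j).card_pos
    have h4 : ((T j).card : ℝ) ≤ ∑ i ∈ I, C * (ρ i) ^ d * (T j).card := by
      calc ((T j).card : ℝ)
          ≤ ((I.biUnion fun i => (T j).filter fun n => q j n ∈ V i).card : ℝ) := by
            exact_mod_cast Finset.card_le_card hsub
        _ ≤ ((∑ i ∈ I, ((T j).filter fun n => q j n ∈ V i).card : ℕ) : ℝ) := by
            exact_mod_cast Finset.card_biUnion_le
        _ = ∑ i ∈ I, (((T j).filter fun n => q j n ∈ V i).card : ℝ) := by push_cast; rfl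
        _ ≤ _ := Finset.sum_le_sum fun i hi => hcount j (ρ i) _ (Finset.filter_subset _ _)
            (hj i hi) (hρ1 i) fun n hn m hm =>
              hVd i _ (Finset.mem_filter.1 hn).2 _ (Finset.mem_filter.1 hm).2
    have h5 : ∑ i ∈ I, C * (ρ i) ^ d * (T j).card ≤ (C * 2 ^ d * (2 * c)) * (T j).card := by
      rw [← Finset.sum_mul, ← Finset.mul_sum]
      refine mul_le_mul_of_nonneg_right ?_ hTpos.le
      rw [mul_assoc]
      refine mul_le_mul_of_nonneg_left ?_ hC.le
      calc ∑ i ∈ I, (ρ i) ^ d ≤ ∑ i ∈ I, 2 ^ d * ((Di i) ^ d + (τ i) ^ d) :=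
            Finset.sum_le_sum fun i _ => hρd i
        _ = 2 ^ d * (∑ i ∈ I, (Di i) ^ d + ∑ i ∈ I, (τ i) ^ d) := by
            rw [← Finset.mul_sum, Finset.sum_add_distrib]
        _ ≤ 2 ^ d * (2 * c) := by
            gcongr
            linarith [hDsum I, hτsum I]
    rw [hcC] at h5
    linarith
  exact le_dimH_of_hausdorffMeasure_ne_zero hne

end HP


namespace HP

open Filter Topology

open Classical in
/-- A point of `S` at distance at most `R` from `y`, if there is one. -/
def pick (S : Set ℝ) (R y : ℝ) : ℝ := if h : ∃ q ∈ S, |q - y| ≤ R then h.choose else y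

lemma pick_spec {S : Set ℝ} {R y : ℝ} (h : ∃ q ∈ S, |q - y| ≤ R) :
    pick S R y ∈ S ∧ |pick S R y - y| ≤ R := by
  unfold pick
  rw [dif_pos h]
  exact h.choose_spec

/-- Branching numbers. -/
def aa (δ R : ℕ → ℝ) (j : ℕ) : ℕ := ⌊δ j / (4 * R j)⌋₊

/-- Number of intervals at a level. -/
def NN (δ R : ℕ → ℝ) : ℕ → ℕ
  | 0 => 1
  | j + 1 => NN δ R j * aa δ R j

/-- Left end points of the intervals at a level. -/
def qq (δ R : ℕ → ℝ) (S : ℕ → Set ℝ) (p : ℝ) : ℕ → ℕ → ℝ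
  | 0, _ => p
  | j + 1, n => pick (S j) (R j)
      (qq δ R S p j (n / aa δ R j) + R j + 4 * R j * ((n % aa δ R j : ℕ) : ℝ))

/-- The hypotheses on a Cantor type construction. -/
structure Casc (δ R : ℕ → ℝ) (S : ℕ → Set ℝ) (p : ℝ) : Prop where
  zero : δ 0 = 1
  pos : ∀ j, 0 < δ j
  le : ∀ j, δ (j + 1) ≤ R j
  four : ∀ j, 4 * R j ≤ δ j
  dense : ∀ j y, p ≤ y → y ≤ p + 1 → ∃ q ∈ S j, |q - y| ≤ R j

/-- The limit set. -/
def LS (δ : ℕ → ℝ) (S : ℕ → Set ℝ) (p : ℝ) : Set ℝ :=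
  {x | x ∈ Icc p (p + 1) ∧ ∀ j, ∃ q ∈ S j, |x - q| ≤ δ (j + 1)}

/-- The approximating sets. -/
def FF (δ R : ℕ → ℝ) (S : ℕ → Set ℝ) (p : ℝ) (j : ℕ) : Set ℝ :=
  ⋃ n ∈ Finset.range (NN δ R j), Icc (qq δ R S p j n) (qq δ R S p j n + δ j)

namespace Casc

variable {δ R : ℕ → ℝ} {S : ℕ → Set ℝ} {p : ℝ}

lemma Rpos (h : Casc δ R S p) (j : ℕ) : 0 < R j := (h.pos (j + 1)).trans_le (h.le j)

lemma aa_pos (h : Casc δ R S p) (j : ℕ) : 0 < aa δ R j := by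
  unfold aa
  rw [Nat.floor_pos, le_div_iff₀ (by have := h.Rpos j; positivity)]
  linarith [h.four j]

lemma aa_le (h : Casc δ R S p) (j : ℕ) : 4 * R j * aa δ R j ≤ δ j := by
  have h1 := Nat.floor_le (a := δ j / (4 * R j)) (by have := h.Rpos j; have := h.pos j; positivity)
  rw [le_div_iff₀ (by have := h.Rpos j; positivity)] at h1
  unfold aa; linarith

lemma le_aa (h : Casc δ R S p) (j : ℕ) : δ j ≤ 8 * R j * aa δ R j := by
  have h1 := Nat.lt_floor_add_one (δ j / (4 * R j))
  rw [div_lt_iff₀ (by have := h.Rpos j; positivity)] at h1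
  have h2 : (1 : ℝ) ≤ aa δ R j := by exact_mod_cast h.aa_pos j
  have h3 := h.Rpos j
  change _ < ((aa δ R j : ℝ) + 1) * _ at h1
  nlinarith

lemma NN_pos (h : Casc δ R S p) (j : ℕ) : 0 < NN δ R j := by
  induction j with
  | zero => exact Nat.one_pos
  | succ j ih => exact Nat.mul_pos ih (h.aa_pos j)

lemma anc_lt (h : Casc δ R S p) {j n : ℕ} (hn : n < NN δ R (j + 1)) :
    n / aa δ R j < NN δ R j := by
  rw [Nat.div_lt_iff_lt_mul (h.aa_pos j)]; exact hn

lemma main (h : Casc δ R S p) (j : ℕ) : ∀ n < NN δ R j,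
    p ≤ qq δ R S p j n ∧ qq δ R S p j n + δ j ≤ p + 1 := by
  induction j with
  | zero => intro n _; simp [qq, h.zero]
  | succ j ih =>
    intro n hn
    obtain ⟨h1, h2⟩ := ih _ (h.anc_lt hn)
    have hR := h.Rpos j
    have hm : ((n % aa δ R j : ℕ) : ℝ) + 1 ≤ aa δ R j := by
      exact_mod_cast Nat.mod_lt n (h.aa_pos j)
    have h4 := h.aa_le j
    have hm0 : (0 : ℝ) ≤ ((n % aa δ R j : ℕ) : ℝ) := by positivity
    have h5 : 4 * R j * ((n % aa δ R j : ℕ) : ℝ) + 4 * R j ≤ δ j := by nlinarith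
    have h6 : 0 ≤ 4 * R j * ((n % aa δ R j : ℕ) : ℝ) := by positivity
    have := (pick_spec (h.dense j (qq δ R S p j (n / aa δ R j) + R j +
      4 * R j * ((n % aa δ R j : ℕ) : ℝ)) (by linarith) (by linarith))).2
    rw [abs_le] at this
    have h7 := h.le j
    constructor <;> simp only [qq] <;> linarith

lemma step (h : Casc δ R S p) (j n : ℕ) (hn : n < NN δ R (j + 1)) :
    qq δ R S p (j + 1) n ∈ S j ∧
    |qq δ R S p (j + 1) n - (qq δ R S p j (n / aa δ R j) + R j +
      4 * R j * ((n % aa δ R j : ℕ) : ℝ))| ≤ R j ∧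
    qq δ R S p j (n / aa δ R j) ≤ qq δ R S p (j + 1) n ∧
    qq δ R S p (j + 1) n + 2 * R j ≤ qq δ R S p j (n / aa δ R j) + δ j := by
  obtain ⟨h1, h2⟩ := h.main j _ (h.anc_lt hn)
  have hR := h.Rpos j
  have hm : ((n % aa δ R j : ℕ) : ℝ) + 1 ≤ aa δ R j := by
    exact_mod_cast Nat.mod_lt n (h.aa_pos j)
  have h4 := h.aa_le j
  have h5 : 4 * R j * ((n % aa δ R j : ℕ) : ℝ) + 4 * R j ≤ δ j := by nlinarith
  have h6 : 0 ≤ 4 * R j * ((n % aa δ R j : ℕ) : ℝ) := by positivity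
  have h8 := pick_spec (h.dense j (qq δ R S p j (n / aa δ R j) + R j +
      4 * R j * ((n % aa δ R j : ℕ) : ℝ)) (by linarith) (by linarith))
  have h9 := h8.2
  rw [abs_le] at h9
  refine ⟨h8.1, h8.2, ?_, ?_⟩ <;> simp only [qq] <;> linarith

lemma gap (h : Casc δ R S p) (j : ℕ) : ∀ m < NN δ R (j + 1), ∀ n < m,
    qq δ R S p (j + 1) n + 2 * R j ≤ qq δ R S p (j + 1) m := by
  induction j with
  | zero =>
    intro m hm n hnm
    have hn := hnm.trans hm
    obtain ⟨-, h1, -, -⟩ := h.step 0 m hm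
    obtain ⟨-, h2, -, -⟩ := h.step 0 n hn
    rw [abs_le] at h1 h2
    simp only [NN, one_mul, zero_add] at hm hn
    rw [Nat.mod_eq_of_lt hm, Nat.div_eq_of_lt hm] at h1
    rw [Nat.mod_eq_of_lt hn, Nat.div_eq_of_lt hn] at h2
    have h3 : (n : ℝ) + 1 ≤ m := by exact_mod_cast hnm
    have hR := h.Rpos 0
    nlinarith
  | succ j ih =>
    intro m hm n hnm
    have hn := hnm.trans hm
    have hd : n / aa δ R (j + 1) ≤ m / aa δ R (j + 1) := Nat.div_le_div_right hnm.le
    obtain ⟨-, h1, h1', -⟩ := h.step (j + 1) m hm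
    obtain ⟨-, h2, -, h2'⟩ := h.step (j + 1) n hn
    have hR := h.Rpos (j + 1)
    rcases hd.lt_or_eq with hd | hd
    · have h3 := ih _ (h.anc_lt hm) _ hd
      have h4 := h.le j
      have h5 := h.pos (j + 1)
      linarith
    · rw [hd] at h2
      rw [abs_le] at h1 h2
      have h3 : n % aa δ R (j + 1) + 1 ≤ m % aa δ R (j + 1) := by
        have e1 := Nat.div_add_mod n (aa δ R (j + 1))
        have e2 := Nat.div_add_mod m (aa δ R (j + 1))
        rw [hd] at e1
        omega
      have h3 : ((n % aa δ R (j + 1) : ℕ) : ℝ) + 1 ≤ ((m % aa δ R (j + 1) : ℕ) : ℝ) := by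
        exact_mod_cast h3
      nlinarith

lemma gap' (h : Casc δ R S p) (j k n : ℕ) (hk : n + k < NN δ R (j + 1)) :
    qq δ R S p (j + 1) n + 2 * R j * k ≤ qq δ R S p (j + 1) (n + k) := by
  induction k with
  | zero => simp
  | succ k ih =>
    have h1 := ih (by omega)
    have h2 := h.gap j (n + (k + 1)) hk (n + k) (by omega)
    push_cast
    linarith

lemma anc (h : Casc δ R S p) (j : ℕ) : ∀ J, j ≤ J → ∃ b : ℕ, 0 < b ∧
    NN δ R J = NN δ R j * b ∧ ∀ n < NN δ R J, n / b < NN δ R j ∧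
      qq δ R S p j (n / b) ≤ qq δ R S p J n ∧
      qq δ R S p J n + δ J ≤ qq δ R S p j (n / b) + δ j := by
  intro J hJ
  induction J, hJ using Nat.le_induction with
  | base => exact ⟨1, Nat.one_pos, by simp, fun n hn => by simp [hn]⟩
  | succ J hJ ih =>
    obtain ⟨b, hb, hN, hq⟩ := ih
    refine ⟨b * aa δ R J, Nat.mul_pos hb (h.aa_pos J), by simp [NN, hN, mul_assoc], ?_⟩
    intro n hn
    obtain ⟨h1, h2, h3⟩ := hq _ (h.anc_lt hn)
    obtain ⟨-, -, h4, h5⟩ := h.step J n hn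
    rw [mul_comm b, ← Nat.div_div_eq_div_mul]
    have h6 := h.le J
    have h7 := h.Rpos J
    exact ⟨h1, h2.trans h4, by linarith⟩

lemma count (h : Casc δ R S p) {j J : ℕ} (hJ : j + 1 ≤ J) (ρ : ℝ) (hρ : 0 ≤ ρ) (I : Finset ℕ)
    (hI : I ⊆ Finset.range (NN δ R J))
    (hd : ∀ n ∈ I, ∀ m ∈ I, |qq δ R S p J n - qq δ R S p J m| ≤ ρ) :
    (I.card : ℝ) * NN δ R (j + 1) ≤ (ρ / (2 * R j) + 2) * NN δ R J := by
  classical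
  obtain ⟨b, hb, hN, hq⟩ := h.anc (j + 1) J hJ
  have hR := h.Rpos j
  rcases I.eq_empty_or_nonempty with rfl | hne
  · simp; positivity
  have hA : ((I.image (· / b)).card : ℝ) ≤ ρ / (2 * R j) + 2 := by
    have hne' : (I.image (· / b)).Nonempty := hne.image _
    set A := I.image (· / b)
    obtain ⟨n0, hn0, hn0'⟩ := Finset.mem_image.1 (A.min'_mem hne')
    obtain ⟨n1, hn1, hn1'⟩ := Finset.mem_image.1 (A.max'_mem hne')
    have hle : A.min' hne' ≤ A.max' hne' := A.min'_le_max' hne'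
    have hsub : A ⊆ Finset.Icc (A.min' hne') (A.max' hne') := fun x hx =>
      Finset.mem_Icc.2 ⟨A.min'_le x hx, A.le_max' x hx⟩
    have hc := Finset.card_le_card hsub
    rw [Nat.card_Icc] at hc
    obtain ⟨k, hk⟩ := Nat.exists_eq_add_of_le hle
    obtain ⟨a1, a2, a3⟩ := hq n0 (Finset.mem_range.1 (hI hn0))
    obtain ⟨b1, b2, b3⟩ := hq n1 (Finset.mem_range.1 (hI hn1))
    rw [hn0'] at a1 a2 a3
    rw [hn1', hk] at b1 b2 b3
    have h1 := h.gap' j k _ b1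
    have h2 := (abs_le.1 (hd n1 hn1 n0 hn0)).2
    have h3 := h.le j
    have h4 := h.pos J
    have h5 : 2 * R j * k ≤ ρ + R j := by linarith
    have h6 : (A.card : ℝ) ≤ k + 1 := by
      have : A.card ≤ k + 1 := by omega
      exact_mod_cast this
    have h7 : (k : ℝ) ≤ ρ / (2 * R j) + 1 := by
      have : (k : ℝ) ≤ (ρ + R j) / (2 * R j) := by
        rw [le_div_iff₀ (by positivity)]; linarith
      refine this.trans ?_
      rw [add_div]
      have : R j / (2 * R j) ≤ 1 := by rw [div_le_one (by positivity)]; linarith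
      linarith
    linarith
  have hcard : I.card ≤ (I.image (· / b)).card * b := by
    rw [mul_comm]
    apply Finset.card_le_mul_card_image
    intro a _
    calc (I.filter (fun x => x / b = a)).card ≤ (Finset.Ico (a * b) (a * b + b)).card := by
          apply Finset.card_le_card
          intro x hx
          obtain ⟨-, hx⟩ := Finset.mem_filter.1 hx
          rw [Nat.div_eq_iff hb] at hx
          rw [Finset.mem_Ico]
          omega
      _ = b := by simp
  have hcard' : (I.card : ℝ) ≤ ((I.image (· / b)).card : ℝ) * b := by exact_mod_cast hcard
  rw [hN]
  push_cast
  calc (I.card : ℝ) * NN δ R (j + 1) ≤ ((ρ / (2 * R j) + 2) * b) * NN δ R (j + 1) := by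
        gcongr
        exact hcard'.trans (by gcongr)
    _ = _ := by ring

lemma FF_compact (_ : Casc δ R S p) (j : ℕ) : IsCompact (FF δ R S p j) :=
  (Finset.range _).isCompact_biUnion fun _ _ => isCompact_Icc

lemma FF_anti (h : Casc δ R S p) : Antitone (FF δ R S p) := by
  intro j J hJ x hx
  obtain ⟨b, hb, hN, hq⟩ := h.anc j J hJ
  simp only [FF, mem_iUnion, Finset.mem_range, exists_prop] at hx ⊢
  obtain ⟨n, hn, hx⟩ := hx
  obtain ⟨h1, h2, h3⟩ := hq n hn
  exact ⟨_, h1, h2.trans hx.1, hx.2.trans h3⟩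

lemma FF_sub (h : Casc δ R S p) : ⋂ j, FF δ R S p j ⊆ LS δ S p := by
  intro x hx
  rw [mem_iInter] at hx
  constructor
  · have := hx 0
    simpa [FF, NN, qq, h.zero] using this
  · intro j
    have := hx (j + 1)
    simp only [FF, mem_iUnion, Finset.mem_range, exists_prop] at this
    obtain ⟨n, hn, hx1, hx2⟩ := this
    refine ⟨_, (h.step j n hn).1, ?_⟩
    rw [abs_of_nonneg (by linarith)]
    linarith

end Casc

/-- The lower bound for the dimension of a product of two Cantor type sets. -/
theorem le_dimH_LS_prod {δ R₁ R₂ : ℕ → ℝ} {S₁ S₂ : ℕ → Set ℝ} {p₁ p₂ : ℝ} (σ : ℝ)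
    (hσ0 : 0 ≤ σ) (hσ1 : σ ≤ 1)
    (h₁ : Casc δ R₁ S₁ p₁) (h₂ : Casc δ R₂ S₂ p₂) (hδ : Tendsto δ atTop (𝓝 0))
    (hR₁ : ∀ j, R₁ j ≤ δ j ^ (1 - σ) * δ (j + 1) ^ σ)
    (hR₂ : ∀ j, R₂ j ≤ δ j ^ (1 - σ) * δ (j + 1) ^ σ)
    (hR : ∀ j, 64 * (R₁ j * R₂ j) ≤ δ j ^ (1 - σ) * δ (j + 1) ^ (1 + σ)) :
    ENNReal.ofReal (1 + σ) ≤ dimH (LS δ S₁ p₁ ×ˢ LS δ S₂ p₂ : Set (ℝ × ℝ)) := by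
  have hpos := h₁.pos
  have hN : ∀ j, δ j ^ (-(1 + σ)) ≤ (NN δ R₁ j : ℝ) * NN δ R₂ j := by
    intro j
    induction j with
    | zero => simp [h₁.zero, NN]
    | succ j ih =>
      have a1 := h₁.le_aa j
      have a2 := h₂.le_aa j
      have r1 := h₁.Rpos j
      have r2 := h₂.Rpos j
      have d1 := hpos j
      have d2 := hpos (j + 1)
      have e1 : δ j * δ j ≤ 64 * (R₁ j * R₂ j) * ((aa δ R₁ j : ℝ) * aa δ R₂ j) := by
        calc δ j * δ j ≤ (8 * R₁ j * aa δ R₁ j) * (8 * R₂ j * aa δ R₂ j) := by gcongr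
          _ = _ := by ring
      have e2 : δ j * δ j ≤ (δ j ^ (1 - σ) * δ (j + 1) ^ (1 + σ)) *
          ((aa δ R₁ j : ℝ) * aa δ R₂ j) := e1.trans (mul_le_mul_of_nonneg_right (hR j) (by positivity))
      have e3 : δ j * δ j = δ j ^ (1 - σ) * δ j ^ (1 + σ) := by
        rw [← Real.rpow_add d1]; norm_num; rw [sq]
      rw [e3, mul_assoc] at e2
      have e4 : δ j ^ (1 + σ) ≤ δ (j + 1) ^ (1 + σ) * ((aa δ R₁ j : ℝ) * aa δ R₂ j) :=
        le_of_mul_le_mul_left e2 (by positivity)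
      rw [Real.rpow_neg d1.le] at ih
      rw [Real.rpow_neg d2.le]
      simp only [NN]
      push_cast
      rw [inv_le_iff_one_le_mul₀ (by positivity)] at ih ⊢
      calc (1 : ℝ) ≤ NN δ R₁ j * NN δ R₂ j * δ j ^ (1 + σ) := ih
        _ ≤ NN δ R₁ j * NN δ R₂ j * (δ (j + 1) ^ (1 + σ) * ((aa δ R₁ j : ℝ) * aa δ R₂ j)) := by
            gcongr
        _ = _ := by ring
  have hanti : Antitone δ := by
    apply antitone_nat_of_succ_le
    intro j
    linarith [h₁.le j, h₁.four j, h₁.Rpos j]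
  have hsub : (⋂ j, FF δ R₁ S₁ p₁ j ×ˢ FF δ R₂ S₂ p₂ j : Set (ℝ × ℝ)) ⊆
      LS δ S₁ p₁ ×ˢ LS δ S₂ p₂ := by
    rintro ⟨x, y⟩ hxy
    simp only [mem_iInter, mem_prod] at hxy
    exact ⟨h₁.FF_sub (mem_iInter.2 fun j => (hxy j).1), h₂.FF_sub (mem_iInter.2 fun j => (hxy j).2)⟩
  refine le_trans ?_ (dimH_mono hsub)
  refine le_dimH_of_counting (fun j => FF δ R₁ S₁ p₁ j ×ˢ FF δ R₂ S₂ p₂ j)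
    (fun j => (h₁.FF_compact j).prod (h₂.FF_compact j))
    (fun i j hij => prod_mono (h₁.FF_anti hij) (h₂.FF_anti hij)) δ hδ (1 + σ) 1024
    (by linarith) (by norm_num)
    (fun j => Finset.range (NN δ R₁ j) ×ˢ Finset.range (NN δ R₂ j))
    (fun j => Finset.Nonempty.product ⟨0, Finset.mem_range.2 (h₁.NN_pos j)⟩
      ⟨0, Finset.mem_range.2 (h₂.NN_pos j)⟩)
    (fun j n => (qq δ R₁ S₁ p₁ j n.1, qq δ R₂ S₂ p₂ j n.2)) ?_ ?_
  · rintro j ⟨n1, n2⟩ hn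
    obtain ⟨hn1, hn2⟩ := Finset.mem_product.1 hn
    simp only [FF, mem_prod, mem_iUnion, exists_prop]
    exact ⟨⟨n1, hn1, le_rfl, by linarith [hpos j]⟩, ⟨n2, hn2, le_rfl, by linarith [hpos j]⟩⟩
  · intro J ρ I hI hJρ hρ1 hdist
    have hρ : 0 < ρ := (hpos J).trans_le hJρ
    rw [Finset.card_product, Finset.card_range, Finset.card_range]
    push_cast
    rcases Nat.eq_zero_or_pos J with rfl | hJpos
    · have : ρ = 1 := le_antisymm hρ1 (by rw [← h₁.zero]; exact hJρ)
      subst this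
      have h3 := Finset.card_le_card hI
      rw [Finset.card_product] at h3
      simp [NN] at h3 ⊢
      have : (I.card : ℝ) ≤ 1 := by exact_mod_cast h3
      linarith
    -- choose the level
    have hexJ : δ (J - 1 + 1) ≤ ρ := by rwa [Nat.sub_add_cancel hJpos]
    have hex : ∃ j, δ (j + 1) ≤ ρ := ⟨J - 1, hexJ⟩
    classical
    obtain ⟨j, hjJ, hj1, hj2⟩ : ∃ j, j + 1 ≤ J ∧ δ (j + 1) ≤ ρ ∧ ρ ≤ δ j := by
      refine ⟨Nat.find hex, ?_, Nat.find_spec hex, ?_⟩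
      · have := Nat.find_min' hex hexJ
        omega
      rcases hf : Nat.find hex with _ | k
      · rw [h₁.zero]; exact hρ1
      · have := Nat.find_min hex (m := k) (by omega)
        push Not at this
        exact this.le
    let I1 := I.image Prod.fst
    let I2 := I.image Prod.snd
    have hc1 := h₁.count hjJ ρ hρ.le I1 (by
      intro x hx
      obtain ⟨n, hn, rfl⟩ := Finset.mem_image.1 hx
      exact (Finset.mem_product.1 (hI hn)).1) (by
      intro x hx y hy
      obtain ⟨n, hn, rfl⟩ := Finset.mem_image.1 hx
      obtain ⟨m, hm, rfl⟩ := Finset.mem_image.1 hy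
      have := hdist n hn m hm
      rw [Prod.dist_eq] at this
      exact (le_max_left _ _).trans this)
    have hc2 := h₂.count hjJ ρ hρ.le I2 (by
      intro x hx
      obtain ⟨n, hn, rfl⟩ := Finset.mem_image.1 hx
      exact (Finset.mem_product.1 (hI hn)).2) (by
      intro x hx y hy
      obtain ⟨n, hn, rfl⟩ := Finset.mem_image.1 hx
      obtain ⟨m, hm, rfl⟩ := Finset.mem_image.1 hy
      have := hdist n hn m hm
      rw [Prod.dist_eq] at this
      exact (le_max_right _ _).trans this)
    have hIc : (I.card : ℝ) ≤ (I1.card : ℝ) * I2.card := by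
      have : I ⊆ I1 ×ˢ I2 := fun n hn => Finset.mem_product.2
        ⟨Finset.mem_image_of_mem _ hn, Finset.mem_image_of_mem _ hn⟩
      have := Finset.card_le_card this
      rw [Finset.card_product] at this
      exact_mod_cast this
    have r1 := h₁.Rpos j
    have r2 := h₂.Rpos j
    have d1 := hpos j
    have d2 := hpos (j + 1)
    have n1 : (0 : ℝ) < NN δ R₁ (j + 1) := by exact_mod_cast h₁.NN_pos _
    have n2 : (0 : ℝ) < NN δ R₂ (j + 1) := by exact_mod_cast h₂.NN_pos _
    -- lower bound for the number of intervals
    have e0 : δ j ^ (1 - σ) ≤ 64 * (R₁ j * R₂ j) *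
        ((NN δ R₁ (j + 1) : ℝ) * NN δ R₂ (j + 1)) := by
      have e1 : δ j * δ j ≤ 64 * (R₁ j * R₂ j) * ((aa δ R₁ j : ℝ) * aa δ R₂ j) := by
        calc δ j * δ j ≤ (8 * R₁ j * aa δ R₁ j) * (8 * R₂ j * aa δ R₂ j) := by
              have := h₁.le_aa j
              have := h₂.le_aa j
              gcongr
          _ = _ := by ring
      calc δ j ^ (1 - σ) = δ j ^ (-(1 + σ)) * (δ j * δ j) := by
            rw [← sq, ← Real.rpow_natCast, ← Real.rpow_add d1]; congr 1; push_cast; ring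
        _ ≤ ((NN δ R₁ j : ℝ) * NN δ R₂ j) *
            (64 * (R₁ j * R₂ j) * ((aa δ R₁ j : ℝ) * aa δ R₂ j)) := by
            gcongr
            exact hN j
        _ = _ := by simp only [NN]; push_cast; ring
    -- the numerical estimate
    have f0 : δ j ^ (1 - σ) * ρ ^ (1 + σ) = (δ j ^ (1 - σ) * ρ ^ σ) * ρ := by
      rw [add_comm, Real.rpow_add hρ, Real.rpow_one]; ring
    have f1 : ρ ≤ δ j ^ (1 - σ) * ρ ^ σ := by
      calc ρ = ρ ^ (1 - σ) * ρ ^ σ := by rw [← Real.rpow_add hρ]; simp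
        _ ≤ _ := by
          gcongr
    have f2 : ∀ x, x ≤ δ j ^ (1 - σ) * δ (j + 1) ^ σ → x ≤ δ j ^ (1 - σ) * ρ ^ σ := by
      intro x hx
      refine hx.trans ?_
      gcongr
    have f3 : 64 * (R₁ j * R₂ j) ≤ δ j ^ (1 - σ) * ρ ^ (1 + σ) := by
      refine (hR j).trans ?_
      gcongr
    have g1 : (ρ / 2 + 2 * R₁ j) * (ρ / 2 + 2 * R₂ j) ≤ 16 * (δ j ^ (1 - σ) * ρ ^ (1 + σ)) := by
      have f4 := f2 _ (hR₁ j)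
      have f5 := f2 _ (hR₂ j)
      rw [f0] at f3 ⊢
      set Q := δ j ^ (1 - σ) * ρ ^ σ
      have k1 := mul_le_mul_of_nonneg_right f1 hρ.le
      have k2 := mul_le_mul_of_nonneg_right f4 hρ.le
      have k3 := mul_le_mul_of_nonneg_right f5 hρ.le
      nlinarith
    have g2 : (ρ / (2 * R₁ j) + 2) * (ρ / (2 * R₂ j) + 2) * (R₁ j * R₂ j) =
        (ρ / 2 + 2 * R₁ j) * (ρ / 2 + 2 * R₂ j) := by
      field_simp
    have g3 : (ρ / (2 * R₁ j) + 2) * (ρ / (2 * R₂ j) + 2) ≤ 1024 * ρ ^ (1 + σ) *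
        ((NN δ R₁ (j + 1) : ℝ) * NN δ R₂ (j + 1)) := by
      have rr : 0 < R₁ j * R₂ j := by positivity
      refine le_of_mul_le_mul_right ?_ rr
      rw [g2]
      refine g1.trans ?_
      calc 16 * (δ j ^ (1 - σ) * ρ ^ (1 + σ)) ≤ 16 * ((64 * (R₁ j * R₂ j) *
        ((NN δ R₁ (j + 1) : ℝ) * NN δ R₂ (j + 1))) * ρ ^ (1 + σ)) := by gcongr
        _ = _ := by ring
    have nn : 0 < (NN δ R₁ (j + 1) : ℝ) * NN δ R₂ (j + 1) := by positivity
    refine le_of_mul_le_mul_right ?_ nn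
    calc (I.card : ℝ) * ((NN δ R₁ (j + 1) : ℝ) * NN δ R₂ (j + 1))
        ≤ ((I1.card : ℝ) * I2.card) * ((NN δ R₁ (j + 1) : ℝ) * NN δ R₂ (j + 1)) := by gcongr
      _ = ((I1.card : ℝ) * (NN δ R₁ (j + 1) : ℝ)) * (I2.card * NN δ R₂ (j + 1)) := by ring
      _ ≤ ((ρ / (2 * R₁ j) + 2) * NN δ R₁ J) * ((ρ / (2 * R₂ j) + 2) * NN δ R₂ J) := by
          gcongr
      _ = ((ρ / (2 * R₁ j) + 2) * (ρ / (2 * R₂ j) + 2)) * ((NN δ R₁ J : ℝ) * NN δ R₂ J) := by ring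
      _ ≤ (1024 * ρ ^ (1 + σ) *
        ((NN δ R₁ (j + 1) : ℝ) * NN δ R₂ (j + 1))) * ((NN δ R₁ J : ℝ) * NN δ R₂ J) := by gcongr
      _ = _ := by ring

end HP


namespace HP

open Filter Topology

/-- One step in the choice of the scales. -/
def ScaleStep (s d e g ε g' : ℝ) (r E D : ℕ) : Prop :=
  0 < g' ∧ 1 ≤ r ∧ 1 ≤ E ∧ 1 ≤ D ∧ g' * ((D : ℝ) ^ 2 * E * r) = 1 ∧
  2 ^ 20 ≤ g * (r * g' ^ s) ∧ 2 ^ 20 ≤ g * (E * g' ^ e) ∧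
  r * g' ^ (s + ε) ≤ 1 ∧ E * g' ^ (e + ε) ≤ 1 ∧ D * g' ^ d ≤ 1 ∧ g' ^ ε ≤ D * g' ^ d ∧
  2 ^ 20 * g' ^ ε ≤ g

lemma exists_scaleStep (s d e : ℝ) (hs : 0 < s) (hd : 0 < d) (he : 0 ≤ e) (hsum : s + 2 * d + e = 1)
    (g ε : ℝ) (hg : 0 < g) (hg1 : g ≤ 1) (hε : 0 < ε) (hε1 : ε ≤ 1) :
    ∃ (g' : ℝ) (r E D : ℕ), ScaleStep s d e g ε g' r E D := by
  set P : ℝ := 2 ^ 24 / g with hP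
  have hP1 : 2 ^ 24 ≤ P := by rw [hP, le_div_iff₀ hg]; nlinarith
  have hPg : P * g = 2 ^ 24 := by rw [hP]; field_simp
  obtain ⟨n, hn1, hnε, hnd⟩ : ∃ n : ℝ, 1 ≤ n ∧ 64 * P ≤ n ^ ε ∧ P ≤ n ^ d := by
    have a := (tendsto_rpow_atTop hε).eventually_ge_atTop (64 * P)
    have b := (tendsto_rpow_atTop hd).eventually_ge_atTop P
    obtain ⟨n, h⟩ := ((eventually_ge_atTop (1 : ℝ)).and (a.and b)).exists
    exact ⟨n, h.1, h.2.1, h.2.2⟩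
  have hn0 : 0 < n := by linarith
  have hns : 1 ≤ n ^ s := Real.one_le_rpow hn1 hs.le
  have hne : 1 ≤ n ^ e := Real.one_le_rpow hn1 he
  have hP0 : 0 < P := by linarith
  have ceilb : ∀ x : ℝ, 1 ≤ x → x ≤ (⌈x⌉₊ : ℝ) ∧ (⌈x⌉₊ : ℝ) ≤ 2 * x := by
    intro x hx
    exact ⟨Nat.le_ceil x, by linarith [Nat.ceil_lt_add_one (a := x) (by linarith)]⟩
  have floorb : ∀ x : ℝ, 1 ≤ x → x / 2 ≤ (⌊x⌋₊ : ℝ) ∧ (⌊x⌋₊ : ℝ) ≤ x := by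
    intro x hx
    refine ⟨?_, Nat.floor_le (by linarith)⟩
    have h1 := Nat.lt_floor_add_one x
    have h2 : (1 : ℝ) ≤ ⌊x⌋₊ := by exact_mod_cast (Nat.floor_pos.2 hx)
    linarith
  obtain ⟨r1, r2⟩ := ceilb (P * n ^ s) (by nlinarith)
  obtain ⟨E1, E2⟩ := ceilb (P * n ^ e) (by nlinarith)
  obtain ⟨D1, D2⟩ := floorb (n ^ d / P) (by rw [le_div_iff₀ hP0]; linarith)
  have D3 : 1 ≤ ⌊n ^ d / P⌋₊ := Nat.floor_pos.2 (by rw [le_div_iff₀ hP0]; linarith)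
  have r3 : 1 ≤ ⌈P * n ^ s⌉₊ := Nat.ceil_pos.2 (by positivity)
  have E3 : 1 ≤ ⌈P * n ^ e⌉₊ := Nat.ceil_pos.2 (by positivity)
  set r := ⌈P * n ^ s⌉₊
  set E := ⌈P * n ^ e⌉₊
  set D := ⌊n ^ d / P⌋₊
  have hr0 : (1 : ℝ) ≤ r := by exact_mod_cast r3
  have hE0 : (1 : ℝ) ≤ E := by exact_mod_cast E3
  have hD0 : (1 : ℝ) ≤ D := by exact_mod_cast D3
  set Q : ℝ := (D : ℝ) ^ 2 * E * r with hQ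
  have hQ0 : 0 < Q := by positivity
  have hprod : (n ^ d) ^ 2 * n ^ e * n ^ s = n := by
    rw [← Real.rpow_natCast, ← Real.rpow_mul hn0.le, ← Real.rpow_add hn0, ← Real.rpow_add hn0]
    conv_rhs => rw [← Real.rpow_one n]
    congr 1; push_cast; linarith
  have Q1 : n / 4 ≤ Q := by
    calc n / 4 = (n ^ d / P / 2) ^ 2 * (P * n ^ e) * (P * n ^ s) := by
          conv_lhs => rw [← hprod]
          field_simp; norm_num
      _ ≤ Q := by rw [hQ]; gcongr
  have Q2 : Q ≤ 4 * n := by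
    calc Q ≤ (n ^ d / P) ^ 2 * (2 * (P * n ^ e)) * (2 * (P * n ^ s)) := by
          rw [hQ]; gcongr
      _ = 4 * n := by
          conv_rhs => rw [← hprod]
          field_simp; norm_num
  have g1 : 1 / (4 * n) ≤ 1 / Q := one_div_le_one_div_of_le hQ0 Q2
  have g2 : 1 / Q ≤ 4 / n := by
    rw [div_le_div_iff₀ hQ0 hn0]; linarith
  have low : ∀ x : ℝ, 0 ≤ x → x ≤ 1 → 1 / 4 ≤ n ^ x * (1 / Q) ^ x := by
    intro x hx hx1
    calc (1 : ℝ) / 4 = (1 / 4) ^ (1 : ℝ) := by simp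
      _ ≤ (1 / 4 : ℝ) ^ x := Real.rpow_le_rpow_of_exponent_ge (by norm_num) (by norm_num) hx1
      _ = n ^ x * (1 / (4 * n)) ^ x := by
          rw [← Real.mul_rpow hn0.le (by positivity)]; congr 1; field_simp
      _ ≤ _ := by gcongr
  have up : ∀ x : ℝ, 0 ≤ x → x ≤ 1 → n ^ x * (1 / Q) ^ x ≤ 4 := by
    intro x hx hx1
    calc n ^ x * (1 / Q) ^ x ≤ n ^ x * (4 / n) ^ x := by gcongr
      _ = 4 ^ x := by
          rw [← Real.mul_rpow hn0.le (by positivity)]; congr 1; field_simp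
      _ ≤ 4 ^ (1 : ℝ) := Real.rpow_le_rpow_of_exponent_le (by norm_num) hx1
      _ = 4 := by simp
  have hg' : 0 < 1 / Q := by positivity
  have eps : P * (1 / Q) ^ ε ≤ 1 / 16 := by
    have := up ε hε.le hε1
    have h0 : 0 ≤ (1 / Q) ^ ε := by positivity
    nlinarith
  have hs1 : s ≤ 1 := by linarith
  have he1 : e ≤ 1 := by linarith
  have hd1 : d ≤ 1 := by linarith
  refine ⟨1 / Q, r, E, D, hg', r3, E3, D3, by rw [one_div]; exact inv_mul_cancel₀ hQ0.ne', ?_, ?_, ?_, ?_, ?_, ?_, ?_⟩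
  · have h1 := low s hs.le hs1
    calc (2 : ℝ) ^ 20 ≤ (P * g) * (1 / 4) := by rw [hPg]; norm_num
      _ ≤ (P * g) * (n ^ s * (1 / Q) ^ s) := by gcongr
      _ = g * (P * n ^ s * (1 / Q) ^ s) := by ring
      _ ≤ g * (r * (1 / Q) ^ s) := by gcongr
  · have h1 := low e he he1
    calc (2 : ℝ) ^ 20 ≤ (P * g) * (1 / 4) := by rw [hPg]; norm_num
      _ ≤ (P * g) * (n ^ e * (1 / Q) ^ e) := by gcongr
      _ = g * (P * n ^ e * (1 / Q) ^ e) := by ring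
      _ ≤ g * (E * (1 / Q) ^ e) := by gcongr
  · rw [Real.rpow_add hg']
    have h1 := up s hs.le hs1
    calc r * ((1 / Q) ^ s * (1 / Q) ^ ε) ≤ 2 * (P * n ^ s) * ((1 / Q) ^ s * (1 / Q) ^ ε) := by gcongr
      _ = 2 * (P * (1 / Q) ^ ε) * (n ^ s * (1 / Q) ^ s) := by ring
      _ ≤ 2 * (1 / 16) * 4 := by gcongr
      _ ≤ 1 := by norm_num
  · rw [Real.rpow_add hg']
    have h1 := up e he he1
    calc E * ((1 / Q) ^ e * (1 / Q) ^ ε) ≤ 2 * (P * n ^ e) * ((1 / Q) ^ e * (1 / Q) ^ ε) := by gcongr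
      _ = 2 * (P * (1 / Q) ^ ε) * (n ^ e * (1 / Q) ^ e) := by ring
      _ ≤ 2 * (1 / 16) * 4 := by gcongr
      _ ≤ 1 := by norm_num
  · have h1 := up d hd.le hd1
    calc D * (1 / Q) ^ d ≤ n ^ d / P * (1 / Q) ^ d := by gcongr
      _ = n ^ d * (1 / Q) ^ d / P := by ring
      _ ≤ 1 := by rw [div_le_one hP0]; linarith
  · have h1 := low d hd.le hd1
    have h2 : n ^ d / P / 2 * (1 / Q) ^ d ≤ D * (1 / Q) ^ d := by gcongr
    refine le_trans ?_ h2
    have : n ^ d / P / 2 * (1 / Q) ^ d = (n ^ d * (1 / Q) ^ d) / (2 * P) := by field_simp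
    rw [this, le_div_iff₀ (by positivity)]
    linarith
  · have h0 : 0 ≤ (1 / Q) ^ ε := by positivity
    have h1 : P * (2 ^ 20 * (1 / Q) ^ ε) ≤ P * g := by
      rw [hPg]; linarith
    exact le_of_mul_le_mul_left h1 hP0

/-- A sequence of scales. -/
structure Scales (s d e ε0 : ℝ) where
  δ : ℕ → ℝ
  r : ℕ → ℕ
  E : ℕ → ℕ
  D : ℕ → ℕ
  zero : δ 0 = 1
  step : ∀ j, ScaleStep s d e (δ j) (ε0 / (j + 1)) (δ (j + 1)) (r j) (E j) (D j)

lemma ScaleStep.lt {s d e g ε g' : ℝ} {r E D : ℕ} (h : ScaleStep s d e g ε g' r E D) (hg : g ≤ 1)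
    (hε : 0 < ε) (hε1 : ε ≤ 1) : 2 ^ 20 * g' ≤ g := by
  obtain ⟨h0, -, -, -, -, -, -, -, -, -, -, h1⟩ := h
  refine le_trans ?_ h1
  gcongr
  have hle : g' ≤ 1 := by
    by_contra hc
    push Not at hc
    have := Real.one_lt_rpow hc hε
    linarith
  calc g' = g' ^ (1 : ℝ) := by simp
    _ ≤ g' ^ ε := Real.rpow_le_rpow_of_exponent_ge h0 hle hε1

lemma exists_scales (s d e ε0 : ℝ) (hs : 0 < s) (hd : 0 < d) (he : 0 ≤ e)
    (hsum : s + 2 * d + e = 1) (hε : 0 < ε0) (hε1 : ε0 ≤ 1) : Nonempty (Scales s d e ε0) := by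
  have hεj : ∀ j : ℕ, 0 < ε0 / ((j : ℝ) + 1) ∧ ε0 / ((j : ℝ) + 1) ≤ 1 := by
    intro j
    refine ⟨by positivity, ?_⟩
    rw [div_le_one (by positivity)]
    linarith [(Nat.cast_nonneg j : (0 : ℝ) ≤ j)]
  have H : ∀ (j : ℕ) (g : {g : ℝ // 0 < g ∧ g ≤ 1}), ∃ (g' : {g : ℝ // 0 < g ∧ g ≤ 1})
      (r E D : ℕ), ScaleStep s d e g (ε0 / (j + 1)) g' r E D := by
    rintro j ⟨g, hg, hg1⟩
    obtain ⟨g', r, E, D, h⟩ := exists_scaleStep s d e hs hd he hsum g _ hg hg1 (hεj j).1 (hεj j).2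
    have := h.lt hg1 (hεj j).1 (hεj j).2
    exact ⟨⟨g', h.1, by linarith [h.1]⟩, r, E, D, h⟩
  choose nx r E D hst using H
  let G : ℕ → {g : ℝ // 0 < g ∧ g ≤ 1} := fun n => Nat.rec ⟨1, one_pos, le_rfl⟩ (fun j g => nx j g) n
  exact ⟨{ δ := fun j => (G j).1
           r := fun j => r j (G j)
           E := fun j => E j (G j)
           D := fun j => D j (G j)
           zero := rfl
           step := by intro j; exact hst j (G j) }⟩

end HP


namespace HP

open Filter Topology

lemma card_le_of_diam (S : Finset ℤ) (L : ℝ) (hL : 0 ≤ L)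
    (h : ∀ x ∈ S, ∀ y ∈ S, (x : ℝ) - y ≤ L) : (S.card : ℝ) ≤ L + 1 := by
  rcases S.eq_empty_or_nonempty with rfl | hne
  · simp; linarith
  have h1 : S ⊆ Finset.Icc (S.min' hne) (S.max' hne) := fun x hx =>
    Finset.mem_Icc.2 ⟨S.min'_le x hx, S.le_max' x hx⟩
  have h2 := Finset.card_le_card h1
  rw [Int.card_Icc] at h2
  have h3 := h _ (S.max'_mem hne) _ (S.min'_mem hne)
  have h4 : S.min' hne ≤ S.max' hne := S.min'_le_max' hne
  have h5 : (S.card : ℤ) ≤ S.max' hne + 1 - S.min' hne := by omega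
  have h6 : ((S.card : ℤ) : ℝ) ≤ ((S.max' hne + 1 - S.min' hne : ℤ) : ℝ) := by exact_mod_cast h5
  push_cast at h6
  linarith

lemma card_le_mul {α : Type*} (S : Finset α) (f : α → ℤ) (n : ℝ) (hn : 0 ≤ n)
    (h : ∀ a : ℤ, ((S.filter fun x => f x = a).card : ℝ) ≤ n) :
    (S.card : ℝ) ≤ n * (S.image f).card := by
  have h1 : S.card ≤ ⌊n⌋₊ * (S.image f).card :=
    Finset.card_le_mul_card_image S _ fun a _ => Nat.le_floor (h a)
  have h2 : (S.card : ℝ) ≤ (⌊n⌋₊ : ℝ) * (S.image f).card := by exact_mod_cast h1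
  refine h2.trans ?_
  gcongr
  exact Nat.floor_le hn

/-- Pigeonhole step. -/
lemma nt1 (r : ℕ) (μ θ b lam : ℝ) (H : Finset ℤ) (hl0 : 0 < lam)
    (hlr : 100 ≤ lam * r) (hHr : ∀ k ∈ H, 0 ≤ k ∧ k ≤ 3 * (r : ℤ))
    (hH : ∀ k ∈ H, ∃ h : ℤ, |μ * k - θ - h| ≤ b) (hc : lam * r ≤ H.card) :
    ∃ dd g : ℤ, 1 ≤ dd ∧ (dd : ℝ) ≤ 6 / lam ∧ |μ * dd - g| ≤ 2 * b := by
  set q : ℕ := ⌈6 / lam⌉₊ with hq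
  have hq0 : 0 < q := Nat.ceil_pos.2 (by positivity)
  have hq1 : 6 / lam ≤ q := Nat.le_ceil _
  have hq2 : (q : ℝ) < 6 / lam + 1 := Nat.ceil_lt_add_one (by positivity)
  have hqR : (0 : ℝ) < q := by exact_mod_cast hq0
  let Tg : Finset ℤ := Finset.Icc 0 (3 * (r : ℤ) / q)
  have hT : (Tg.card : ℝ) < H.card := by
    have h1 : (Tg.card : ℝ) ≤ lam * r / 2 + 1 := by
      refine card_le_of_diam _ _ (by positivity) ?_
      intro x hx y hy
      have hx := (Finset.mem_Icc.1 hx).2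
      have hy := (Finset.mem_Icc.1 hy).1
      have hy' : (0 : ℝ) ≤ y := by exact_mod_cast hy
      rw [Int.le_ediv_iff_mul_le (by exact_mod_cast hq0)] at hx
      have hx' : (x : ℝ) * q ≤ 3 * r := by exact_mod_cast hx
      have h3 : 6 ≤ q * lam := by rwa [div_le_iff₀ hl0] at hq1
      have h4 : (x : ℝ) ≤ 3 * r / q := by rwa [le_div_iff₀ hqR]
      have h5 : 3 * (r : ℝ) / q ≤ lam * r / 2 := by
        rw [div_le_iff₀ hqR]
        have : (0 : ℝ) ≤ r := by positivity
        nlinarith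
      linarith
    linarith
  have hT' : Tg.card < H.card := by exact_mod_cast hT
  obtain ⟨x, hx, y, hy, hxy, hf⟩ := Finset.exists_ne_map_eq_of_card_lt_of_maps_to hT'
    (f := fun k => k / (q : ℤ)) (by
      intro k hk
      have := hHr k hk
      exact Finset.mem_Icc.2 ⟨Int.ediv_nonneg this.1 (by positivity),
        Int.ediv_le_ediv (by exact_mod_cast hq0) this.2⟩)
  have hqz : (0 : ℤ) < q := by exact_mod_cast hq0
  wlog hlt : x < y generalizing x y
  · exact this y hy x hx hxy.symm hf.symm (lt_of_le_of_ne (not_lt.1 hlt) hxy.symm)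
  obtain ⟨h1, hh1⟩ := hH x hx
  obtain ⟨h2, hh2⟩ := hH y hy
  refine ⟨y - x, h2 - h1, by omega, ?_, ?_⟩
  · have e1 := Int.mul_ediv_add_emod x q
    have e2 := Int.mul_ediv_add_emod y q
    have e3 := Int.emod_lt_of_pos y hqz
    have e4 := Int.emod_nonneg x hqz.ne'
    rw [hf] at e1
    have e5 : y - x ≤ (q : ℤ) - 1 := by linarith
    have e6 : ((y - x : ℤ) : ℝ) ≤ (q : ℝ) - 1 := by exact_mod_cast e5
    linarith
  · push_cast
    rw [abs_le] at *
    constructor <;> nlinarith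

/-- Counting step. -/
lemma nt2 (r : ℕ) (μ θ b lam : ℝ) (H : Finset ℤ) (hl0 : 0 < lam) (hl1 : lam ≤ 1)
    (hb : 100 * b ≤ lam) (hlr : 100 ≤ lam * r) (hHr : ∀ k ∈ H, 0 ≤ k ∧ k ≤ 3 * (r : ℤ))
    (hH : ∀ k ∈ H, ∃ h : ℤ, |μ * k - θ - h| ≤ b) (hc : lam * r ≤ H.card)
    (dd g : ℤ) (hdd : 1 ≤ dd) (hdl : (dd : ℝ) ≤ 6 / lam) (hg : |μ * dd - g| ≤ 2 * b) :
    |μ * dd - g| ≤ 16 * b * dd / (lam * r) := by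
  have hb0 : 0 ≤ b := by linarith [abs_nonneg (μ * dd - g)]
  have hddR : (1 : ℝ) ≤ dd := by exact_mod_cast hdd
  rcases eq_or_ne (μ * dd - g) 0 with h0 | h0
  · rw [h0, abs_zero]; positivity
  set β := μ * dd - g with hβ
  have hβ0 : 0 < |β| := abs_pos.2 h0
  have hddz : (0 : ℤ) < dd := by omega
  choose! hh hhh using hH
  let w : ℤ → ℤ := fun k => hh k - g * (k / dd)
  -- the basic identity
  have hid : ∀ k : ℤ, μ * k - θ - hh k =
      μ * ((k % dd : ℤ) : ℝ) - θ - w k + ((k / dd : ℤ) : ℝ) * β := by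
    intro k
    have e1 : (k : ℝ) = dd * ((k / dd : ℤ) : ℝ) + ((k % dd : ℤ) : ℝ) := by
      exact_mod_cast (Int.mul_ediv_add_emod k dd).symm
    simp only [w, hβ]
    push_cast
    rw [e1]
    generalize ((k / dd : ℤ) : ℝ) = u
    generalize ((k % dd : ℤ) : ℝ) = v
    ring
  have hquot : ∀ k ∈ H, ∀ l ∈ H, ((k / dd : ℤ) : ℝ) - ((l / dd : ℤ) : ℝ) ≤ 3 * r / dd := by
    intro k hk l hl
    have e1 : ((k / dd : ℤ) : ℝ) ≤ 3 * r / dd := by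
      rw [le_div_iff₀ (by linarith)]
      have : k / dd * dd ≤ k := Int.ediv_mul_le k hddz.ne'
      have h2 := (hHr k hk).2
      exact_mod_cast this.trans h2
    have e2 : (0 : ℝ) ≤ ((l / dd : ℤ) : ℝ) := by
      exact_mod_cast Int.ediv_nonneg (hHr l hl).1 hddz.le
    linarith
  have hfib : ∀ a c : ℤ, (((H.filter fun k => k % dd = a).filter fun k => w k = c).card : ℝ) ≤
      2 * b / |β| + 1 := by
    intro a c
    set F := (H.filter fun k => k % dd = a).filter fun k => w k = c
    have hinj : F.card = (F.image fun k => k / dd).card := by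
      rw [Finset.card_image_of_injOn]
      intro x hx y hy hxy
      have hx := (Finset.mem_filter.1 (Finset.mem_filter.1 hx).1).2
      have hy := (Finset.mem_filter.1 (Finset.mem_filter.1 hy).1).2
      simp only at hxy
      rw [← Int.mul_ediv_add_emod x dd, ← Int.mul_ediv_add_emod y dd, hxy, hx, hy]
    rw [hinj]
    refine card_le_of_diam _ _ (by positivity) ?_
    intro x hx y hy
    obtain ⟨k, hk, rfl⟩ := Finset.mem_image.1 hx
    obtain ⟨l, hl, rfl⟩ := Finset.mem_image.1 hy
    obtain ⟨hk1, hk2⟩ := Finset.mem_filter.1 hk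
    obtain ⟨hk1, hk3⟩ := Finset.mem_filter.1 hk1
    obtain ⟨hl1, hl2⟩ := Finset.mem_filter.1 hl
    obtain ⟨hl1, hl3⟩ := Finset.mem_filter.1 hl1
    have e1 := hhh k hk1
    have e2 := hhh l hl1
    rw [hid k, hk3, hk2] at e1
    rw [hid l, hl3, hl2] at e2
    have e3 : |(((k / dd : ℤ) : ℝ) - ((l / dd : ℤ) : ℝ)) * β| ≤ 2 * b := by
      rw [abs_le] at *
      constructor <;> nlinarith
    rw [abs_mul] at e3
    rw [le_div_iff₀ hβ0]
    exact (mul_le_mul_of_nonneg_right (le_abs_self _) hβ0.le).trans e3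
  have hres : ∀ a : ℤ, ((H.filter fun k => k % dd = a).card : ℝ) ≤
      (2 * b / |β| + 1) * (3 * r / dd * |β| + 2 * b + 1) := by
    intro a
    refine (card_le_mul (H.filter fun k => k % dd = a) w _ (by positivity) (hfib a)).trans ?_
    gcongr
    refine card_le_of_diam _ _ (by positivity) ?_
    intro x hx y hy
    obtain ⟨k, hk, rfl⟩ := Finset.mem_image.1 hx
    obtain ⟨l, hl, rfl⟩ := Finset.mem_image.1 hy
    obtain ⟨hk1, hk3⟩ := Finset.mem_filter.1 hk
    obtain ⟨hl1, hl3⟩ := Finset.mem_filter.1 hl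
    have e1 := hhh k hk1
    have e2 := hhh l hl1
    rw [hid k, hk3] at e1
    rw [hid l, hl3] at e2
    have e3 : |((k / dd : ℤ) : ℝ) - ((l / dd : ℤ) : ℝ)| ≤ 3 * r / dd :=
      abs_sub_le_iff.2 ⟨hquot k hk1 l hl1, hquot l hl1 k hk1⟩
    have e4 : (((k / dd : ℤ) : ℝ) - ((l / dd : ℤ) : ℝ)) * β ≤ 3 * r / dd * |β| := by
      refine (le_abs_self _).trans ?_
      rw [abs_mul]
      gcongr
    rw [abs_le] at e1 e2
    nlinarith
  have htot : (H.card : ℝ) ≤ ((2 * b / |β| + 1) * (3 * r / dd * |β| + 2 * b + 1)) * dd := by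
    refine (card_le_mul H (fun k => k % dd) _ (by positivity) hres).trans ?_
    gcongr
    have : ((H.image fun k => k % dd).card : ℝ) ≤ ((dd : ℝ) - 1) + 1 := by
      refine card_le_of_diam _ _ (by linarith) ?_
      intro x hx y hy
      obtain ⟨k, hk, rfl⟩ := Finset.mem_image.1 hx
      obtain ⟨l, hl, rfl⟩ := Finset.mem_image.1 hy
      have e1 := Int.emod_lt_of_pos k hddz
      have e2 := Int.emod_nonneg l hddz.ne'
      have : k % dd - l % dd ≤ dd - 1 := by omega
      exact_mod_cast this
    linarith
  have hexp : ((2 * b / |β| + 1) * (3 * r / dd * |β| + 2 * b + 1)) * dd =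
      (2 * b + |β|) * (3 * r) + (2 * b / |β| + 1) * (2 * b + 1) * dd := by
    field_simp; ring
  rw [hexp] at htot
  have k1 : (2 * b + |β|) * (3 * r) ≤ 12 * b * r := by
    have : (0 : ℝ) ≤ r := by positivity
    nlinarith
  have k2 : 12 * b * r ≤ lam * r / 4 := by
    have : (0 : ℝ) ≤ r := by positivity
    nlinarith
  have k3 : (2 * b / |β| + 1) ≤ 4 * b / |β| := by
    have : 1 ≤ 2 * b / |β| := by rw [le_div_iff₀ hβ0]; linarith
    have e : 4 * b / |β| = 2 * b / |β| + 2 * b / |β| := by ring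
    linarith
  have k4 : (2 * b / |β| + 1) * (2 * b + 1) * dd ≤ 4 * b / |β| * 2 * dd := by
    gcongr
    linarith
  have k5 : lam * r / 2 ≤ 8 * b * dd / |β| := by
    have : 4 * b / |β| * 2 * dd = 8 * b * dd / |β| := by ring
    linarith
  rw [le_div_iff₀ hβ0] at k5
  rw [le_div_iff₀ (by linarith)]
  linarith

set_option maxHeartbeats 1000000 in
/-- The covering of rich offsets. -/
lemma nt_cover (r E D : ℕ) (a B B1 lam δ : ℝ) (hr : 1 ≤ r) (hE : 1 ≤ E) (hD : 1 ≤ D) (hB : 1 ≤ B)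
    (hBB : B ≤ B1) (hl0 : 0 < lam) (hl1 : lam ≤ 1) (hb : 100 * B1 ≤ lam * D)
    (hlr : 100 ≤ lam * r) (hδ : δ * ((D : ℝ) ^ 2 * E * r) = 1) :
    ∃ T : Finset ℝ, (T.card : ℝ) ≤ 10 ^ 8 * B1 ^ 2 * E / lam ^ 5 ∧
      ∀ m : ℝ, |m| ≤ B → ∀ H : Finset ℤ, (∀ k ∈ H, 0 ≤ k ∧ k ≤ 3 * (r : ℤ)) →
        (∀ k ∈ H, ∃ h : ℤ, |D * E * m * (k + 1 / D) - D * E * r * a - h| ≤ B1 / D) →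
        lam * r ≤ H.card → ∃ c ∈ T, |m - c| ≤ 16 * B1 * δ / lam := by
  have hrR : (1 : ℝ) ≤ r := by exact_mod_cast hr
  have hER : (1 : ℝ) ≤ E := by exact_mod_cast hE
  have hDR : (1 : ℝ) ≤ D := by exact_mod_cast hD
  have hB1 : 1 ≤ B1 := hB.trans hBB
  have hB10 : 0 < B1 := by linarith
  set W : ℝ := 400 * B1 / lam ^ 2 with hW
  have hW0 : 1 ≤ W := by
    rw [hW, le_div_iff₀ (by positivity)]
    nlinarith
  set X : ℝ := 6 * E * B1 / lam + 1 + W with hX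
  have hX0 : 0 ≤ X := by positivity
  let T : Finset ℝ := (Finset.Icc (1 : ℤ) ⌊6 / lam⌋).biUnion fun dd =>
    (Finset.Icc ⌈-(dd * (D * E * r) * a) - X⌉ ⌊-(dd * (D * E * r) * a) + X⌋).biUnion fun N =>
      (Finset.Icc ⌈(D : ℝ) * (dd * (D * E * r) * a + N) - W⌉
        ⌊(D : ℝ) * (dd * (D * E * r) * a + N) + W⌋).image fun g : ℤ => (g : ℝ) / (dd * (D * E))
  have cIcc : ∀ x Y : ℝ, 0 ≤ Y → ((Finset.Icc ⌈x - Y⌉ ⌊x + Y⌋).card : ℝ) ≤ 2 * Y + 1 := by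
    intro x Y hY
    refine card_le_of_diam _ _ (by positivity) ?_
    intro u hu v hv
    have h1 := Int.le_floor.1 (Finset.mem_Icc.1 hu).2
    have h2 := Int.ceil_le.1 (Finset.mem_Icc.1 hv).1
    linarith
  have cU : ∀ (S : Finset ℤ) (f : ℤ → Finset ℝ) (n : ℝ), 0 ≤ n → (∀ i, ((f i).card : ℝ) ≤ n) →
      ((S.biUnion f).card : ℝ) ≤ S.card * n := by
    intro S f n hn hf
    have : (S.biUnion f).card ≤ S.card * ⌊n⌋₊ :=
      Finset.card_biUnion_le_card_mul S f _ fun i _ => Nat.le_floor (hf i)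
    have h2 : ((S.biUnion f).card : ℝ) ≤ S.card * (⌊n⌋₊ : ℝ) := by exact_mod_cast this
    refine h2.trans ?_
    gcongr
    exact Nat.floor_le hn
  refine ⟨T, ?_, ?_⟩
  · have c1 : (T.card : ℝ) ≤ (6 / lam) * ((2 * X + 1) * (2 * W + 1)) := by
      refine (cU _ _ ((2 * X + 1) * (2 * W + 1)) (by positivity) ?_).trans ?_
      · intro dd
        refine (cU _ _ (2 * W + 1) (by positivity) ?_).trans ?_
        · intro N
          have : ((Finset.image (fun g : ℤ => (g : ℝ) / (dd * (D * E)))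
            (Finset.Icc ⌈(D : ℝ) * (dd * (D * E * r) * a + N) - W⌉
            ⌊(D : ℝ) * (dd * (D * E * r) * a + N) + W⌋)).card : ℝ) ≤ _ :=
            Nat.cast_le.2 Finset.card_image_le
          exact this.trans (cIcc _ _ (by linarith))
        · gcongr
          exact cIcc _ _ hX0
      · gcongr
        have h1 : (1 : ℝ) ≤ 6 / lam := by rw [le_div_iff₀ hl0]; linarith
        have : ((Finset.Icc (1 : ℤ) ⌊6 / lam⌋).card : ℝ) ≤ (6 / lam - 1) + 1 := by
          refine card_le_of_diam _ _ (by linarith) ?_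
          intro u hu v hv
          have h1 := Int.le_floor.1 (Finset.mem_Icc.1 hu).2
          have h2 : (1 : ℝ) ≤ v := by exact_mod_cast (Finset.mem_Icc.1 hv).1
          linarith
        linarith
    refine c1.trans ?_
    have hX1 : 2 * X + 1 ≤ 1000 * B1 * E / lam ^ 2 := by
      rw [hX, hW, le_div_iff₀ (by positivity)]
      have e : (2 * (6 * E * B1 / lam + 1 + 400 * B1 / lam ^ 2) + 1) * lam ^ 2 =
          12 * E * B1 * lam + 3 * lam ^ 2 + 800 * B1 := by field_simp; ring
      rw [e]
      have b1 : 1 ≤ B1 := by linarith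
      have e1 : B1 ≤ E * B1 := by nlinarith
      have e2 : E * B1 * lam ≤ E * B1 := by
        apply mul_le_of_le_one_right (by positivity) hl1
      have e3 : lam ^ 2 ≤ 1 := by nlinarith
      nlinarith
    have hW1 : 2 * W + 1 ≤ 1000 * B1 / lam ^ 2 := by
      have : 1000 * B1 / lam ^ 2 = W + W + 200 * B1 / lam ^ 2 := by rw [hW]; ring
      have h3 : 1 ≤ 200 * B1 / lam ^ 2 := by
        rw [le_div_iff₀ (by positivity)]
        nlinarith
      linarith
    calc (6 / lam) * ((2 * X + 1) * (2 * W + 1)) ≤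
        (6 / lam) * ((1000 * B1 * E / lam ^ 2) * (1000 * B1 / lam ^ 2)) := by gcongr
      _ = 6000000 * B1 ^ 2 * E / lam ^ 5 := by field_simp; ring
      _ ≤ _ := by
        gcongr
        norm_num
  · intro m hm H hHr hH hc
    set b : ℝ := B1 / D with hbdef
    have hbD : b * D = B1 := by rw [hbdef]; field_simp
    have hb0 : 0 ≤ b := by positivity
    have hb' : 100 * b ≤ lam := by
      rw [hbdef, ← mul_div_assoc, div_le_iff₀ (by linarith)]; linarith
    set μ : ℝ := D * E * m with hμ
    set θ : ℝ := D * E * r * a - μ / D with hθ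
    have hH' : ∀ k ∈ H, ∃ h : ℤ, |μ * k - θ - h| ≤ b := by
      intro k hk
      obtain ⟨h, hh⟩ := hH k hk
      refine ⟨h, ?_⟩
      convert hh using 2
      rw [hθ]; ring
    obtain ⟨dd, g, hdd, hdl, hg⟩ := nt1 r μ θ b lam H hl0 hlr hHr hH' hc
    have hβ := nt2 r μ θ b lam H hl0 hl1 hb' hlr hHr hH' hc dd g hdd hdl hg
    have hddR : (1 : ℝ) ≤ dd := by exact_mod_cast hdd
    have hHne : H.Nonempty := by
      rw [← Finset.card_pos]
      have : (0 : ℝ) < H.card := by linarith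
      exact_mod_cast this
    obtain ⟨k, hk⟩ := hHne
    obtain ⟨h, hh⟩ := hH k hk
    obtain ⟨hk0, hk3⟩ := hHr k hk
    have hk0' : (0 : ℝ) ≤ k := by exact_mod_cast hk0
    have hk3' : (k : ℝ) ≤ 3 * r := by exact_mod_cast hk3
    set β := μ * dd - g with hβd
    set N : ℤ := dd * h - g * k with hN
    -- the key identity
    have hid : (g : ℝ) - D * (dd * (D * E * r) * a + N) =
        D * dd * (μ * (k + 1 / D) - D * E * r * a - h) - β * (k * D + 1) := by
      rw [hN, hβd]; push_cast; field_simp; ring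
    have hgW : |(g : ℝ) - D * (dd * (D * E * r) * a + N)| ≤ W := by
      rw [hid]
      have t1 : |D * dd * (μ * (k + 1 / D) - D * E * r * a - h)| ≤ D * dd * b := by
        rw [abs_mul, abs_of_nonneg (by positivity : (0 : ℝ) ≤ D * dd)]
        gcongr
      have t2 : |β * (k * D + 1)| ≤ 16 * b * dd / (lam * r) * (4 * r * D) := by
        rw [abs_mul, abs_of_nonneg (by positivity : (0 : ℝ) ≤ k * D + 1)]
        gcongr
        nlinarith
      have t3 : 16 * b * dd / (lam * r) * (4 * r * D) = 64 * (b * D) * dd / lam := by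
        field_simp; ring
      rw [t3, hbD] at t2
      have t4 : (D : ℝ) * dd * b = B1 * dd := by rw [← hbD]; ring
      rw [t4] at t1
      have t5 : B1 * dd ≤ B1 * dd / lam := by
        rw [le_div_iff₀ hl0]
        exact mul_le_of_le_one_right (by positivity) hl1
      have t6 : 65 * B1 * dd / lam ≤ W := by
        calc 65 * B1 * dd / lam ≤ 65 * B1 * (6 / lam) / lam := by gcongr
          _ = 390 * B1 / lam ^ 2 := by field_simp; norm_num
          _ ≤ W := by rw [hW]; gcongr; norm_num
      have t7 : 65 * B1 * dd / lam = B1 * dd / lam + 64 * B1 * dd / lam := by ring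
      refine (abs_sub _ _).trans ?_
      linarith
    have hNX : |(dd * (D * E * r) * a + N : ℝ)| ≤ X := by
      have u1 : |(g : ℝ)| ≤ D * (6 * E * B1 / lam) + 1 := by
        have e : (g : ℝ) = μ * dd - β := by rw [hβd]; ring
        rw [e]
        refine (abs_sub _ _).trans ?_
        have e1 : |μ * dd| ≤ D * (6 * E * B1 / lam) := by
          rw [abs_mul, abs_of_nonneg (by linarith : (0 : ℝ) ≤ dd), hμ, abs_mul,
            abs_of_nonneg (by positivity : (0 : ℝ) ≤ D * E)]
          calc (D : ℝ) * E * |m| * dd ≤ D * E * B1 * (6 / lam) := by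
                gcongr
                exact hm.trans hBB
            _ = _ := by ring
        linarith
      have u2 : |(D : ℝ) * (dd * (D * E * r) * a + N)| ≤ D * (6 * E * B1 / lam) + 1 + W := by
        have e : (D : ℝ) * (dd * (D * E * r) * a + N) =
            g - (g - (D : ℝ) * (dd * (D * E * r) * a + N)) := by ring
        rw [e]
        refine (abs_sub _ _).trans ?_
        linarith
      rw [abs_mul, abs_of_nonneg (by positivity : (0 : ℝ) ≤ D)] at u2
      have u3 : (D : ℝ) * |(dd * (D * E * r) * a + N : ℝ)| ≤ D * X := by
        refine u2.trans ?_
        rw [hX]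
        nlinarith
      exact le_of_mul_le_mul_left u3 (by linarith)
    refine ⟨(g : ℝ) / (dd * (D * E)), ?_, ?_⟩
    · refine Finset.mem_biUnion.2 ⟨dd, Finset.mem_Icc.2 ⟨hdd, Int.le_floor.2 hdl⟩, ?_⟩
      rw [abs_le] at hNX hgW
      refine Finset.mem_biUnion.2 ⟨N, Finset.mem_Icc.2 ⟨Int.ceil_le.2 (by linarith),
        Int.le_floor.2 (by linarith)⟩, ?_⟩
      exact Finset.mem_image.2 ⟨g, Finset.mem_Icc.2 ⟨Int.ceil_le.2 (by linarith),
        Int.le_floor.2 (by linarith)⟩, rfl⟩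
    · have e : m - (g : ℝ) / (dd * (D * E)) = β / (dd * (D * E)) := by
        rw [hβd, hμ]; field_simp
      rw [e, abs_div, abs_of_nonneg (by positivity : (0 : ℝ) ≤ dd * (D * E)),
        div_le_iff₀ (by positivity)]
      refine hβ.trans (le_of_eq ?_)
      have hδ' : δ = 1 / ((D : ℝ) ^ 2 * E * r) := by
        rw [eq_div_iff (by positivity)]; exact hδ
      rw [hδ', hbdef]
      field_simp

end HP


namespace HP

open Filter Topology

/-- The signed offset of the line through `p` in direction `v`. -/
def cross (v p : ℝ × ℝ) : ℝ := v.1 * p.2 - v.2 * p.1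

/-- The radial set. -/
def K2 (A : Set ℝ) : Set (ℝ × ℝ) := {p | p.1 ^ 2 + p.2 ^ 2 ∈ A}

lemma K2_compact {A : Set ℝ} (hA : IsCompact A) (hA12 : A ⊆ Icc 1 2) : IsCompact (K2 A) := by
  refine (isCompact_Icc (a := (-2 : ℝ)) (b := 2) |>.prod
    (isCompact_Icc (a := (-2 : ℝ)) (b := 2))).of_isClosed_subset ?_ ?_
  · exact hA.isClosed.preimage (by fun_prop)
  · rintro ⟨x, y⟩ hp
    have := (hA12 hp).2
    simp only at this
    refine ⟨⟨?_, ?_⟩, ⟨?_, ?_⟩⟩ <;> simp only <;> nlinarith [sq_nonneg x, sq_nonneg y]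

lemma dimH_K2_le {A : Set ℝ} (hA12 : A ⊆ Icc 1 2) : dimH (K2 A) ≤ dimH A + 1 := by
  let f : ℝ × ℝ → ℝ × ℝ := fun q => (Real.sqrt q.1 * Real.cos q.2, Real.sqrt q.1 * Real.sin q.2)
  have hsub : K2 A ⊆ f '' (A ×ˢ univ) := by
    rintro ⟨x, y⟩ hp
    refine ⟨(x ^ 2 + y ^ 2, Complex.arg ⟨x, y⟩), ⟨hp, mem_univ _⟩, ?_⟩
    have hn : ‖(⟨x, y⟩ : ℂ)‖ = Real.sqrt (x ^ 2 + y ^ 2) := by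
      rw [Complex.norm_def, Complex.normSq_mk]; ring_nf
    have h1 := Complex.norm_mul_cos_arg ⟨x, y⟩
    have h2 := Complex.norm_mul_sin_arg ⟨x, y⟩
    rw [hn] at h1 h2
    simp only [f]
    rw [h1, h2]
  refine (dimH_mono hsub).trans ?_
  refine le_trans ?_ (dimH_prod_univ_le A)
  have hc : ContDiffOn ℝ 1 f (Ioi (0 : ℝ) ×ˢ univ) := by
    intro q hq
    have hq0 : q.1 ≠ 0 := (hq.1 : (0 : ℝ) < q.1).ne'
    have h1 : ContDiffAt ℝ 1 (fun q : ℝ × ℝ => Real.sqrt q.1) q := contDiffAt_fst.sqrt hq0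
    exact ContDiffAt.contDiffWithinAt ((h1.mul contDiffAt_snd.cos).prodMk (h1.mul contDiffAt_snd.sin))
  refine hc.dimH_image_le ((convex_Ioi 0).prod convex_univ) ?_
  rintro ⟨ρ, θ⟩ ⟨h, -⟩
  exact ⟨lt_of_lt_of_le one_pos (hA12 h).1, mem_univ _⟩

/-- The general lower bound for parts of the radial set. -/
lemma le_dimH_K2_part {A G : Set ℝ} (hA12 : A ⊆ Icc 1 2) (hG : G ⊆ Icc 0 1) (α β : ℝ)
    (hαβ : 1 ≤ α ^ 2 + β ^ 2) :
    dimH (A ×ˢ G : Set (ℝ × ℝ)) ≤ dimH {p ∈ K2 A | α * p.1 + β * p.2 ∈ G} := by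
  let f : ℝ × ℝ → ℝ × ℝ := fun p => (p.1 ^ 2 + p.2 ^ 2, α * p.1 + β * p.2)
  have hf : ContDiff ℝ 1 f := by fun_prop
  refine le_trans (dimH_mono ?_) (hf.contDiffOn.dimH_image_le convex_univ (subset_univ _))
  rintro ⟨ρ, m⟩ ⟨hρ, hm⟩
  simp only at hρ hm
  set n := α ^ 2 + β ^ 2 with hn
  have hρ1 := (hA12 hρ).1
  have hm1 := hG hm
  have hn0 : 0 < n := by linarith
  have hle : m ^ 2 / n ≤ 1 := by
    rw [div_le_one hn0]
    nlinarith [hm1.1, hm1.2]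
  set τ := Real.sqrt ((ρ - m ^ 2 / n) / n) with hτ
  have hτ2 : τ ^ 2 = (ρ - m ^ 2 / n) / n := Real.sq_sqrt (div_nonneg (by linarith) hn0.le)
  have e1 : (m * α / n - τ * β) ^ 2 + (m * β / n + τ * α) ^ 2 = ρ := by
    have : (m * α / n - τ * β) ^ 2 + (m * β / n + τ * α) ^ 2 =
        m ^ 2 * (α ^ 2 + β ^ 2) / n ^ 2 + τ ^ 2 * (α ^ 2 + β ^ 2) := by
      field_simp; ring
    rw [this, hτ2, ← hn]; field_simp; ring
  have e2 : α * (m * α / n - τ * β) + β * (m * β / n + τ * α) = m := by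
    have : α * (m * α / n - τ * β) + β * (m * β / n + τ * α) = m * (α ^ 2 + β ^ 2) / n := by
      field_simp; ring
    rw [this, ← hn]; field_simp
  refine ⟨(m * α / n - τ * β, m * β / n + τ * α), ⟨?_, ?_⟩, ?_⟩
  · change _ + _ ∈ A
    simp only [e1]; exact hρ
  · simp only [e2]; exact hm
  · simp only [f, e1, e2]

lemma le_dimH_K2 {A : Set ℝ} (hA12 : A ⊆ Icc 1 2) :
    dimH (A ×ˢ Icc 0 1 : Set (ℝ × ℝ)) ≤ dimH (K2 A) :=
  (le_dimH_K2_part hA12 subset_rfl 0 1 (by norm_num)).trans (dimH_mono (sep_subset _ _))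

lemma le_dimH_K2_slice {A : Set ℝ} (hA12 : A ⊆ Icc 1 2) (v : ℝ × ℝ) (hv : v ≠ 0) :
    dimH A ≤ dimH (K2 A ∩ {p | cross v p = 0}) := by
  let f : ℝ × ℝ → ℝ := fun p => p.1 ^ 2 + p.2 ^ 2
  have hf : ContDiff ℝ 1 f := by fun_prop
  refine le_trans (dimH_mono ?_) (hf.contDiffOn.dimH_image_le convex_univ (subset_univ _))
  intro ρ hρ
  have hn0 : 0 < v.1 ^ 2 + v.2 ^ 2 := by
    by_contra hc
    apply hv
    have h1 : v.1 ^ 2 = 0 := by nlinarith [sq_nonneg v.1, sq_nonneg v.2]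
    have h2 : v.2 ^ 2 = 0 := by nlinarith [sq_nonneg v.1, sq_nonneg v.2]
    exact Prod.ext (by simpa using h1) (by simpa using h2)
  set τ := Real.sqrt (ρ / (v.1 ^ 2 + v.2 ^ 2))
  have hτ2 : τ ^ 2 = ρ / (v.1 ^ 2 + v.2 ^ 2) :=
    Real.sq_sqrt (div_nonneg (by linarith [(hA12 hρ).1]) hn0.le)
  have e1 : (τ * v.1) ^ 2 + (τ * v.2) ^ 2 = ρ := by
    have : (τ * v.1) ^ 2 + (τ * v.2) ^ 2 = τ ^ 2 * (v.1 ^ 2 + v.2 ^ 2) := by ring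
    rw [this, hτ2]; field_simp
  refine ⟨(τ * v.1, τ * v.2), ⟨?_, ?_⟩, e1⟩
  · change _ + _ ∈ A
    simp only [e1]; exact hρ
  · simp only [mem_setOf_eq, cross]; ring

lemma dimH_K2_slice_le {A : Set ℝ} (v : ℝ × ℝ) (hv : v ≠ 0) (c : ℝ) :
    dimH (K2 A ∩ {p | cross v p = c}) ≤ dimH A := by
  have hn0 : 0 < v.1 ^ 2 + v.2 ^ 2 := by
    by_contra hc
    apply hv
    have h1 : v.1 ^ 2 = 0 := by nlinarith [sq_nonneg v.1, sq_nonneg v.2]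
    have h2 : v.2 ^ 2 = 0 := by nlinarith [sq_nonneg v.1, sq_nonneg v.2]
    exact Prod.ext (by simpa using h1) (by simpa using h2)
  set n := v.1 ^ 2 + v.2 ^ 2 with hn
  let pt : ℝ → ℝ × ℝ := fun τ => (-c * v.2 / n + τ * v.1, c * v.1 / n + τ * v.2)
  let f : ℝ → ℝ → ℝ × ℝ := fun σ ρ => pt (σ * Real.sqrt ((ρ - c ^ 2 / n) / n))
  have hsub : K2 A ∩ {p | cross v p = c} ⊆
      (f 1 '' (A ∩ Ioi (c ^ 2 / n)) ∪ f (-1) '' (A ∩ Ioi (c ^ 2 / n))) ∪ {pt 0} := by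
    rintro ⟨x, y⟩ ⟨hA, hc⟩
    simp only [mem_setOf_eq, cross] at hc
    set τ := (v.1 * x + v.2 * y) / n with hτ
    have hp : ((x, y) : ℝ × ℝ) = pt τ := by
      simp only [pt, Prod.mk.injEq]
      constructor
      · rw [hτ, ← hc]; field_simp; rw [hn]; ring
      · rw [hτ, ← hc]; field_simp; rw [hn]; ring
    have hsq : x ^ 2 + y ^ 2 = c ^ 2 / n + τ ^ 2 * n := by
      rw [hτ, ← hc]; field_simp; rw [hn]; ring
    rcases eq_or_ne τ 0 with h0 | h0
    · right; rw [hp, h0]; rfl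
    left
    have hpos : 0 < τ ^ 2 * n := by positivity
    have hin : x ^ 2 + y ^ 2 ∈ A ∩ Ioi (c ^ 2 / n) := ⟨hA, by rw [mem_Ioi]; linarith⟩
    have hs : Real.sqrt ((x ^ 2 + y ^ 2 - c ^ 2 / n) / n) = |τ| := by
      rw [hsq, add_sub_cancel_left, mul_div_assoc, div_self hn0.ne', mul_one, Real.sqrt_sq_eq_abs]
    rcases h0.lt_or_gt with h | h
    · right
      refine ⟨_, hin, ?_⟩
      simp only [f]; rw [hs, abs_of_neg h, hp]; simp
    · left
      refine ⟨_, hin, ?_⟩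
      simp only [f]; rw [hs, abs_of_pos h, hp]; simp
  have hf : ∀ σ, dimH (f σ '' (A ∩ Ioi (c ^ 2 / n))) ≤ dimH A := by
    intro σ
    refine le_trans ?_ (dimH_mono (inter_subset_left (s := A) (t := Ioi (c ^ 2 / n))))
    refine ContDiffOn.dimH_image_le (s := Ioi (c ^ 2 / n)) ?_ (convex_Ioi _) inter_subset_right
    intro ρ hρ
    apply ContDiffAt.contDiffWithinAt
    have h1 : ContDiffAt ℝ 1 (fun ρ : ℝ => Real.sqrt ((ρ - c ^ 2 / n) / n)) ρ := by
      apply ContDiffAt.sqrt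
      · fun_prop
      · rw [mem_Ioi] at hρ
        exact (div_pos (by linarith) hn0).ne'
    simp only [f, pt]
    fun_prop
  refine (dimH_mono hsub).trans ?_
  rw [dimH_union, dimH_union, dimH_singleton]
  simp [hf]

end HP

namespace HP

open Filter Topology

lemma le_ofReal_of_forall {x : ℝ≥0∞} {a : ℝ} (h : ∀ v, a < v → v ≤ a + 1 → x ≤ ENNReal.ofReal v) :
    x ≤ ENNReal.ofReal a := by
  have h1 : Tendsto (fun v => ENNReal.ofReal v) (𝓝[>] a) (𝓝 (ENNReal.ofReal a)) :=
    (ENNReal.continuous_ofReal.tendsto a).mono_left nhdsWithin_le_nhds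
  refine ge_of_tendsto h1 ?_
  filter_upwards [Ioc_mem_nhdsGT (show a < a + 1 by linarith)] with v hv
  exact h v hv.1 hv.2

/-- distance to the nearest integer -/
def nint (x : ℝ) : ℝ := |x - round x|

lemma nint_continuous : Continuous nint := by
  have : nint = fun x : ℝ => ‖(x : UnitAddCircle)‖ := by
    ext x; rw [UnitAddCircle.norm_eq]; rfl
  rw [this]
  exact continuous_norm.comp (AddCircle.continuous_mk' 1)

lemma nint_le_iff {x c : ℝ} : nint x ≤ c ↔ ∃ k : ℤ, |x - k| ≤ c :=
  ⟨fun h => ⟨round x, h⟩, fun ⟨k, hk⟩ => (round_le x k).trans hk⟩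

namespace Scales

variable {s d e ε0 : ℝ} (Sc : Scales s d e ε0)

lemma pos (j : ℕ) : 0 < Sc.δ j := by
  cases j with
  | zero => rw [Sc.zero]; exact one_pos
  | succ j => exact (Sc.step j).1

lemma step_lt (h0 : 0 < ε0) (h1 : ε0 ≤ 1) : ∀ j, Sc.δ j ≤ 1 ∧ 2 ^ 20 * Sc.δ (j + 1) ≤ Sc.δ j := by
  have key : ∀ j, Sc.δ j ≤ 1 → 2 ^ 20 * Sc.δ (j + 1) ≤ Sc.δ j := by
    intro j hj
    refine (Sc.step j).lt hj (by positivity) ?_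
    rw [div_le_one (by positivity)]
    have : (0 : ℝ) ≤ j := by positivity
    linarith
  intro j
  induction j with
  | zero => exact ⟨Sc.zero.le, key 0 Sc.zero.le⟩
  | succ j ih =>
    have h : Sc.δ (j + 1) ≤ 1 := by nlinarith [ih.1, ih.2, Sc.pos (j + 1)]
    exact ⟨h, key _ h⟩

lemma le_one (h0 : 0 < ε0) (h1 : ε0 ≤ 1) (j : ℕ) : Sc.δ j ≤ 1 := (Sc.step_lt h0 h1 j).1

lemma lt (h0 : 0 < ε0) (h1 : ε0 ≤ 1) (j : ℕ) : 2 ^ 20 * Sc.δ (j + 1) ≤ Sc.δ j :=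
  (Sc.step_lt h0 h1 j).2

lemma tendsto (h0 : 0 < ε0) (h1 : ε0 ≤ 1) : Tendsto Sc.δ atTop (𝓝 0) := by
  have hb : ∀ j, Sc.δ j ≤ (1 / 2 : ℝ) ^ j := by
    intro j
    induction j with
    | zero => simp [Sc.zero]
    | succ j ih =>
      rw [pow_succ]
      nlinarith [Sc.lt h0 h1 j, Sc.pos (j + 1)]
  exact squeeze_zero (fun j => (Sc.pos j).le) hb
    (tendsto_pow_atTop_nhds_zero_of_lt_one (by norm_num) (by norm_num))

/-- the admissible spacing at exponent `σ` -/
def Rs (σ : ℝ) (j : ℕ) : ℝ := Sc.δ j ^ (1 - σ) * Sc.δ (j + 1) ^ σ / 64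

lemma eps_le (h0 : 0 < ε0) (j : ℕ) : ε0 / (j + 1) ≤ ε0 := by
  rw [div_le_iff₀ (by positivity)]
  have : (0 : ℝ) ≤ j := by positivity
  nlinarith

lemma Rs_pos (σ : ℝ) (j : ℕ) : 0 < Sc.Rs σ j := by
  have := Sc.pos j; have := Sc.pos (j + 1)
  unfold Rs; positivity

lemma le_Rs (h0 : 0 < ε0) (h1 : ε0 ≤ 1) {σ : ℝ} (hσ : 0 ≤ σ) (j : ℕ) :
    Sc.δ j * Sc.δ (j + 1) ^ σ / 64 ≤ Sc.Rs σ j := by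
  have hp := Sc.pos j; have hp' := Sc.pos (j + 1)
  unfold Rs
  gcongr
  nth_rw 1 [← Real.rpow_one (Sc.δ j)]
  exact Real.rpow_le_rpow_of_exponent_ge hp (Sc.le_one h0 h1 j) (by linarith)

lemma le_Rs' (h0 : 0 < ε0) (h1 : ε0 ≤ 1) {σ : ℝ} (hσ : 0 ≤ σ) (j : ℕ) :
    2 ^ 14 * Sc.δ (j + 1) ^ (σ + ε0 / (j + 1)) ≤ Sc.Rs σ j := by
  have hp := Sc.pos j; have hp' := Sc.pos (j + 1)
  refine le_trans ?_ (Sc.le_Rs h0 h1 hσ j)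
  have h2 := (Sc.step j).2.2.2.2.2.2.2.2.2.2.2
  rw [Real.rpow_add hp']
  have h3 : 0 < Sc.δ (j + 1) ^ σ := by positivity
  nlinarith

lemma δ_le_Rs (h0 : 0 < ε0) (h1 : ε0 ≤ 1) {σ : ℝ} (hσ : 0 ≤ σ) (hσ1 : σ ≤ 1 - ε0) (j : ℕ) :
    Sc.δ (j + 1) ≤ Sc.Rs σ j := by
  have hp' := Sc.pos (j + 1)
  refine le_trans ?_ (Sc.le_Rs' h0 h1 hσ j)
  have h3 : Sc.δ (j + 1) ^ (1 : ℝ) ≤ Sc.δ (j + 1) ^ (σ + ε0 / (j + 1)) :=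
    Real.rpow_le_rpow_of_exponent_ge hp' (Sc.le_one h0 h1 _) (by linarith [eps_le h0 j])
  rw [Real.rpow_one] at h3
  nlinarith

lemma Rs_mono (h0 : 0 < ε0) (h1 : ε0 ≤ 1) {σ σ' : ℝ} (hσ : σ ≤ σ') (j : ℕ) :
    Sc.Rs σ' j ≤ Sc.Rs σ j := by
  have hp := Sc.pos j; have hp' := Sc.pos (j + 1)
  have hle : Sc.δ (j + 1) ≤ Sc.δ j := by nlinarith [Sc.lt h0 h1 j]
  have key : ∀ τ, Sc.Rs τ j = Sc.δ j * (Sc.δ (j + 1) / Sc.δ j) ^ τ / 64 := by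
    intro τ
    unfold Rs
    rw [Real.rpow_sub hp, Real.rpow_one, Real.div_rpow hp'.le hp.le]
    ring
  rw [key, key]
  gcongr ?_ / 64
  gcongr ?_ * ?_
  exact Real.rpow_le_rpow_of_exponent_ge (by positivity) ((div_le_one hp).2 hle) hσ

lemma Rs_four (h0 : 0 < ε0) (h1 : ε0 ≤ 1) {σ : ℝ} (hσ : 0 ≤ σ) (j : ℕ) :
    4 * Sc.Rs σ j ≤ Sc.δ j := by
  have := Sc.Rs_mono h0 h1 hσ j
  have h2 : Sc.Rs 0 j = Sc.δ j / 64 := by simp [Rs]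
  linarith [Sc.pos j]

open Classical in
/-- spacing restricted to the levels `P` -/
def RR (σ : ℝ) (P : ℕ → Prop) (j : ℕ) : ℝ := if P j then Sc.Rs σ j else Sc.δ (j + 1)

lemma casc (h0 : 0 < ε0) (h1 : ε0 ≤ 1) {σ : ℝ} (hσ : 0 ≤ σ) (hσ1 : σ ≤ 1 - ε0) (P : ℕ → Prop)
    (S : ℕ → Set ℝ) (p : ℝ)
    (hS : ∀ j, P j → ∀ y, p ≤ y → y ≤ p + 1 → ∃ q ∈ S j, |q - y| ≤ Sc.Rs σ j)
    (hS' : ∀ j, ¬ P j → S j = univ) : Casc Sc.δ (Sc.RR σ P) S p where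
  zero := Sc.zero
  pos := Sc.pos
  le j := by
    unfold RR; split_ifs
    · exact Sc.δ_le_Rs h0 h1 hσ hσ1 j
    · exact le_rfl
  four j := by
    unfold RR; split_ifs
    · exact Sc.Rs_four h0 h1 hσ j
    · linarith [Sc.lt h0 h1 j, Sc.pos (j + 1)]
  dense j y hy hy' := by
    unfold RR; split_ifs with h
    · exact hS j h y hy hy'
    · exact ⟨y, by rw [hS' j h]; trivial, by simpa using (Sc.pos _).le⟩

lemma le_dimH_prod (h0 : 0 < ε0) (h1 : ε0 ≤ 1) {σ σ₁ σ₂ : ℝ} (hσ : 0 ≤ σ) (hσ₁ : σ ≤ σ₁)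
    (hσ₂ : σ ≤ σ₂) (hσ₁' : σ₁ ≤ 1 - ε0) (hσ₂' : σ₂ ≤ 1 - ε0) (P₁ P₂ : ℕ → Prop)
    (hP : ∀ j, P₁ j → ¬ P₂ j) (S₁ S₂ : ℕ → Set ℝ) (p₁ p₂ : ℝ)
    (hS₁ : ∀ j, P₁ j → ∀ y, p₁ ≤ y → y ≤ p₁ + 1 → ∃ q ∈ S₁ j, |q - y| ≤ Sc.Rs σ₁ j)
    (hS₁' : ∀ j, ¬ P₁ j → S₁ j = univ)
    (hS₂ : ∀ j, P₂ j → ∀ y, p₂ ≤ y → y ≤ p₂ + 1 → ∃ q ∈ S₂ j, |q - y| ≤ Sc.Rs σ₂ j)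
    (hS₂' : ∀ j, ¬ P₂ j → S₂ j = univ) :
    ENNReal.ofReal (1 + σ) ≤ dimH (LS Sc.δ S₁ p₁ ×ˢ LS Sc.δ S₂ p₂ : Set (ℝ × ℝ)) := by
  have hR64 : ∀ σ' j, σ ≤ σ' → Sc.Rs σ' j * 64 ≤ Sc.δ j ^ (1 - σ) * Sc.δ (j + 1) ^ σ := by
    intro σ' j h
    have h := Sc.Rs_mono h0 h1 h j
    have h2 : Sc.Rs σ j * 64 = Sc.δ j ^ (1 - σ) * Sc.δ (j + 1) ^ σ := by unfold Rs; ring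
    linarith
  have hd64 : ∀ j, Sc.δ (j + 1) * 64 ≤ Sc.δ j ^ (1 - σ) * Sc.δ (j + 1) ^ σ := by
    intro j
    have := Sc.δ_le_Rs h0 h1 hσ (hσ₁.trans hσ₁') j
    linarith [hR64 σ j le_rfl]
  have hRR : ∀ σ' P j, σ ≤ σ' → Sc.RR σ' P j * 64 ≤ Sc.δ j ^ (1 - σ) * Sc.δ (j + 1) ^ σ := by
    intro σ' P j h
    unfold RR; split_ifs
    · exact hR64 σ' j h
    · exact hd64 j
  have hRpos : ∀ σ' P j, 0 < Sc.RR σ' P j := by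
    intro σ' P j
    unfold RR; split_ifs
    · exact Sc.Rs_pos _ _
    · exact Sc.pos _
  refine le_dimH_LS_prod σ hσ (by linarith)
    (Sc.casc h0 h1 (hσ.trans hσ₁) hσ₁' P₁ S₁ p₁ hS₁ hS₁')
    (Sc.casc h0 h1 (hσ.trans hσ₂) hσ₂' P₂ S₂ p₂ hS₂ hS₂') (Sc.tendsto h0 h1) ?_ ?_ ?_
  · intro j; linarith [hRR σ₁ P₁ j hσ₁, hRpos σ₁ P₁ j]
  · intro j; linarith [hRR σ₂ P₂ j hσ₂, hRpos σ₂ P₂ j]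
  · intro j
    have hp' := Sc.pos (j + 1)
    have e : Sc.δ j ^ (1 - σ) * Sc.δ (j + 1) ^ (1 + σ) =
        (Sc.δ j ^ (1 - σ) * Sc.δ (j + 1) ^ σ) * Sc.δ (j + 1) := by
      rw [Real.rpow_add hp', Real.rpow_one]; ring
    rw [e]
    by_cases h : P₁ j
    · have h2 : Sc.RR σ₂ P₂ j = Sc.δ (j + 1) := by unfold RR; rw [if_neg (hP j h)]
      rw [h2]
      nlinarith [hRR σ₁ P₁ j hσ₁]
    · have h2 : Sc.RR σ₁ P₁ j = Sc.δ (j + 1) := by unfold RR; rw [if_neg h]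
      rw [h2]
      nlinarith [hRR σ₂ P₂ j hσ₂]

lemma LS_univ (p : ℝ) : LS Sc.δ (fun _ => univ) p = Icc p (p + 1) := by
  ext x
  constructor
  · exact fun h => h.1
  · exact fun h => ⟨h, fun j => ⟨x, trivial, by simpa using (Sc.pos _).le⟩⟩

lemma le_dimH_prod_Icc (h0 : 0 < ε0) (h1 : ε0 ≤ 1) {σ : ℝ} (hσ : 0 ≤ σ) (hσ1 : σ ≤ 1 - ε0)
    (P : ℕ → Prop) (S : ℕ → Set ℝ) (p : ℝ)
    (hS : ∀ j, P j → ∀ y, p ≤ y → y ≤ p + 1 → ∃ q ∈ S j, |q - y| ≤ Sc.Rs σ j)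
    (hS' : ∀ j, ¬ P j → S j = univ) :
    ENNReal.ofReal (1 + σ) ≤ dimH (LS Sc.δ S p ×ˢ Icc (0 : ℝ) 1 : Set (ℝ × ℝ)) := by
  have := Sc.le_dimH_prod h0 h1 hσ le_rfl le_rfl hσ1 hσ1 P (fun _ => False) (by simp) S
    (fun _ => univ) p 0 hS hS' (by simp) (by simp)
  rwa [LS_univ, zero_add] at this

lemma le_dimH_LS (h0 : 0 < ε0) (h1 : ε0 ≤ 1) {σ : ℝ} (hσ : 0 ≤ σ) (hσ1 : σ ≤ 1 - ε0)
    (P : ℕ → Prop) (S : ℕ → Set ℝ) (p : ℝ)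
    (hS : ∀ j, P j → ∀ y, p ≤ y → y ≤ p + 1 → ∃ q ∈ S j, |q - y| ≤ Sc.Rs σ j)
    (hS' : ∀ j, ¬ P j → S j = univ) : ENNReal.ofReal σ ≤ dimH (LS Sc.δ S p) := by
  have h := (Sc.le_dimH_prod_Icc h0 h1 hσ hσ1 P S p hS hS').trans
    (dimH_prod_Icc_le (LS Sc.δ S p) 0 1 zero_le_one (by norm_num))
  rw [add_comm, ENNReal.ofReal_add hσ zero_le_one, ENNReal.ofReal_one] at h
  exact (ENNReal.add_le_add_iff_right ENNReal.one_ne_top).1 h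

open Classical in
/-- grids of spacing `Rs` at the levels congruent to `2` -/
def SA (σ : ℝ) (j : ℕ) : Set ℝ :=
  if j % 3 = 2 then Set.range (fun k : ℤ => (k : ℝ) * Sc.Rs σ j) else univ

lemma SA_dense (σ : ℝ) (j : ℕ) (hj : j % 3 = 2) (y : ℝ) : ∃ q ∈ Sc.SA σ j, |q - y| ≤ Sc.Rs σ j := by
  have hR := Sc.Rs_pos σ j
  refine ⟨(round (y / Sc.Rs σ j) : ℝ) * Sc.Rs σ j, ?_, ?_⟩
  · unfold SA; rw [if_pos hj]; exact ⟨_, rfl⟩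
  · have h := abs_sub_round (y / Sc.Rs σ j)
    have e : (round (y / Sc.Rs σ j) : ℝ) * Sc.Rs σ j - y =
        -((y / Sc.Rs σ j - round (y / Sc.Rs σ j)) * Sc.Rs σ j) := by
      field_simp; ring
    rw [e, abs_neg, abs_mul, abs_of_pos hR]
    nlinarith

/-- the radii -/
def radA (σ : ℝ) : Set ℝ := LS Sc.δ (Sc.SA σ) 1

lemma radA_sub (σ : ℝ) : Sc.radA σ ⊆ Icc 1 2 := by
  intro x hx; have := hx.1; norm_num at this; exact this

lemma radA_compact (σ : ℝ) : IsCompact (Sc.radA σ) := by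
  refine isCompact_Icc.of_isClosed_subset ?_ (Sc.radA_sub σ)
  have : Sc.radA σ = Icc 1 (1 + 1) ∩
      ⋂ j, {x | j % 3 = 2 → nint (x / Sc.Rs σ j) ≤ Sc.δ (j + 1) / Sc.Rs σ j} := by
    ext x
    unfold radA LS
    simp only [Set.mem_inter_iff, Set.mem_iInter, Set.mem_setOf_eq]
    refine and_congr_right fun _ => forall_congr' fun j => ?_
    have hR := Sc.Rs_pos σ j
    by_cases hj : j % 3 = 2
    · simp only [hj, forall_true_left, nint_le_iff, SA, if_true]
      simp only [Set.mem_range, exists_exists_eq_and]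
      refine exists_congr fun k => ?_
      rw [le_div_iff₀ hR, ← abs_of_pos hR, ← abs_mul, abs_of_pos hR]
      have : (x / Sc.Rs σ j - k) * Sc.Rs σ j = x - k * Sc.Rs σ j := by field_simp
      rw [this]
    · simp only [hj, SA, if_false, false_imp_iff, iff_true]
      exact ⟨x, trivial, by simpa using (Sc.pos _).le⟩
  rw [this]
  refine isClosed_Icc.inter (isClosed_iInter fun j => ?_)
  by_cases hj : j % 3 = 2
  · simp only [hj, forall_true_left]
    exact isClosed_le (nint_continuous.comp (by fun_prop)) continuous_const
  · simp [hj]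

lemma eps_ev {c : ℝ} (hc : 0 < c) : ∀ᶠ j : ℕ in atTop, ε0 / (j + 1) ≤ c := by
  have h : Tendsto (fun j : ℕ => ε0 / ((j : ℝ) + 1)) atTop (𝓝 0) :=
    tendsto_const_nhds.div_atTop (tendsto_natCast_atTop_atTop.atTop_add tendsto_const_nhds)
  filter_upwards [h.eventually (gt_mem_nhds hc)] with j hj using hj.le

/-- Scales can be chosen arbitrarily late in a residue class. -/
lemma exists_level (h0 : 0 < ε0) (h1 : ε0 ≤ 1) (i : ℕ) (hi : i < 3) {c η : ℝ} (hc : 0 < c)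
    (hη : 0 < η) {Q : ℕ → Prop} (hQ : ∀ᶠ j in atTop, Q j) :
    ∃ j, j % 3 = i ∧ ε0 / (j + 1) ≤ c ∧ Sc.δ (j + 1) ≤ η ∧ Q j := by
  have h3 : ∀ᶠ j in atTop, Sc.δ (j + 1) ≤ η := by
    filter_upwards [((tendsto_add_atTop_iff_nat 1).2 (Sc.tendsto h0 h1)).eventually
      (gt_mem_nhds hη)] with j hj using hj.le
  obtain ⟨N, hN⟩ := eventually_atTop.1 ((eps_ev (ε0 := ε0) hc).and (h3.and hQ))
  refine ⟨3 * N + i, by omega, ?_⟩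
  exact hN (3 * N + i) (by omega)

lemma dimH_radA_le (h0 : 0 < ε0) (h1 : ε0 ≤ 1) {σ : ℝ} (hσ : 0 ≤ σ) (hσ1 : σ ≤ 1) :
    dimH (Sc.radA σ) ≤ ENNReal.ofReal σ := by
  refine le_ofReal_of_forall fun v hv hv1 => ?_
  refine dimH_le_of_covers _ v (by linarith) fun η hη => ?_
  obtain ⟨j, hj3, hjc, hjη, -⟩ := Sc.exists_level h0 h1 2 (by norm_num) (c := v - σ) (η := η / 2)
    (by linarith) (by linarith) (Q := fun _ => True) (by simp)
  have hR := Sc.Rs_pos σ j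
  have hp' := Sc.pos (j + 1)
  set R := Sc.Rs σ j with hRdef
  have hR4 : 4 * R ≤ 1 := (Sc.Rs_four h0 h1 hσ j).trans (Sc.le_one h0 h1 j)
  have hRl := Sc.le_Rs' h0 h1 hσ j
  have hdl : Sc.δ (j + 1) ≤ 1 := Sc.le_one h0 h1 _
  set δ' := Sc.δ (j + 1)
  set N : ℤ := ⌈3 / R⌉
  have hNle : (N : ℝ) ≤ 3 / R + 1 := (Int.ceil_lt_add_one _).le
  have hNge : 3 / R ≤ (N : ℝ) := Int.le_ceil _
  refine ⟨ℤ, Finset.Icc 0 N, fun k => Icc ((k : ℝ) * R - δ') (k * R + δ'), 2 * δ', by linarith,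
    by linarith, ?_, ?_, ?_⟩
  · intro x hx
    have hx12 := Sc.radA_sub σ hx
    obtain ⟨q, hq, hxq⟩ := hx.2 j
    simp only [SA, hj3, if_true] at hq
    obtain ⟨k, rfl⟩ := hq
    simp only at hxq
    rw [abs_le] at hxq
    simp only [Set.mem_iUnion, Finset.mem_Icc]
    refine ⟨k, ⟨?_, ?_⟩, ⟨by linarith, by linarith⟩⟩
    · have : (-1 : ℝ) < k := by
        by_contra hc
        push Not at hc
        have : δ' ≥ 1 + R := by nlinarith [hx12.1]
        linarith
      have : (-1 : ℤ) < k := by exact_mod_cast this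
      omega
    · have : (k : ℝ) ≤ N := by
        refine le_trans ?_ hNge
        rw [le_div_iff₀ hR]; linarith [hx12.2]
      exact_mod_cast this
  · intro k _
    rw [Real.ediam_Icc]
    exact ENNReal.ofReal_le_ofReal (by linarith)
  · have hc : ((Finset.Icc 0 N).card : ℝ) ≤ 4 / R := by
      rw [Int.card_Icc]
      have hN0 : 0 ≤ N + 1 - 0 := by
        have : (0 : ℝ) ≤ N := le_trans (by positivity) hNge
        have : (0 : ℤ) ≤ N := by exact_mod_cast this
        omega
      have : (((N + 1 - 0).toNat : ℤ) : ℝ) = N + 1 := by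
        rw [Int.toNat_of_nonneg hN0]; push_cast; ring
      rw [Int.cast_natCast] at this
      rw [this]
      have : 2 ≤ 1 / R := by rw [le_div_iff₀ hR]; linarith
      have e : 4 / R = 3 / R + 1 / R := by ring
      linarith
    have h2 : (2 * δ') ^ v ≤ 4 * δ' ^ v := by
      rw [Real.mul_rpow (by norm_num) hp'.le]
      have : (2 : ℝ) ^ v ≤ 2 ^ (2 : ℝ) :=
        Real.rpow_le_rpow_of_exponent_le (by norm_num) (by linarith)
      have h4 : (2 : ℝ) ^ (2 : ℝ) = 4 := by norm_num
      rw [h4] at this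
      gcongr
    have h3 : δ' ^ v ≤ δ' ^ (σ + ε0 / (j + 1)) :=
      Real.rpow_le_rpow_of_exponent_ge hp' hdl (by linarith)
    calc ((Finset.Icc 0 N).card : ℝ) * (2 * δ') ^ v ≤ 4 / R * (4 * δ' ^ v) := by gcongr
      _ ≤ 1 := by
        rw [div_mul_eq_mul_div, div_le_one hR]
        have : 0 < δ' ^ v := by positivity
        linarith

end Scales

end HP

namespace HP

open Filter Topology

namespace Scales

variable {s d e ε0 : ℝ} (Sc : Scales s d e ε0)

lemma ev_small (h0 : 0 < ε0) (h1 : ε0 ≤ 1) (K : ℝ) {c η : ℝ} (hc : 0 < c) (hη : 0 < η) :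
    ∀ᶠ j : ℕ in atTop, K * Sc.δ (j + 1) ^ c ≤ η := by
  have h2 := ((tendsto_add_atTop_iff_nat 1).2 (Sc.tendsto h0 h1)).rpow_const (p := c)
    (Or.inr hc.le)
  rw [Real.zero_rpow hc.ne'] at h2
  have h3 := h2.const_mul K
  rw [mul_zero] at h3
  filter_upwards [h3.eventually (gt_mem_nhds hη)] with j hj using hj.le

/-- The shear parameter of a level. -/
def kap (j : ℕ) : ℝ := if j % 3 = 0 then 0 else 1 / 8

lemma kap_cases (j : ℕ) : kap j = 0 ∨ kap j = 1 / 8 := by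
  unfold kap; split_ifs <;> simp

/-- The basic condition at a level. -/
def Cond (j : ℕ) (x y : ℝ) : Prop :=
  nint (Sc.r j / x - 1 / Sc.D j) ≤ 8 * (Sc.r j * Sc.δ (j + 1)) ∧
    nint (Sc.D j * Sc.E j * Sc.r j * (y / x)) ≤ 40 / Sc.D j

/-- The set `K¹`. -/
def K1 : Set (ℝ × ℝ) :=
  {p | p.1 ∈ Icc (1 : ℝ) 2 ∧ p.2 ∈ Icc (-3 : ℝ) 2 ∧
    ∀ j, j % 3 ≠ 2 → Sc.Cond j (p.1 + kap j * p.2) p.2}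

lemma shear_bd {x y : ℝ} (j : ℕ) (hx : x ∈ Icc (1 : ℝ) 2) (hy : y ∈ Icc (-3 : ℝ) 2) :
    1 / 2 ≤ x + kap j * y ∧ x + kap j * y ≤ 3 := by
  rcases kap_cases j with h | h <;> rw [h] <;>
    constructor <;> linarith [hx.1, hx.2, hy.1, hy.2]

lemma K1_compact : IsCompact Sc.K1 := by
  refine (isCompact_Icc (a := (1 : ℝ)) (b := 2) |>.prod
    (isCompact_Icc (a := (-3 : ℝ)) (b := 2))).of_isClosed_subset ?_ ?_
  · have : Sc.K1 = (Icc (1 : ℝ) 2 ×ˢ Icc (-3 : ℝ) 2) ∩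
        ⋂ j, {p | j % 3 ≠ 2 → Sc.Cond j (max (p.1 + kap j * p.2) (1 / 2)) p.2} := by
      ext ⟨x, y⟩
      simp only [K1, Set.mem_inter_iff, Set.mem_iInter, Set.mem_setOf_eq, Set.mem_prod, and_assoc]
      refine and_congr_right fun hx => and_congr_right fun hy => forall_congr' fun j => ?_
      rw [max_eq_left (shear_bd j hx hy).1]
    rw [this]
    refine (isClosed_Icc.prod isClosed_Icc).inter (isClosed_iInter fun j => ?_)
    by_cases hj : j % 3 ≠ 2
    · have hset : {p : ℝ × ℝ | j % 3 ≠ 2 → Sc.Cond j (max (p.1 + kap j * p.2) (1 / 2)) p.2} =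
          {p : ℝ × ℝ | nint (Sc.r j / (max (p.1 + kap j * p.2) (1 / 2)) - 1 / Sc.D j) ≤
            8 * (Sc.r j * Sc.δ (j + 1))} ∩
          {p : ℝ × ℝ | nint (Sc.D j * Sc.E j * Sc.r j * (p.2 / (max (p.1 + kap j * p.2) (1 / 2))))
            ≤ 40 / Sc.D j} := by
        ext p
        exact ⟨fun h => h hj, fun h _ => h⟩
      rw [hset]
      have hpos : ∀ p : ℝ × ℝ, max (p.1 + kap j * p.2) (1 / 2) ≠ 0 := fun p =>
        (lt_of_lt_of_le (by norm_num) (le_max_right _ _)).ne'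
      refine IsClosed.inter (isClosed_le (nint_continuous.comp ?_) continuous_const)
        (isClosed_le (nint_continuous.comp ?_) continuous_const)
      · exact (continuous_const.div (by fun_prop) hpos).sub continuous_const
      · exact continuous_const.mul (continuous_snd.div (by fun_prop) hpos)
    · simp [hj]
  · rintro p ⟨h1, h2, -⟩; exact ⟨h1, h2⟩

/-- casts of the level data -/
lemma data (j : ℕ) : (1 : ℝ) ≤ Sc.r j ∧ (1 : ℝ) ≤ Sc.E j ∧ (1 : ℝ) ≤ Sc.D j ∧
    Sc.δ (j + 1) * ((Sc.D j : ℝ) ^ 2 * Sc.E j * Sc.r j) = 1 := by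
  obtain ⟨-, h1, h2, h3, h4, -⟩ := Sc.step j
  exact ⟨by exact_mod_cast h1, by exact_mod_cast h2, by exact_mod_cast h3, h4⟩

lemma rδ_le (j : ℕ) : Sc.r j * Sc.δ (j + 1) ≤ 1 / (Sc.D j : ℝ) ^ 2 := by
  obtain ⟨h1, h2, h3, h4⟩ := Sc.data j
  have := Sc.pos (j + 1)
  rw [le_div_iff₀ (by positivity)]
  nlinarith [show 0 ≤ Sc.δ (j + 1) * ((Sc.D j : ℝ) ^ 2 * Sc.r j) by positivity]

lemma rpow_bd {g x a : ℝ} (hg : 0 < g) (h : x * g ^ a ≤ 1) : x ≤ g ^ (-a) := by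
  rw [Real.rpow_neg hg.le, ← one_div, le_div_iff₀ (by positivity)]; exact h

lemma inv_diff {r w w' b c : ℝ} (hr : 0 < r) (hb : 0 < b) (hw : b ≤ w) (hw' : b ≤ w')
    (h : |w - w'| ≤ c) : |r / w - r / w'| ≤ r * c / b ^ 2 := by
  have h1 : 0 < w := by linarith
  have h2 : 0 < w' := by linarith
  have e : r / w - r / w' = r * (w' - w) / (w * w') := by field_simp
  have hc : 0 ≤ c := (abs_nonneg _).trans h
  rw [e, abs_div, abs_mul, abs_of_pos hr, abs_of_pos (mul_pos h1 h2), abs_sub_comm]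
  gcongr
  nlinarith

set_option maxHeartbeats 2000000 in
lemma dimH_K1_le (h0 : 0 < ε0) (h1 : ε0 ≤ 1) (hs : 0 < s) (hd : 0 < d) (he : 0 ≤ e)
    (hsum : s + 2 * d + e = 1) : dimH Sc.K1 ≤ ENNReal.ofReal (1 + s - d) := by
  refine le_ofReal_of_forall fun v hv hv1 => ?_
  refine dimH_le_of_covers _ v (by linarith) fun η hη => ?_
  obtain ⟨j, hj3, hjc, hjη, hsm⟩ := Sc.exists_level h0 h1 0 (by norm_num)
    (c := (v - (1 + s - d)) / 6) (η := η / 400)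
    (by linarith) (by linarith) (Sc.ev_small h0 h1 (2000 * 400 ^ 3)
      (c := (v - (1 + s - d)) / 2) (by linarith) one_pos)
  obtain ⟨hr, hE, hD, hδ⟩ := Sc.data j
  obtain ⟨-, -, -, -, -, -, -, hr2, hE2, hD2, -⟩ := Sc.step j
  have hp' := Sc.pos (j + 1)
  have hdl : Sc.δ (j + 1) ≤ 1 := Sc.le_one h0 h1 _
  set δ' := Sc.δ (j + 1)
  set ε := ε0 / (j + 1)
  set r := Sc.r j
  set D := Sc.D j
  set E := Sc.E j
  set C : ℝ := D * E * r with hC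
  have hC1 : 1 ≤ C := one_le_mul_of_one_le_of_one_le (one_le_mul_of_one_le_of_one_le hD hE) hr
  have hCδ : C * δ' * D = 1 := by rw [← hδ, hC]; ring
  have hrδ : r * δ' ≤ 1 := (Sc.rδ_le j).trans (by
    rw [div_le_one (by positivity)]; exact one_le_pow₀ hD)
  let U : ℤ × ℤ → Set (ℝ × ℝ) := fun kh => {p | p.1 ∈ Icc (1 : ℝ) 2 ∧ p.2 ∈ Icc (-3 : ℝ) 2 ∧
    |r / p.1 - 1 / D - kh.1| ≤ 8 * (r * δ') ∧ |C * (p.2 / p.1) - kh.2| ≤ 40 / D}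
  refine ⟨ℤ × ℤ, Finset.Icc (-(10 * r : ℤ)) (10 * r) ×ˢ Finset.Icc (-(43 * (D * E * r) : ℤ)) (43 * (D * E * r)),
    U, 400 * δ', by linarith, by linarith, ?_, ?_, ?_⟩
  · rintro ⟨x, y⟩ ⟨hx, hy, hcond⟩
    have := hcond j (by omega)
    simp only [kap, hj3, if_true, zero_mul, add_zero, Cond] at this
    obtain ⟨c1, c2⟩ := this
    obtain ⟨k, hk⟩ := nint_le_iff.1 c1
    obtain ⟨h, hh⟩ := nint_le_iff.1 c2
    simp only at hx hy
    simp only [Set.mem_iUnion]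
    refine ⟨(k, h), ?_, hx, hy, hk, hh⟩
    have hx0 : 0 < x := by linarith [hx.1]
    have hrx : r / x ≤ r := div_le_self (by positivity) hx.1
    have hrx0 : 0 ≤ r / x := by positivity
    have hD1 : 1 / (D : ℝ) ≤ 1 := by rw [div_le_one (by positivity)]; exact hD
    have hD0 : 0 < 1 / (D : ℝ) := by positivity
    have hD40 : 40 / (D : ℝ) ≤ 40 := by rw [div_le_iff₀ (by positivity)]; linarith
    have hyx : |y / x| ≤ 3 := by
      rw [abs_div, abs_of_pos hx0, div_le_iff₀ hx0, abs_le]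
      constructor <;> linarith [hx.1, hy.1, hy.2]
    rw [abs_le] at hk hh hyx
    simp only [Finset.mem_product, Finset.mem_Icc]
    have hrδ' : 8 * (r * δ') ≤ 8 * r := by nlinarith
    refine ⟨⟨?_, ?_⟩, ?_, ?_⟩
    · have : -(10 * r : ℝ) ≤ k := by linarith
      exact_mod_cast this
    · have : (k : ℝ) ≤ 10 * r := by linarith
      exact_mod_cast this
    · have : -(43 * C : ℝ) ≤ h := by
        have : -(3 * C) ≤ C * (y / x) := by nlinarith
        have := hh.2
        linarith
      rw [hC] at this
      exact_mod_cast this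
    · have : (h : ℝ) ≤ 43 * C := by
        have : C * (y / x) ≤ 3 * C := by nlinarith
        have := hh.1
        linarith
      rw [hC] at this
      exact_mod_cast this
  · rintro ⟨k, h⟩ -
    refine ediam_le fun p hp q hq => ?_
    obtain ⟨x, y⟩ := p
    obtain ⟨x', y'⟩ := q
    obtain ⟨hx, hy, ha, hb⟩ := hp
    obtain ⟨hx', hy', ha', hb'⟩ := hq
    simp only at hx hy ha hb hx' hy' ha' hb'
    have hx0 : 0 < x := by linarith [hx.1]
    have hx0' : 0 < x' := by linarith [hx'.1]
    rw [edist_dist]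
    apply ENNReal.ofReal_le_ofReal
    have hr0 : (0 : ℝ) < r := by linarith
    have hw : |r / x - r / x'| ≤ 16 * (r * δ') := by
      rw [abs_le] at *; constructor <;> linarith [ha.1, ha.2, ha'.1, ha'.2]
    have hxx : |x - x'| ≤ 64 * δ' := by
      have h2 := inv_diff (r := r) (b := r / 2) hr0 (by linarith)
        (w := r / x) (w' := r / x') (by gcongr; exact hx.2) (by gcongr; exact hx'.2) hw
      rw [div_div_cancel₀ hr0.ne', div_div_cancel₀ hr0.ne'] at h2
      refine h2.trans (le_of_eq ?_)
      field_simp; ring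
    have hyy : |y / x - y' / x'| ≤ 80 * δ' := by
      have h2 : |C * (y / x - y' / x')| ≤ 80 / D := by
        have e80 : 80 / (D : ℝ) = 40 / D + 40 / D := by ring
        rw [abs_le] at *; constructor <;> linarith [hb.1, hb.2, hb'.1, hb'.2]
      rw [abs_mul, abs_of_pos (by linarith)] at h2
      have : 80 / (D : ℝ) = C * (80 * δ') := by
        rw [div_eq_iff (by positivity)]; linarith
      rw [this] at h2
      exact le_of_mul_le_mul_left h2 (by linarith)
    have hyx : |y / x| ≤ 3 := by
      rw [abs_div, abs_of_pos hx0, div_le_iff₀ hx0, abs_le]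
      constructor <;> linarith [hx.1, hy.1, hy.2]
    have hy2 : |y - y'| ≤ 400 * δ' := by
      have e1 : y - y' = (y / x) * (x - x') + x' * (y / x - y' / x') := by field_simp; ring
      rw [e1]
      refine (abs_add_le _ _).trans ?_
      rw [abs_mul, abs_mul, abs_of_pos hx0']
      have t1 : |y / x| * |x - x'| ≤ 3 * (64 * δ') := by gcongr
      have t2 : x' * |y / x - y' / x'| ≤ 2 * (80 * δ') := by gcongr; exact hx'.2
      linarith
    rw [Prod.dist_eq, max_le_iff]
    exact ⟨by rw [Real.dist_eq]; simp only; linarith, by rw [Real.dist_eq]; exact hy2⟩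
  · have hcard : ((Finset.Icc (-(10 * r : ℤ)) (10 * r) ×ˢ
        Finset.Icc (-(43 * (D * E * r) : ℤ)) (43 * (D * E * r))).card : ℝ) ≤ 2000 * (r * C) := by
      rw [Finset.card_product, Int.card_Icc, Int.card_Icc]
      have e1 : ((10 * r : ℤ) + 1 - -(10 * r : ℤ)).toNat = 20 * r + 1 := by omega
      have e2 : ((43 * (D * E * r) : ℤ) + 1 - -(43 * (D * E * r) : ℤ)).toNat = 86 * (D * E * r) + 1 := by
        have h0' : (0 : ℤ) ≤ (D * E * r : ℤ) := by positivity
        zify; rw [Int.toNat_of_nonneg (by linarith)]; ring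
      rw [e1, e2]
      push_cast
      rw [← hC]
      have : (r : ℝ) * C ≥ 1 := one_le_mul_of_one_le_of_one_le hr hC1
      nlinarith
    have hrC : r * C ≤ δ' ^ (-(1 + s - d + 3 * ε)) := by
      have b1 := rpow_bd hp' hr2
      have b2 := rpow_bd hp' hE2
      have b3 := rpow_bd hp' hD2
      calc (r : ℝ) * C = r * r * E * D := by rw [hC]; ring
        _ ≤ δ' ^ (-(s + ε)) * δ' ^ (-(s + ε)) * δ' ^ (-(e + ε)) * δ' ^ (-d) := by gcongr
        _ = δ' ^ (-(1 + s - d + 3 * ε)) := by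
          rw [← Real.rpow_add hp', ← Real.rpow_add hp', ← Real.rpow_add hp']
          congr 1; linarith
    have h4 : (400 * δ') ^ v ≤ 400 ^ 3 * δ' ^ v := by
      rw [Real.mul_rpow (by norm_num) hp'.le]
      have : (400 : ℝ) ^ v ≤ 400 ^ (3 : ℝ) :=
        Real.rpow_le_rpow_of_exponent_le (by norm_num) (by linarith)
      have h4 : (400 : ℝ) ^ (3 : ℝ) = 400 ^ 3 := by norm_num
      rw [h4] at this
      gcongr
    calc _ ≤ 2000 * (δ' ^ (-(1 + s - d + 3 * ε))) * (400 ^ 3 * δ' ^ v) := by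
            refine mul_le_mul (hcard.trans ?_) h4 (by positivity) (by positivity)
            gcongr
      _ = 2000 * 400 ^ 3 * δ' ^ (v - (1 + s - d) - 3 * ε) := by
          have : v - (1 + s - d) - 3 * ε = -(1 + s - d + 3 * ε) + v := by ring
          rw [this, Real.rpow_add hp']; ring
      _ ≤ 2000 * 400 ^ 3 * δ' ^ ((v - (1 + s - d)) / 2) := by
          gcongr ?_ * ?_
          exact Real.rpow_le_rpow_of_exponent_ge hp' hdl (by linarith)
      _ ≤ 1 := hsm

end Scales

end HP

namespace HP

open Filter Topology

set_option maxHeartbeats 1000000 in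
lemma lower_alg (r E D : ℕ) (δ' a κ m x : ℝ) (l n k : ℤ) (hr : (1 : ℝ) ≤ r) (hE : (1 : ℝ) ≤ E)
    (hD : (1 : ℝ) ≤ D) (hδ : δ' * ((D : ℝ) ^ 2 * E * r) = 1) (hδ0 : 0 < δ') (hδ1 : δ' ≤ 1 / 1000)
    (ha : |a| ≤ 1) (hκ : κ = 0 ∨ κ = 1 / 8) (hm0 : 0 ≤ m) (hm1 : m ≤ 1) (hx1 : 1 ≤ x) (hx2 : x ≤ 2)
    (hm : |m - (1 + κ * a) * (l + D * n) / (D * E)| ≤ δ')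
    (hl : |a / (1 + κ * a) - l * δ'| ≤ δ' / 2) (hw : (r : ℝ) / 3 ≤ k + 1 / D)
    (hx : |x - (r / (k + 1 / D) + κ * m) / (1 + κ * a)| ≤ δ') :
    nint (r / (x + κ * (a * x - m)) - 1 / D) ≤ 8 * (r * δ') ∧
      nint (D * E * r * ((a * x - m) / (x + κ * (a * x - m)))) ≤ 40 / D := by
  rw [abs_le] at ha
  set q := 1 + κ * a with hq
  have hq1 : 7 / 8 ≤ q := by rcases hκ with h | h <;> rw [hq, h] <;> linarith
  have hq2 : q ≤ 9 / 8 := by rcases hκ with h | h <;> rw [hq, h] <;> linarith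
  have hκ0 : 0 ≤ κ := by rcases hκ with h | h <;> rw [h]; norm_num
  have hκ1 : κ ≤ 1 / 8 := by rcases hκ with h | h <;> rw [h]; norm_num
  set w : ℝ := k + 1 / D with hwdef
  have hr0 : (0 : ℝ) < r := by linarith
  have hD0 : (0 : ℝ) < D := by linarith
  have hE0 : (0 : ℝ) < E := by linarith
  have hw0 : 0 < w := by linarith
  have hq0 : 0 < q := by linarith
  set x' := x + κ * (a * x - m) with hx'
  have hx'q : x' = q * x - κ * m := by rw [hx', hq]; ring
  have hx'1 : 3 / 4 ≤ x' := by rw [hx'q]; nlinarith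
  have hx'0 : 0 < x' := by linarith
  -- distance to r / w
  have d1 : |x' - r / w| ≤ 9 / 8 * δ' := by
    have e : x' - r / w = q * (x - (r / w + κ * m) / q) := by rw [hx'q]; field_simp; ring
    rw [e, abs_mul, abs_of_pos hq0]
    gcongr
  have hrw : 7 / 10 ≤ r / w := by rw [abs_le] at d1; linarith
  have hwr : w / r ≤ 10 / 7 := by
    rw [div_le_iff₀ hr0]; rw [le_div_iff₀ hw0] at hrw; linarith
  have hwr0 : 0 < w / r := by positivity
  have d2 : |1 / x' - w / r| ≤ 5 / 2 * δ' := by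
    have e : 1 / x' - w / r = -((w / r) * (x' - r / w) / x') := by field_simp; ring
    rw [e, abs_neg, abs_div, abs_mul, abs_of_pos hwr0, abs_of_pos hx'0, div_le_iff₀ hx'0]
    calc w / r * |x' - r / w| ≤ 10 / 7 * (9 / 8 * δ') := by gcongr
      _ ≤ 5 / 2 * δ' * x' := by nlinarith
  constructor
  · rw [nint_le_iff]
    refine ⟨k, ?_⟩
    have e : r / x' - 1 / D - k = r * (1 / x' - w / r) := by
      have : r * (1 / x' - w / r) = r / x' - w := by field_simp
      rw [this, hwdef]; ring
    rw [e, abs_mul, abs_of_pos hr0]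
    nlinarith
  · rw [nint_le_iff]
    refine ⟨-n - (l + D * n) * k, ?_⟩
    set i : ℝ := l + D * n with hi
    have hy : (a * x - m) / x' = a / q - (m / q) * (1 / x') := by
      have : a * x - m = (a / q) * x' - m / q := by
        rw [hx'q]; field_simp; rw [hq]; ring
      rw [this]; field_simp
    have hzint : (((-n - (l + D * n) * k : ℤ)) : ℝ) = D * E * r * (l * δ' - (i / (D * E)) * (w / r)) := by
      have e1 : D * E * r * (l * δ') = l / D := by
        rw [eq_div_iff hD0.ne']
        linear_combination (l : ℝ) * hδ
      have e2 : D * E * r * ((i / (D * E)) * (w / r)) = i * w := by field_simp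
      rw [mul_sub, e1, e2, hwdef, hi]
      push_cast
      field_simp
      ring
    rw [hzint, hy, ← mul_sub, abs_mul, abs_of_pos (by positivity)]
    have e3 : a / q - m / q * (1 / x') - (l * δ' - i / (D * E) * (w / r)) =
        (a / q - l * δ') - ((m / q - i / (D * E)) * (w / r) + m / q * (1 / x' - w / r)) := by ring
    have d3 : |m / q - i / (D * E)| ≤ 8 / 7 * δ' := by
      have e : m / q - i / (D * E) = (m - q * i / (D * E)) / q := by field_simp
      rw [e, abs_div, abs_of_pos hq0, div_le_iff₀ hq0]
      nlinarith
    have hmq : m / q ≤ 8 / 7 := by rw [div_le_iff₀ hq0]; linarith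
    have hmq0 : 0 ≤ m / q := by positivity
    have tot : |a / q - m / q * (1 / x') - (l * δ' - i / (D * E) * (w / r))| ≤ 40 * δ' := by
      rw [e3]
      refine (abs_sub _ _).trans ?_
      have t1 : |(m / q - i / (D * E)) * (w / r) + m / q * (1 / x' - w / r)| ≤
          8 / 7 * δ' * (10 / 7) + 8 / 7 * (5 / 2 * δ') := by
        refine (abs_add_le _ _).trans ?_
        rw [abs_mul, abs_mul, abs_of_pos hwr0, abs_of_nonneg hmq0]
        gcongr
      linarith
    calc _ ≤ D * E * r * (40 * δ') := by gcongr
      _ = 40 / D := by rw [eq_div_iff hD0.ne']; linear_combination 40 * hδ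

namespace Scales

variable {s d e ε0 : ℝ} (Sc : Scales s d e ε0)

/-- good offsets at a level -/
def SG (a : ℝ) (j : ℕ) : Set ℝ :=
  if j % 3 ≠ 2 then Set.range (fun n : ℤ => (1 + kap j * a) *
    ((round (a / (1 + kap j * a) / Sc.δ (j + 1)) : ℤ) + Sc.D j * n) / (Sc.D j * Sc.E j)) else univ

/-- good abscissae at a level -/
def SZ (a m : ℝ) (j : ℕ) : Set ℝ :=
  if j % 3 ≠ 2 then {x | ∃ k : ℤ, (Sc.r j : ℝ) / 3 ≤ k + 1 / Sc.D j ∧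
    x = (Sc.r j / (k + 1 / Sc.D j) + kap j * m) / (1 + kap j * a)} else univ

lemma q_bd {a : ℝ} (ha : |a| ≤ 1) (j : ℕ) : 7 / 8 ≤ 1 + kap j * a ∧ 1 + kap j * a ≤ 9 / 8 := by
  rw [abs_le] at ha
  rcases kap_cases j with h | h <;> rw [h] <;> constructor <;> linarith

lemma SG_dense (h0 : 0 < ε0) (h1 : ε0 ≤ 1) (he : 0 ≤ e) {a : ℝ} (ha : |a| ≤ 1) (j : ℕ)
    (hj : j % 3 ≠ 2) (y : ℝ) : ∃ q ∈ Sc.SG a j, |q - y| ≤ Sc.Rs e j := by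
  obtain ⟨hr, hE, hD, hδ⟩ := Sc.data j
  obtain ⟨-, -, -, -, -, -, hE1, -⟩ := Sc.step j
  obtain ⟨hq1, hq2⟩ := q_bd ha j
  set q := 1 + kap j * a
  set l : ℤ := round (a / q / Sc.δ (j + 1)) with hl
  have hE0 : (0 : ℝ) < Sc.E j := by linarith
  have hD0 : (0 : ℝ) < Sc.D j := by linarith
  have hq0 : 0 < q := by linarith
  set z : ℝ := y * Sc.E j / q - l / Sc.D j with hz
  refine ⟨q * (l + Sc.D j * (round z : ℤ)) / (Sc.D j * Sc.E j), ?_, ?_⟩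
  · unfold SG; rw [if_pos hj]; exact ⟨round z, rfl⟩
  · have e1 : q * (l + Sc.D j * (round z : ℤ)) / (Sc.D j * Sc.E j) - y =
        -(q / Sc.E j * (z - round z)) := by
      rw [hz]; field_simp; ring
    rw [e1, abs_neg, abs_mul, abs_of_pos (by positivity)]
    have h3 := abs_sub_round z
    refine le_trans ?_ (Sc.le_Rs h0 h1 he j)
    calc q / Sc.E j * |z - round z| ≤ (9 / 8) / Sc.E j * (1 / 2) := by gcongr
      _ ≤ _ := by
        rw [div_mul_eq_mul_div, div_le_iff₀ hE0]
        linarith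

lemma r_big (h0 : 0 < ε0) (h1 : ε0 ≤ 1) (hs : 0 < s) (j : ℕ) : (2 : ℝ) ^ 20 ≤ Sc.r j := by
  obtain ⟨-, -, -, -, -, hr1, -⟩ := Sc.step j
  have hp := Sc.pos j
  have hp' := Sc.pos (j + 1)
  have a1 := Sc.le_one h0 h1 j
  have a2 : Sc.δ (j + 1) ^ s ≤ 1 := Real.rpow_le_one hp'.le (Sc.le_one h0 h1 _) hs.le
  have a3 : 0 < Sc.δ (j + 1) ^ s := by positivity
  calc (2 : ℝ) ^ 20 ≤ Sc.δ j * (Sc.r j * Sc.δ (j + 1) ^ s) := hr1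
    _ ≤ 1 * (Sc.r j * 1) := by gcongr
    _ = Sc.r j := by ring

lemma SZ_dense (h0 : 0 < ε0) (h1 : ε0 ≤ 1) (hs : 0 < s) {a m : ℝ} (ha : |a| ≤ 1)
    (hm0 : 0 ≤ m) (hm1 : m ≤ 1) (j : ℕ)
    (hj : j % 3 ≠ 2) (x : ℝ) (hx1 : 1 ≤ x) (hx2 : x ≤ 1 + 1) :
    ∃ q ∈ Sc.SZ a m j, |q - x| ≤ Sc.Rs s j := by
  obtain ⟨hr, hE, hD, hδ⟩ := Sc.data j
  obtain ⟨-, -, -, -, -, hr1, -⟩ := Sc.step j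
  obtain ⟨hq1, hq2⟩ := q_bd ha j
  have hrb := Sc.r_big h0 h1 hs j
  have hκ0 : 0 ≤ kap j := by rcases kap_cases j with h | h <;> rw [h]; norm_num
  have hκ1 : kap j ≤ 1 / 8 := by rcases kap_cases j with h | h <;> rw [h]; norm_num
  set q := 1 + kap j * a with hq
  set r : ℝ := ((Sc.r j : ℕ) : ℝ)
  set D : ℝ := ((Sc.D j : ℕ) : ℝ)
  have hD0 : (0 : ℝ) < D := by linarith
  have hr0 : (0 : ℝ) < r := by linarith
  have hq0 : 0 < q := by linarith
  set x' := q * x - kap j * m with hx'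
  have hx'1 : 3 / 4 ≤ x' := by nlinarith
  have hx'2 : x' ≤ 9 / 4 := by nlinarith
  have hx'0 : 0 < x' := by linarith
  set k : ℤ := ⌊r / x'⌋
  have k1 : (k : ℝ) ≤ r / x' := Int.floor_le _
  have k2 : r / x' < k + 1 := Int.lt_floor_add_one _
  have hDi : 1 / D ≤ 1 := by rw [div_le_one hD0]; exact hD
  have hDi0 : 0 < 1 / D := by positivity
  have hrx : 4 / 9 * r ≤ r / x' := by rw [le_div_iff₀ hx'0]; nlinarith
  set w := (k : ℝ) + 1 / D with hw
  have hw3 : r / 3 ≤ w := by linarith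
  have hw0 : 0 < w := by linarith
  refine ⟨(r / w + kap j * m) / q, ?_, ?_⟩
  · unfold SZ; rw [if_pos hj]; exact ⟨k, hw3, rfl⟩
  · have e1 : (r / w + kap j * m) / q - x = (x' / (w * q)) * (r / x' - w) := by
      rw [eq_comm]
      have : x = (x' + kap j * m) / q := by rw [hx']; field_simp; ring
      rw [this]; field_simp; ring
    have h3 : |r / x' - w| ≤ 1 := by rw [abs_le]; constructor <;> linarith
    rw [e1, abs_mul, abs_of_pos (by positivity)]
    refine le_trans ?_ (Sc.le_Rs h0 h1 hs.le j)
    calc x' / (w * q) * |r / x' - w| ≤ (9 / 4) / (r / 3 * (7 / 8)) * 1 := by gcongr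
      _ ≤ _ := by
        rw [mul_one, div_le_iff₀ (by positivity)]
        nlinarith

/-- Good offsets. -/
def GG (a : ℝ) : Set ℝ := LS Sc.δ (Sc.SG a) 0

lemma GG_sub (a : ℝ) : Sc.GG a ⊆ Icc 0 1 := by
  intro x hx; have := hx.1; rwa [zero_add] at this

lemma K1_slice_lower (h0 : 0 < ε0) (h1 : ε0 ≤ 1) (hs : 0 < s) (hs1 : s ≤ 1 - ε0) {a m : ℝ}
    (ha : |a| ≤ 1) (hm : m ∈ Sc.GG a) :
    ENNReal.ofReal s ≤ dimH (Sc.K1 ∩ {p | p.2 = a * p.1 - m}) := by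
  have hm01 := Sc.GG_sub a hm
  have hlow := Sc.le_dimH_LS h0 h1 hs.le hs1 (fun j => j % 3 ≠ 2) (Sc.SZ a m) 1
    (fun j hj y => Sc.SZ_dense h0 h1 hs ha hm01.1 hm01.2 j hj y)
    (fun j hj => by unfold SZ; rw [if_neg hj])
  refine hlow.trans ?_
  have hfst : LipschitzWith 1 (Prod.fst : ℝ × ℝ → ℝ) := LipschitzWith.prod_fst
  refine le_trans (dimH_mono ?_) (hfst.dimH_image_le _)
  intro x hx
  have hx12 : x ∈ Icc (1 : ℝ) 2 := by have := hx.1; norm_num at this; exact this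
  refine ⟨(x, a * x - m), ⟨⟨hx12, ?_, ?_⟩, rfl⟩, rfl⟩
  · have ha' := abs_le.1 ha
    constructor <;> simp only <;> nlinarith [hx12.1, hx12.2, hm01.1, hm01.2]
  · intro j hj
    obtain ⟨hr, hE, hD, hδ⟩ := Sc.data j
    have hlt := Sc.lt h0 h1 j
    have hle := Sc.le_one h0 h1 j
    have hp' := Sc.pos (j + 1)
    obtain ⟨z, hz, hxz⟩ := hx.2 j
    unfold SZ at hz; rw [if_pos hj] at hz
    obtain ⟨k, hk, rfl⟩ := hz
    obtain ⟨g, hg, hmg⟩ := hm.2 j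
    unfold SG at hg; rw [if_pos hj] at hg
    obtain ⟨n, rfl⟩ := hg
    refine lower_alg _ _ _ _ a (kap j) m x _ n k hr hE hD hδ hp' (by linarith) ha (kap_cases j)
      hm01.1 hm01.2 hx12.1 hx12.2 hmg ?_ hk hxz
    have h5 := abs_sub_round (a / (1 + kap j * a) / Sc.δ (j + 1))
    set b := a / (1 + kap j * a)
    have e1 : b - (round (b / Sc.δ (j + 1)) : ℤ) * Sc.δ (j + 1) =
        (b / Sc.δ (j + 1) - round (b / Sc.δ (j + 1))) * Sc.δ (j + 1) := by field_simp
    rw [e1, abs_mul, abs_of_pos hp']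
    nlinarith

/-- The product `A × G` used for the lower bound. -/
lemma le_dimH_AG (h0 : 0 < ε0) (h1 : ε0 ≤ 1) (he : 0 ≤ e) {σ : ℝ} (hσ : e ≤ σ) (hσ1 : σ ≤ 1 - ε0)
    {a : ℝ} (ha : |a| ≤ 1) :
    ENNReal.ofReal (1 + e) ≤ dimH (Sc.radA σ ×ˢ Sc.GG a : Set (ℝ × ℝ)) := by
  refine Sc.le_dimH_prod h0 h1 he hσ le_rfl hσ1 (hσ.trans hσ1) (fun j => j % 3 = 2)
    (fun j => j % 3 ≠ 2) (by simp) _ _ 1 0 ?_ ?_ ?_ ?_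
  · intro j hj y _ _; exact Sc.SA_dense σ j hj y
  · intro j hj; unfold SA; rw [if_neg hj]
  · intro j hj y _ _; exact Sc.SG_dense h0 h1 he ha j hj y
  · intro j hj; unfold SG; rw [if_neg hj]

lemma le_dimH_A (h0 : 0 < ε0) (h1 : ε0 ≤ 1) {σ : ℝ} (hσ : 0 ≤ σ) (hσ1 : σ ≤ 1 - ε0) :
    ENNReal.ofReal (1 + σ) ≤ dimH (Sc.radA σ ×ˢ Icc (0 : ℝ) 1 : Set (ℝ × ℝ)) ∧
    ENNReal.ofReal σ ≤ dimH (Sc.radA σ) := by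
  have a1 : ∀ j, j % 3 = 2 → ∀ y, (1 : ℝ) ≤ y → y ≤ 1 + 1 → ∃ q ∈ Sc.SA σ j, |q - y| ≤ Sc.Rs σ j :=
    fun j hj y _ _ => Sc.SA_dense σ j hj y
  have a2 : ∀ j, ¬ j % 3 = 2 → Sc.SA σ j = univ := by
    intro j hj; unfold SA; rw [if_neg hj]
  exact ⟨Sc.le_dimH_prod_Icc h0 h1 hσ hσ1 (fun j => j % 3 = 2) _ 1 a1 a2,
    Sc.le_dimH_LS h0 h1 hσ hσ1 (fun j => j % 3 = 2) _ 1 a1 a2⟩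

end Scales

end HP

namespace HP

open Filter Topology

namespace Scales

variable {s d e ε0 : ℝ} (Sc : Scales s d e ε0)

set_option maxHeartbeats 1000000 in
lemma slice_cover (j : ℕ) (hj : j % 3 ≠ 2) (v : ℝ × ℝ) (V : ℝ) (hV : V = v.1 + kap j * v.2)
    (hV0 : V ≠ 0) (c B : ℝ) (hB : |-c / V| ≤ B) (hD : (100 : ℝ) ≤ Sc.D j) :
    ∃ H : Finset ℤ, (∀ k ∈ H, 0 ≤ k ∧ k ≤ 3 * (Sc.r j : ℤ)) ∧
      (∀ k ∈ H, ∃ h : ℤ, |Sc.D j * Sc.E j * (-c / V) * (k + 1 / Sc.D j) -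
        Sc.D j * Sc.E j * Sc.r j * (v.2 / V) - h| ≤ (40 + 8 * B) / Sc.D j) ∧
      ∃ U : ℤ → Set (ℝ × ℝ), Sc.K1 ∩ {p | cross v p = c} ⊆ ⋃ k ∈ H, U k ∧
        ∀ k ∈ H, ediam (U k) ≤ ENNReal.ofReal (144 * (1 + |v.2 / V|) * Sc.δ (j + 1)) := by
  classical
  obtain ⟨hr, hE, -, hδ⟩ := Sc.data j
  have hrδ := Sc.rδ_le j
  have hp' := Sc.pos (j + 1)
  set r := Sc.r j
  set D := Sc.D j
  set E := Sc.E j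
  set δ' := Sc.δ (j + 1)
  set a := v.2 / V with ha
  set m := -c / V with hm
  have hD0 : (0 : ℝ) < D := by linarith
  have hr0 : (0 : ℝ) < r := by linarith
  have hE0 : (0 : ℝ) < E := by linarith
  have hrδ8 : 8 * (r * δ') ≤ 1 / 2 - 1 / D := by
    have a1 : 1 / (D : ℝ) ≤ 1 / 100 := by gcongr
    have a2 : 1 / (D : ℝ) ^ 2 ≤ 1 / 100 ^ 2 := by gcongr
    norm_num at a1 a2 ⊢
    have : r * δ' ≤ 1 / 10000 := by simpa using hrδ.trans (by simpa using a2)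
    linarith
  have hDi : 0 < 1 / (D : ℝ) := by positivity
  have hlin : ∀ p : ℝ × ℝ, cross v p = c → p.2 = a * (p.1 + kap j * p.2) - m := by
    intro p hp
    simp only [cross] at hp
    rw [ha, hm]
    field_simp
    rw [hV, ← hp]; ring
  refine ⟨(Finset.Icc (0 : ℤ) (3 * r)).filter (fun k => ∃ h : ℤ, |D * E * m * (k + 1 / D) -
        D * E * r * a - h| ≤ (40 + 8 * B) / D), ?_, ?_, fun k => {p | p.1 ∈ Icc (1 : ℝ) 2 ∧
        p.2 ∈ Icc (-3 : ℝ) 2 ∧ cross v p = c ∧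
        |r / (p.1 + kap j * p.2) - 1 / D - k| ≤ 8 * (r * δ')}, ?_, ?_⟩
  · intro k hk
    rw [Finset.mem_filter, Finset.mem_Icc] at hk
    exact hk.1
  · intro k hk
    rw [Finset.mem_filter] at hk
    exact hk.2
  · rintro ⟨x, y⟩ ⟨⟨hx, hy, hcond⟩, hc⟩
    obtain ⟨c1, c2⟩ := hcond j hj
    obtain ⟨k, hk⟩ := nint_le_iff.1 c1
    obtain ⟨h, hh⟩ := nint_le_iff.1 c2
    have hl := hlin _ hc
    simp only at hl hx hy hk hh
    obtain ⟨b1, b2⟩ := shear_bd j hx hy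
    simp only [Set.mem_iUnion]
    refine ⟨k, ?_, hx, hy, hc, hk⟩
    set x' := x + kap j * y
    have hx0 : 0 < x' := by linarith
    have l1 : r / 3 ≤ r / x' := by gcongr
    have l2 : r / x' ≤ 2 * r := by rw [div_le_iff₀ hx0]; nlinarith
    rw [Finset.mem_filter, Finset.mem_Icc]
    refine ⟨⟨?_, ?_⟩, -h, ?_⟩
    · rw [abs_le] at hk
      have : (-1 : ℝ) < k := by linarith
      have : (-1 : ℤ) < k := by exact_mod_cast this
      omega
    · rw [abs_le] at hk
      have : (k : ℝ) ≤ 3 * r := by linarith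
      exact_mod_cast this
    · have e1 : D * E * m * (k + 1 / D) - D * E * r * a - ((-h : ℤ) : ℝ) =
          -(D * E * m * (r / x' - 1 / D - k)) - (D * E * r * (y / x') - h) := by
        have : y / x' = a - m / x' := by
          rw [eq_sub_iff_add_eq, ← add_div, div_eq_iff hx0.ne']; linarith
        rw [this]; push_cast; ring
      rw [e1]
      refine (abs_sub _ _).trans ?_
      rw [abs_neg, abs_mul, abs_mul, abs_of_pos (by positivity : (0 : ℝ) < D * E)]
      have e2 : D * E * B * (8 * (r * δ')) = 8 * B / D := by
        rw [eq_div_iff hD0.ne']; linear_combination 8 * B * hδ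
      have : D * E * |m| * |r / x' - 1 / D - k| ≤ D * E * B * (8 * (r * δ')) := by
        gcongr
        exact mul_nonneg (by positivity) ((abs_nonneg _).trans hB)
      have e3 : (40 + 8 * B) / (D : ℝ) = 8 * B / D + 40 / D := by ring
      linarith
  · intro k _
    refine ediam_le fun p hp q hq => ?_
    obtain ⟨hx, hy, hc, hk⟩ := hp
    obtain ⟨hx', hy', hc', hk'⟩ := hq
    obtain ⟨b1, b2⟩ := shear_bd j hx hy
    obtain ⟨b1', b2'⟩ := shear_bd j hx' hy'
    have hl := hlin _ hc
    have hl' := hlin _ hc'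
    set X := p.1 + kap j * p.2 with hX
    set X' := q.1 + kap j * q.2 with hX'
    have hw : |r / X - r / X'| ≤ 16 * (r * δ') := by
      rw [abs_le] at *; constructor <;> linarith [hk.1, hk.2, hk'.1, hk'.2]
    have hXX : |X - X'| ≤ 144 * δ' := by
      have h2 := inv_diff (r := r) (b := r / 3) hr0 (by linarith)
        (w := r / X) (w' := r / X') (by gcongr) (by gcongr) hw
      rw [div_div_cancel₀ hr0.ne', div_div_cancel₀ hr0.ne'] at h2
      refine h2.trans (le_of_eq ?_)
      field_simp; ring
    rw [edist_dist]
    apply ENNReal.ofReal_le_ofReal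
    have hy2 : |p.2 - q.2| ≤ |a| * (144 * δ') := by
      have : p.2 - q.2 = a * (X - X') := by linarith
      rw [this, abs_mul]; gcongr
    have hx2 : |p.1 - q.1| ≤ 144 * δ' + |a| * (144 * δ') := by
      have : p.1 - q.1 = (X - X') - kap j * (p.2 - q.2) := by rw [hX, hX']; ring
      rw [this]
      refine (abs_sub _ _).trans ?_
      have hκ : |kap j| ≤ 1 := by
        rcases kap_cases j with h | h <;> rw [h] <;> norm_num
      have : |kap j * (p.2 - q.2)| ≤ 1 * (|a| * (144 * δ')) := by
        rw [abs_mul]; gcongr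
      linarith
    rw [Prod.dist_eq, max_le_iff, Real.dist_eq, Real.dist_eq]
    have : 0 ≤ 144 * δ' := by positivity
    constructor <;> nlinarith

lemma lamD_ev (h0 : 0 < ε0) (h1 : ε0 ≤ 1) (hd : 0 < d) {τ : ℝ} (hτ : τ ≤ d / 4) (K : ℝ) :
    ∀ᶠ j : ℕ in atTop, K ≤ Sc.δ (j + 1) ^ τ * Sc.D j := by
  filter_upwards [Sc.ev_small h0 h1 K (c := d / 2) (by linarith) one_pos,
    eps_ev (ε0 := ε0) (c := d / 4) (by linarith)] with j hj hε
  have hp' := Sc.pos (j + 1)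
  have hle := Sc.le_one h0 h1 (j + 1)
  obtain ⟨-, -, -, -, -, -, -, -, -, -, hD, -⟩ := Sc.step j
  set δ' := Sc.δ (j + 1)
  refine (rpow_bd hp' hj).trans ?_
  have h3 : δ' ^ (-(d / 2)) * δ' ^ d ≤ δ' ^ τ * Sc.D j * δ' ^ d := by
    rw [mul_assoc]
    calc δ' ^ (-(d / 2)) * δ' ^ d = δ' ^ (d / 4) * δ' ^ (d / 4) := by
          rw [← Real.rpow_add hp', ← Real.rpow_add hp']; congr 1; ring
      _ ≤ δ' ^ τ * δ' ^ (ε0 / (j + 1)) := by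
          gcongr ?_ * ?_
          · exact Real.rpow_le_rpow_of_exponent_ge hp' hle hτ
          · exact Real.rpow_le_rpow_of_exponent_ge hp' hle hε
      _ ≤ _ := by gcongr
  exact le_of_mul_le_mul_right h3 (by positivity)

lemma lamr_ev (h0 : 0 < ε0) (h1 : ε0 ≤ 1) (hs : 0 < s) {τ : ℝ} (hτ : τ ≤ s / 4) (K : ℝ) :
    ∀ᶠ j : ℕ in atTop, K ≤ Sc.δ (j + 1) ^ τ * Sc.r j := by
  filter_upwards [Sc.ev_small h0 h1 K (c := s / 2) (by linarith) one_pos] with j hj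
  have hp' := Sc.pos (j + 1)
  have hle := Sc.le_one h0 h1 (j + 1)
  have hle' := Sc.le_one h0 h1 j
  obtain ⟨-, -, -, -, -, hr, -⟩ := Sc.step j
  set δ' := Sc.δ (j + 1)
  refine (rpow_bd hp' hj).trans ?_
  have hr2 : 1 ≤ Sc.r j * δ' ^ s := by
    have : Sc.δ j * (Sc.r j * δ' ^ s) ≤ 1 * (Sc.r j * δ' ^ s) := by gcongr
    linarith
  have h3 : δ' ^ (-(s / 2)) * δ' ^ s ≤ δ' ^ τ * Sc.r j * δ' ^ s := by
    rw [mul_assoc]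
    calc δ' ^ (-(s / 2)) * δ' ^ s = δ' ^ (s / 2) * 1 := by
          rw [← Real.rpow_add hp', mul_one]; congr 1; ring
      _ ≤ δ' ^ τ * (Sc.r j * δ' ^ s) := by
          gcongr ?_ * ?_
          exact Real.rpow_le_rpow_of_exponent_ge hp' hle (by linarith)
  exact le_of_mul_le_mul_right h3 (by positivity)

lemma rich_ev (h0 : 0 < ε0) (h1 : ε0 ≤ 1) {τ s' K : ℝ} (hτ : 0 < τ) (hs' : s' = s - τ / 4)
    (hK : 0 ≤ K) :
    ∀ᶠ j : ℕ in atTop, Sc.δ (j + 1) ^ τ * Sc.r j * (K * Sc.δ (j + 1)) ^ s' ≤ 1 := by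
  filter_upwards [Sc.ev_small h0 h1 (K ^ s') (c := τ / 2) (by linarith) one_pos,
    eps_ev (ε0 := ε0) (c := τ / 4) (by linarith)] with j hj hε
  have hp' := Sc.pos (j + 1)
  have hle := Sc.le_one h0 h1 (j + 1)
  obtain ⟨-, -, -, -, -, -, -, hr, -⟩ := Sc.step j
  set δ' := Sc.δ (j + 1)
  have hr' := rpow_bd hp' hr
  have hK' : 0 ≤ K ^ s' := Real.rpow_nonneg hK _
  calc δ' ^ τ * Sc.r j * (K * δ') ^ s' ≤ δ' ^ τ * δ' ^ (-(s + ε0 / (j + 1))) * (K ^ s' * δ' ^ s') := by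
        rw [Real.mul_rpow hK hp'.le]; gcongr
    _ = K ^ s' * δ' ^ (τ + -(s + ε0 / (j + 1)) + s') := by
        rw [Real.rpow_add hp', Real.rpow_add hp']; ring
    _ ≤ K ^ s' * δ' ^ (τ / 2) := by
        gcongr ?_ * ?_
        exact Real.rpow_le_rpow_of_exponent_ge hp' hle (by linarith)
    _ ≤ 1 := hj

set_option maxHeartbeats 1000000 in
lemma K1_L_le (h0 : 0 < ε0) (h1 : ε0 ≤ 1) (hs : 0 < s) (hd : 0 < d) (he : 0 ≤ e)
    (hsum : s + 2 * d + e = 1) (v : ℝ × ℝ) (hv : v ≠ 0) :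
    dimH {c | ENNReal.ofReal s ≤ dimH (Sc.K1 ∩ {p | cross v p = c})} ≤ ENNReal.ofReal e := by
  -- choice of the class of levels
  obtain ⟨i, V, hi3, hi2, hV0, hV⟩ : ∃ (i : ℕ) (V : ℝ), i < 3 ∧ i ≠ 2 ∧ V ≠ 0 ∧
      ∀ j, j % 3 = i → V = v.1 + kap j * v.2 := by
    by_cases h : v.1 = 0
    · refine ⟨1, 1 / 8 * v.2, by norm_num, by norm_num, ?_, ?_⟩
      · intro h2
        exact hv (Prod.ext h (by simpa using h2))
      · intro j hj; simp [kap, hj, h]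
    · exact ⟨0, v.1, by norm_num, by norm_num, h, fun j hj => by simp [kap, hj]⟩
  refine le_ofReal_of_forall fun w hw hw1 => ?_
  set τ : ℝ := min ((w - e) / 16) (min (d / 4) (s / 4)) with hτdef
  have hτ0 : 0 < τ := lt_min (by linarith) (lt_min (by linarith) (by linarith))
  have hτ1 : τ ≤ (w - e) / 16 := min_le_left _ _
  have hτ2 : τ ≤ d / 4 := (min_le_right _ _).trans (min_le_left _ _)
  have hτ3 : τ ≤ s / 4 := (min_le_right _ _).trans (min_le_right _ _)
  set a := v.2 / V with ha
  let LL : ℕ → ℕ → Set ℝ := fun B N => {c | |-c / V| ≤ B + 1 ∧ ∀ j, N ≤ j → j % 3 = i →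
    ∃ H : Finset ℤ, (∀ k ∈ H, 0 ≤ k ∧ k ≤ 3 * (Sc.r j : ℤ)) ∧
      (∀ k ∈ H, ∃ h : ℤ, |Sc.D j * Sc.E j * (-c / V) * (k + 1 / Sc.D j) -
        Sc.D j * Sc.E j * Sc.r j * a - h| ≤ (40 + 8 * (B + 1)) / Sc.D j) ∧
      Sc.δ (j + 1) ^ τ * Sc.r j ≤ H.card}
  have hsub : {c | ENNReal.ofReal s ≤ dimH (Sc.K1 ∩ {p | cross v p = c})} ⊆
      ⋃ B : ℕ, ⋃ N : ℕ, LL B N := by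
    intro c hc
    rw [Set.mem_setOf_eq] at hc
    obtain ⟨B, hB⟩ := exists_nat_ge |-c / V|
    have hB' : |-c / V| ≤ (B : ℝ) + 1 := by linarith
    have hnot : ¬ dimH (Sc.K1 ∩ {p | cross v p = c}) ≤ ENNReal.ofReal (s - τ / 4) := by
      intro hle
      have := hc.trans hle
      rw [ENNReal.ofReal_le_ofReal_iff (by linarith)] at this
      linarith
    have hnot2 := mt (dimH_le_of_covers (Sc.K1 ∩ {p | cross v p = c}) (s - τ / 4) (by linarith)) hnot
    push Not at hnot2
    obtain ⟨η, hη, hcov⟩ := hnot2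
    obtain ⟨N, hN⟩ := eventually_atTop.1 ((Sc.rich_ev h0 h1 (K := 144 * (1 + |a|)) hτ0 rfl
      (by positivity)).and ((Sc.lamD_ev h0 h1 hd (τ := 0) (by linarith) 100).and
      (Sc.ev_small h0 h1 (144 * (1 + |a|)) one_pos hη)))
    simp only [Set.mem_iUnion]
    refine ⟨B, N, hB', fun j hNj hji => ?_⟩
    obtain ⟨n1, n2, n3⟩ := hN j hNj
    rw [Real.rpow_zero, one_mul] at n2
    rw [Real.rpow_one] at n3
    obtain ⟨H, H1, H2, U, H3, H4⟩ := Sc.slice_cover j (by omega) v V (hV j hji) hV0 c (B + 1) hB' n2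
    refine ⟨H, H1, H2, ?_⟩
    have hp' := Sc.pos (j + 1)
    have hρ : 0 < 144 * (1 + |a|) * Sc.δ (j + 1) := by positivity
    have h5 := hcov ℤ H U _ hρ n3 H3 H4
    have h6 := n1.trans h5.le
    exact le_of_mul_le_mul_right h6 (by positivity)
  refine (dimH_mono hsub).trans ?_
  simp only [dimH_iUnion, iSup_le_iff]
  intro B N
  refine dimH_le_of_covers _ w (by linarith) fun η hη => ?_
  set B1 : ℝ := 40 + 8 * ((B : ℝ) + 1) with hB1
  have hBnn : (0 : ℝ) ≤ B := by positivity
  have hVp : 0 < |V| := abs_pos.2 hV0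
  set K : ℝ := 32 * B1 * |V| with hK
  have hB1p : 0 < B1 := by linarith
  have hK0 : 0 < K := by positivity
  obtain ⟨j, hji, hjε, -, ⟨hNj, e1, e2, e3, e4⟩⟩ := Sc.exists_level h0 h1 i hi3 (c := (w - e) / 16)
    (η := 1) (by linarith) one_pos ((eventually_ge_atTop N).and
      ((Sc.lamD_ev h0 h1 hd hτ2 (100 * B1)).and ((Sc.lamr_ev h0 h1 hs hτ3 100).and
      ((Sc.ev_small h0 h1 K (c := 1 - τ) (by linarith) hη).and
      (Sc.ev_small h0 h1 (10 ^ 8 * B1 ^ 2 * K ^ w) (c := (w - e) / 2) (by linarith) one_pos)))))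
  obtain ⟨-, hr, hE, hD, hδ, -, -, -, hE2, -⟩ := Sc.step j
  have hp' := Sc.pos (j + 1)
  have hle := Sc.le_one h0 h1 (j + 1)
  set δ' := Sc.δ (j + 1)
  have hlam0 : 0 < δ' ^ τ := by positivity
  obtain ⟨T, hT1, hT2⟩ := nt_cover (Sc.r j) (Sc.E j) (Sc.D j) a (B + 1) B1 (δ' ^ τ) δ' hr hE hD
    (by linarith) (by linarith) hlam0 (Real.rpow_le_one hp'.le hle hτ0.le) e1 e2 hδ
  have hquot : δ' / δ' ^ τ = δ' ^ (1 - τ) := by rw [Real.rpow_sub hp', Real.rpow_one]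
  refine ⟨ℝ, T, fun t => {c | |-c / V - t| ≤ 16 * B1 * δ' / δ' ^ τ}, K * δ' ^ (1 - τ),
    by positivity, e3, ?_, ?_, ?_⟩
  · rintro c ⟨hcB, hc⟩
    obtain ⟨H, H1, H2, H3⟩ := hc j hNj hji
    obtain ⟨t, ht, ht2⟩ := hT2 _ hcB H H1 H2 H3
    simp only [Set.mem_iUnion]
    exact ⟨t, ht, ht2⟩
  · intro t _
    refine ediam_le fun x hx y hy => ?_
    rw [edist_dist, Real.dist_eq]
    apply ENNReal.ofReal_le_ofReal
    rw [Set.mem_setOf_eq] at hx hy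
    have h5 : |(-x / V) - (-y / V)| ≤ 32 * B1 * δ' / δ' ^ τ := by
      have : 32 * B1 * δ' / δ' ^ τ = 16 * B1 * δ' / δ' ^ τ + 16 * B1 * δ' / δ' ^ τ := by ring
      rw [abs_le] at *; constructor <;> linarith [hx.1, hx.2, hy.1, hy.2]
    have e5 : x - y = -(V * ((-x / V) - (-y / V))) := by field_simp; ring
    rw [e5, abs_neg, abs_mul]
    calc |V| * |(-x / V) - (-y / V)| ≤ |V| * (32 * B1 * δ' / δ' ^ τ) := by gcongr
      _ = K * δ' ^ (1 - τ) := by rw [hK, ← hquot]; ring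
  · have hE3 := rpow_bd hp' hE2
    calc (T.card : ℝ) * (K * δ' ^ (1 - τ)) ^ w
        ≤ (10 ^ 8 * B1 ^ 2 * δ' ^ (-(e + ε0 / (j + 1))) / (δ' ^ τ) ^ 5) * (K ^ w * δ' ^ ((1 - τ) * w)) := by
          rw [Real.mul_rpow hK0.le (by positivity), ← Real.rpow_mul hp'.le]
          gcongr
          refine hT1.trans ?_
          gcongr
      _ = 10 ^ 8 * B1 ^ 2 * K ^ w * δ' ^ (-(e + ε0 / (j + 1)) - τ * (5 : ℕ) + (1 - τ) * w) := by
          rw [Real.rpow_add hp', Real.rpow_sub hp', Real.rpow_mul_natCast hp'.le]; ring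
      _ ≤ 10 ^ 8 * B1 ^ 2 * K ^ w * δ' ^ ((w - e) / 2) := by
          gcongr ?_ * ?_
          apply Real.rpow_le_rpow_of_exponent_ge hp' hle
          push_cast
          nlinarith
      _ ≤ 1 := e4

end Scales

end HP

namespace HP

open Filter Topology

/-- heavy offsets -/
def Lset (K : Set (ℝ × ℝ)) (v : ℝ × ℝ) (s : ℝ) : Set ℝ :=
  {c | ENNReal.ofReal s ≤ dimH (K ∩ {p | cross v p = c})}

/-- heavy part -/
def Hset (K : Set (ℝ × ℝ)) (v : ℝ × ℝ) (s : ℝ) : Set (ℝ × ℝ) :=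
  {p | p ∈ K ∧ cross v p ∈ Lset K v s}

lemma sq_pos_of_ne {v : ℝ × ℝ} (hv : v ≠ 0) : 0 < v.1 ^ 2 + v.2 ^ 2 := by
  by_contra hc
  apply hv
  have h1 : v.1 ^ 2 = 0 := by nlinarith [sq_nonneg v.1, sq_nonneg v.2]
  have h2 : v.2 ^ 2 = 0 := by nlinarith [sq_nonneg v.1, sq_nonneg v.2]
  exact Prod.ext (by simpa using h1) (by simpa using h2)

lemma dimH_Hset_le (K : Set (ℝ × ℝ)) (v : ℝ × ℝ) (hv : v ≠ 0) (s : ℝ) :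
    dimH (Hset K v s) ≤ dimH (Lset K v s) + 1 := by
  refine le_trans ?_ (dimH_prod_univ_le _)
  have hn0 := sq_pos_of_ne hv
  set n := v.1 ^ 2 + v.2 ^ 2 with hn
  let f : ℝ × ℝ → ℝ × ℝ := fun q => ((v.1 * q.2 - v.2 * q.1) / n, (v.2 * q.2 + v.1 * q.1) / n)
  have hf : ContDiff ℝ 1 f := by fun_prop
  refine le_trans (dimH_mono ?_) (hf.contDiffOn.dimH_image_le convex_univ (subset_univ _))
  rintro ⟨x, y⟩ ⟨-, hL⟩
  refine ⟨(cross v (x, y), v.1 * x + v.2 * y), ⟨hL, mem_univ _⟩, ?_⟩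
  simp only [f, cross, Prod.mk.injEq]
  constructor <;> rw [div_eq_iff hn0.ne', hn] <;> ring

lemma isometry_swap : Isometry (Prod.swap : ℝ × ℝ → ℝ × ℝ) := by
  intro p q
  simp [Prod.edist_eq, max_comm]

lemma cross_swap (v p : ℝ × ℝ) : cross v p.swap = - cross v.swap p := by
  simp [cross]

lemma swap_slice (K : Set (ℝ × ℝ)) (v : ℝ × ℝ) (c : ℝ) :
    (Prod.swap '' K) ∩ {p | cross v p = c} = Prod.swap '' (K ∩ {p | cross v.swap p = -c}) := by
  ext p
  constructor
  · rintro ⟨⟨q, hq, rfl⟩, h⟩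
    refine ⟨q, ⟨hq, ?_⟩, rfl⟩
    change cross v q.swap = c at h
    change cross v.swap q = -c
    rw [cross_swap] at h; linarith
  · rintro ⟨q, ⟨hq, h⟩, rfl⟩
    refine ⟨⟨q, hq, rfl⟩, ?_⟩
    change cross v.swap q = -c at h
    change cross v q.swap = c
    rw [cross_swap]; linarith

lemma dimH_Lset_swap (K : Set (ℝ × ℝ)) (v : ℝ × ℝ) (s : ℝ) :
    dimH (Lset (Prod.swap '' K) v s) ≤ dimH (Lset K v.swap s) := by
  have hneg : LipschitzWith 1 (fun c : ℝ => -c) := by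
    intro a b; simp
  refine le_trans (dimH_mono ?_) (hneg.dimH_image_le _)
  intro c hc
  refine ⟨-c, ?_, neg_neg c⟩
  change ENNReal.ofReal s ≤ _ at hc
  rw [swap_slice, isometry_swap.dimH_image] at hc
  exact hc

theorem interior (t s : ℝ) (ht1 : 1 < t) (hs1 : t - 1 < s) (hs2 : s ≤ (2 * t - 1) / 3)
    (hs3 : t / 3 ≤ s) : ∃ K : Set (ℝ × ℝ), IsCompact K ∧ dimH K = ENNReal.ofReal t ∧
      ∀ v ≠ 0, dimH (Lset K v s) ≤ ENNReal.ofReal (2 * t - 3 * s - 1) ∧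
        ENNReal.ofReal (2 * t - 3 * s) ≤ dimH (Hset K v s) := by
  set d := s - t + 1 with hd
  set e := 2 * t - 3 * s - 1 with he
  have hd0 : 0 < d := by linarith
  have he0 : 0 ≤ e := by linarith
  have hs0 : 0 < s := by linarith
  have hsum : s + 2 * d + e = 1 := by rw [hd, he]; ring
  set ε0 := min (1 - s) (2 - t) with hε
  have h0 : 0 < ε0 := lt_min (by linarith) (by linarith)
  have h1 : ε0 ≤ 1 := (min_le_right _ _).trans (by linarith)
  have hsε : s ≤ 1 - ε0 := by have := min_le_left (1 - s) (2 - t); linarith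
  have htε : t - 1 ≤ 1 - ε0 := by have := min_le_right (1 - s) (2 - t); linarith
  obtain ⟨Sc⟩ := exists_scales s d e ε0 hs0 hd0 he0 hsum h0 h1
  set A := Sc.radA (t - 1) with hA
  have hA12 : A ⊆ Icc 1 2 := Sc.radA_sub _
  have hAle : dimH A ≤ ENNReal.ofReal (t - 1) := Sc.dimH_radA_le h0 h1 (by linarith) (by linarith)
  have hK1 : dimH Sc.K1 ≤ ENNReal.ofReal t := by
    have := Sc.dimH_K1_le h0 h1 hs0 hd0 he0 hsum
    rwa [show 1 + s - d = t by rw [hd]; ring] at this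
  have hK2le : dimH (K2 A) ≤ ENNReal.ofReal t := by
    refine (dimH_K2_le hA12).trans ?_
    refine (add_le_add_left hAle 1).trans (le_of_eq ?_)
    rw [← ENNReal.ofReal_one, ← ENNReal.ofReal_add (by linarith) zero_le_one]
    congr 1; ring
  have hK2ge : ENNReal.ofReal t ≤ dimH (K2 A) := by
    refine le_trans ?_ (le_dimH_K2 hA12)
    have := (Sc.le_dimH_A h0 h1 (σ := t - 1) (by linarith) htε).1
    rwa [show 1 + (t - 1) = t by ring] at this
  refine ⟨K2 A ∪ (Sc.K1 ∪ Prod.swap '' Sc.K1), ?_, ?_, ?_⟩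
  · exact (K2_compact (Sc.radA_compact _) hA12).union
      (Sc.K1_compact.union (Sc.K1_compact.image continuous_swap))
  · rw [dimH_union, dimH_union, isometry_swap.dimH_image]
    exact le_antisymm (max_le hK2le (max_le hK1 hK1)) (hK2ge.trans (le_max_left _ _))
  · intro v hv
    constructor
    · have hsub : Lset (K2 A ∪ (Sc.K1 ∪ Prod.swap '' Sc.K1)) v s ⊆
          Lset Sc.K1 v s ∪ Lset (Prod.swap '' Sc.K1) v s := by
        intro c hc
        change ENNReal.ofReal s ≤ dimH _ at hc
        rw [union_inter_distrib_right, union_inter_distrib_right, dimH_union, dimH_union,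
          le_max_iff, le_max_iff] at hc
        rcases hc with hc | hc | hc
        · exfalso
          have := hc.trans ((dimH_K2_slice_le v hv c).trans hAle)
          rw [ENNReal.ofReal_le_ofReal_iff (by linarith)] at this
          linarith
        · exact Or.inl hc
        · exact Or.inr hc
      refine (dimH_mono hsub).trans ?_
      rw [dimH_union]
      refine max_le (Sc.K1_L_le h0 h1 hs0 hd0 he0 hsum v hv)
        ((dimH_Lset_swap _ _ _).trans (Sc.K1_L_le h0 h1 hs0 hd0 he0 hsum v.swap ?_))
      intro h
      exact hv (Prod.ext (congrArg Prod.snd h) (congrArg Prod.fst h))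
    · have hu : 2 * t - 3 * s = 1 + e := by rw [he]; ring
      rw [hu]
      have hAG : ∀ a : ℝ, |a| ≤ 1 → ENNReal.ofReal (1 + e) ≤ dimH (A ×ˢ Sc.GG a : Set (ℝ × ℝ)) :=
        fun a ha => Sc.le_dimH_AG h0 h1 he0 (by linarith) htε ha
      have hn0 := sq_pos_of_ne hv
      rcases le_or_gt |v.2| |v.1| with hv12 | hv12
      · have hv1 : v.1 ≠ 0 := by
          intro h
          rw [h, abs_zero] at hv12
          have : v.2 = 0 := abs_eq_zero.1 (le_antisymm hv12 (abs_nonneg _))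
          rw [h, this] at hn0; norm_num at hn0
        set a := v.2 / v.1 with ha
        have ha1 : |a| ≤ 1 := by
          rw [ha, abs_div]; exact div_le_one_of_le₀ hv12 (abs_nonneg _)
        refine (hAG a ha1).trans ((le_dimH_K2_part hA12 (Sc.GG_sub a) a (-1) (by nlinarith)).trans
          (dimH_mono ?_))
        rintro p ⟨hp, hpG⟩
        refine ⟨Or.inl hp, (Sc.K1_slice_lower h0 h1 hs0 hsε ha1 hpG).trans (dimH_mono ?_)⟩
        rintro q ⟨hq, hql⟩
        refine ⟨Or.inr (Or.inl hq), ?_⟩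
        change q.2 = _ at hql
        change cross v q = cross v p
        simp only [cross]
        rw [hql, ha]
        field_simp
        ring
      · have hv2 : v.2 ≠ 0 := by
          intro h
          rw [h, abs_zero] at hv12
          exact absurd (abs_nonneg v.1) (not_le.2 hv12)
        set a := v.1 / v.2 with ha
        have ha1 : |a| ≤ 1 := by
          rw [ha, abs_div]; exact div_le_one_of_le₀ hv12.le (abs_nonneg _)
        refine (hAG a ha1).trans ((le_dimH_K2_part hA12 (Sc.GG_sub a) (-1) a (by nlinarith)).trans
          (dimH_mono ?_))
        rintro p ⟨hp, hpG⟩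
        refine ⟨Or.inl hp, (Sc.K1_slice_lower h0 h1 hs0 hsε ha1 hpG).trans ?_⟩
        rw [← isometry_swap.dimH_image]
        refine dimH_mono ?_
        rintro - ⟨q, ⟨hq, hql⟩, rfl⟩
        refine ⟨Or.inr (Or.inr ⟨q, hq, rfl⟩), ?_⟩
        change q.2 = _ at hql
        change cross v q.swap = cross v p
        simp only [cross, Prod.fst_swap, Prod.snd_swap]
        rw [hql, ha]
        field_simp
        ring

end HP

namespace HP

open Filter Topology

lemma dimH_smul_image {X : Type*} [NormedAddCommGroup X] [NormedSpace ℝ X] {l : ℝ} (hl : l ≠ 0)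
    (S : Set X) : dimH ((fun p : X => l • p) '' S) = dimH S := by
  refine le_antisymm ((lipschitzWith_smul l).dimH_image_le S) ?_
  refine le_trans (dimH_mono ?_) ((lipschitzWith_smul l⁻¹).dimH_image_le _)
  intro p hp
  exact ⟨l • p, ⟨p, hp, rfl⟩, inv_smul_smul₀ hl p⟩

lemma cross_smul (v p : ℝ × ℝ) (l : ℝ) : cross v (l • p) = l * cross v p := by
  simp only [cross, Prod.smul_fst, Prod.smul_snd, smul_eq_mul]; ring

/-- Gluing shrinking copies of a sequence of compact sets at the origin. -/
lemma glue (Kn : ℕ → Set (ℝ × ℝ)) (hK : ∀ n, IsCompact (Kn n)) :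
    ∃ K : Set (ℝ × ℝ), IsCompact K ∧ dimH K = ⨆ n, dimH (Kn n) ∧
      (∀ v s, 0 < s → dimH (Lset K v s) ≤ ⨆ n, dimH (Lset (Kn n) v s)) ∧
      (∀ v s n, dimH (Hset (Kn n) v s) ≤ dimH (Hset K v s)) ∧
      (∀ v n, dimH (Kn n ∩ {p | cross v p = 0}) ≤ dimH (K ∩ {p | cross v p = 0})) := by
  have hb : ∀ n, ∃ B : ℝ, 0 < B ∧ ∀ p ∈ Kn n, ‖p‖ ≤ B := by
    intro n
    obtain ⟨B, hB⟩ := (hK n).isBounded.exists_norm_le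
    exact ⟨max B 1, lt_max_of_lt_right one_pos, fun p hp => (hB p hp).trans (le_max_left _ _)⟩
  choose B hB0 hB using hb
  let l : ℕ → ℝ := fun n => 1 / (((n : ℝ) + 1) * B n)
  have hl : ∀ n, 0 < l n := fun n => by have := hB0 n; simp only [l]; positivity
  let P : ℕ → Set (ℝ × ℝ) := fun n => (fun p => l n • p) '' Kn n
  have hPc : ∀ n, IsCompact (P n) := fun n => (hK n).image (continuous_const_smul _)
  have hPn : ∀ n, ∀ p ∈ P n, ‖p‖ ≤ 1 / ((n : ℝ) + 1) := by
    rintro n - ⟨p, hp, rfl⟩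
    simp only
    rw [norm_smul, Real.norm_of_nonneg (hl n).le]
    have h1 := hB n p hp
    have h2 := hB0 n
    calc l n * ‖p‖ ≤ l n * B n := by have := hl n; gcongr
      _ = 1 / ((n : ℝ) + 1) := by simp only [l]; field_simp
  have hPd : ∀ n, dimH (P n) = dimH (Kn n) := fun n => dimH_smul_image (hl n).ne' _
  have hslice : ∀ n v c, P n ∩ {p | cross v p = c} =
      (fun p => l n • p) '' (Kn n ∩ {p | cross v p = c / l n}) := by
    intro n v c
    have hln := hl n
    ext p
    constructor
    · rintro ⟨⟨q, hq, rfl⟩, h⟩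
      refine ⟨q, ⟨hq, ?_⟩, rfl⟩
      change cross v (l n • q) = c at h
      change cross v q = c / l n
      rw [cross_smul] at h
      rw [eq_div_iff hln.ne', mul_comm]; exact h
    · rintro ⟨q, ⟨hq, h⟩, rfl⟩
      refine ⟨⟨q, hq, rfl⟩, ?_⟩
      change cross v q = c / l n at h
      change cross v (l n • q) = c
      rw [cross_smul, h]; field_simp
  have hLP : ∀ n v s c, c ∈ Lset (P n) v s ↔ c / l n ∈ Lset (Kn n) v s := by
    intro n v s c
    change ENNReal.ofReal s ≤ dimH (P n ∩ {p | cross v p = c}) ↔ ENNReal.ofReal s ≤ dimH (Kn n ∩ {p | cross v p = c / l n})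
    rw [hslice, dimH_smul_image (hl n).ne']
  have hsubP : ∀ n, P n ⊆ {0} ∪ ⋃ n, P n := fun n => (subset_iUnion P n).trans subset_union_right
  refine ⟨{0} ∪ ⋃ n, P n, ?_, ?_, ?_, ?_, ?_⟩
  · have hEq : ({0} ∪ ⋃ n, P n) = ⋂ N : ℕ, (closedBall (0 : ℝ × ℝ) (1 / ((N : ℝ) + 1)) ∪
        ⋃ n ∈ Finset.range N, P n) := by
      ext p
      constructor
      · intro hp
        rw [mem_iInter]
        intro N
        rcases hp with hp | hp
        · left
          rw [mem_singleton_iff.1 hp]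
          exact mem_closedBall_self (by positivity)
        · obtain ⟨n, hn⟩ := mem_iUnion.1 hp
          rcases lt_or_ge n N with h | h
          · right
            simp only [mem_iUnion]
            exact ⟨n, Finset.mem_range.2 h, hn⟩
          · left
            rw [mem_closedBall_zero_iff]
            refine (hPn n p hn).trans ?_
            gcongr
      · intro hp
        rw [mem_iInter] at hp
        by_cases h0 : p = 0
        · left; exact h0
        right
        obtain ⟨N, hN⟩ := exists_nat_one_div_lt (norm_pos_iff.2 h0)
        rcases hp N with h | h
        · rw [mem_closedBall_zero_iff] at h
          exact absurd hN (not_lt.2 h)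
        · simp only [mem_iUnion] at h ⊢
          obtain ⟨n, -, hn⟩ := h
          exact ⟨n, hn⟩
    rw [hEq]
    have hcN : ∀ N : ℕ, IsCompact (closedBall (0 : ℝ × ℝ) (1 / ((N : ℝ) + 1)) ∪
        ⋃ n ∈ Finset.range N, P n) := fun N =>
      (isCompact_closedBall _ _).union ((Finset.range N).isCompact_biUnion fun n _ => hPc n)
    exact (hcN 0).of_isClosed_subset (isClosed_iInter fun N => (hcN N).isClosed)
      (iInter_subset _ 0)
  · rw [dimH_union, dimH_singleton, dimH_iUnion]
    simp [hPd]
  · intro v s hs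
    have hsub : Lset ({0} ∪ ⋃ n, P n) v s ⊆
        {0} ∪ ⋃ n, (fun c : ℝ => l n • c) '' Lset (Kn n) v s := by
      intro c hc
      by_cases hc0 : c = 0
      · left; exact hc0
      right
      have hcp : 0 < |c| / (2 * (‖v‖ + 1)) := by
        have := abs_pos.2 hc0; positivity
      obtain ⟨N, hN⟩ := exists_nat_one_div_lt hcp
      have hsl : ({0} ∪ ⋃ n, P n) ∩ {p | cross v p = c} ⊆
          ⋃ n ∈ Finset.range N, (P n ∩ {p | cross v p = c}) := by
        rintro p ⟨hp, hpc⟩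
        change cross v p = c at hpc
        have hpn : |c| ≤ 2 * (‖v‖ + 1) * ‖p‖ := by
          rw [← hpc]
          simp only [cross]
          have a1 := norm_fst_le v
          have a2 := norm_snd_le v
          have a3 := norm_fst_le p
          have a4 := norm_snd_le p
          rw [Real.norm_eq_abs] at a1 a2 a3 a4
          refine (abs_sub _ _).trans ?_
          rw [abs_mul, abs_mul]
          have b1 : |v.1| * |p.2| ≤ ‖v‖ * ‖p‖ := by gcongr
          have b2 : |v.2| * |p.1| ≤ ‖v‖ * ‖p‖ := by gcongr
          nlinarith [norm_nonneg p]
        have hpn' : |c| / (2 * (‖v‖ + 1)) ≤ ‖p‖ := by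
          rw [div_le_iff₀ (by positivity)]; linarith
        rcases hp with hp | hp
        · rw [mem_singleton_iff.1 hp, norm_zero] at hpn'
          linarith
        · obtain ⟨n, hn⟩ := mem_iUnion.1 hp
          simp only [mem_iUnion]
          refine ⟨n, Finset.mem_range.2 ?_, hn, hpc⟩
          by_contra hge
          push Not at hge
          have h1 := hPn n p hn
          have h2 : 1 / ((n : ℝ) + 1) ≤ 1 / ((N : ℝ) + 1) := by gcongr
          linarith
      have hc' : ENNReal.ofReal s ≤ ⨆ n ∈ (Finset.range N : Set ℕ), dimH (P n ∩ {p | cross v p = c}) := by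
        have hc1 : ENNReal.ofReal s ≤ dimH _ := hc
        refine (hc1.trans (dimH_mono hsl)).trans ?_
        rw [← dimH_bUnion (Finset.countable_toSet _)]
        exact le_rfl
      by_contra hno
      have hlt : ∀ n, dimH (P n ∩ {p | cross v p = c}) < ENNReal.ofReal s := by
        intro n
        by_contra hge
        push Not at hge
        apply hno
        rw [mem_iUnion]
        refine ⟨n, c / l n, (hLP n v s c).1 hge, ?_⟩
        have := hl n
        simp only [smul_eq_mul]; field_simp
      have : (⨆ n ∈ (Finset.range N : Set ℕ), dimH (P n ∩ {p | cross v p = c})) < ENNReal.ofReal s := by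
        have h3 : (⨆ n ∈ (Finset.range N : Set ℕ), dimH (P n ∩ {p | cross v p = c})) =
            (Finset.range N).sup fun n => dimH (P n ∩ {p | cross v p = c}) := by
          rw [Finset.sup_eq_iSup]; rfl
        rw [h3, Finset.sup_lt_iff (by simpa using hs)]
        intro n _
        exact hlt n
      exact absurd hc' (not_le.2 this)
    refine (dimH_mono hsub).trans ?_
    rw [dimH_union, dimH_singleton, dimH_iUnion]
    refine max_le (by simp) (iSup_mono fun n => ?_)
    rw [dimH_smul_image (hl n).ne']
  · intro v s n
    rw [← dimH_smul_image (hl n).ne' (Hset (Kn n) v s)]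
    refine dimH_mono ?_
    rintro - ⟨p, ⟨hp, hpL⟩, rfl⟩
    refine ⟨hsubP n ⟨p, hp, rfl⟩, ?_⟩
    have h1 : cross v (l n • p) ∈ Lset (P n) v s := by
      rw [hLP, cross_smul, mul_div_cancel_left₀ _ (hl n).ne']; exact hpL
    exact le_trans (show ENNReal.ofReal s ≤ _ from h1)
      (dimH_mono (inter_subset_inter_left _ (hsubP n)))
  · intro v n
    have h1 := hslice n v 0
    rw [zero_div] at h1
    rw [← dimH_smul_image (hl n).ne' (Kn n ∩ _), ← h1]
    exact dimH_mono (inter_subset_inter_left _ (hsubP n))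

lemma ofReal_le_of_seq {x : ℝ≥0∞} {a b : ℝ} (h : ∀ n : ℕ, ENNReal.ofReal (a - b / ((n : ℝ) + 1)) ≤ x) :
    ENNReal.ofReal a ≤ x := by
  have h1 : Tendsto (fun n : ℕ => a - b / ((n : ℝ) + 1)) atTop (𝓝 (a - 0)) :=
    tendsto_const_nhds.sub
      (tendsto_const_nhds.div_atTop (tendsto_natCast_atTop_atTop.atTop_add tendsto_const_nhds))
  rw [sub_zero] at h1
  exact le_of_tendsto ((ENNReal.continuous_ofReal.tendsto a).comp h1) (Eventually.of_forall h)

lemma Hset_mono (K : Set (ℝ × ℝ)) (v : ℝ × ℝ) {s s' : ℝ} (h : s ≤ s') :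
    Hset K v s' ⊆ Hset K v s := fun _ hp =>
  ⟨hp.1, (ENNReal.ofReal_le_ofReal h).trans (show ENNReal.ofReal s' ≤ _ from hp.2)⟩

lemma add_one_ofReal {u : ℝ} (hu : 1 ≤ u) {x : ℝ≥0∞} (h : x ≤ ENNReal.ofReal (u - 1)) :
    x + 1 ≤ ENNReal.ofReal u := by
  refine (add_le_add_left h 1).trans (le_of_eq ?_)
  rw [← ENNReal.ofReal_one, ← ENNReal.ofReal_add (by linarith) zero_le_one]
  congr 1; ring

/-- Radial sets of every dimension in `[1,2)`. -/
lemma exists_rad (t : ℝ) (ht1 : 1 ≤ t) (ht2 : t < 2) : ∃ K : Set (ℝ × ℝ), IsCompact K ∧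
    dimH K = ENNReal.ofReal t ∧ ∀ v ≠ 0, (∀ c, dimH (K ∩ {p | cross v p = c}) ≤ ENNReal.ofReal (t - 1)) ∧
      ENNReal.ofReal (t - 1) ≤ dimH (K ∩ {p | cross v p = 0}) := by
  obtain ⟨Sc⟩ := exists_scales (1 / 3) (1 / 3) 0 (2 - t) (by norm_num) (by norm_num) le_rfl
    (by norm_num) (by linarith) (by linarith)
  have h0 : 0 < 2 - t := by linarith
  have h1 : 2 - t ≤ 1 := by linarith
  have hA12 := Sc.radA_sub (t - 1)
  have hAle := Sc.dimH_radA_le h0 h1 (σ := t - 1) (by linarith) (by linarith)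
  obtain ⟨g1, g2⟩ := Sc.le_dimH_A h0 h1 (σ := t - 1) (by linarith) (by linarith)
  refine ⟨K2 (Sc.radA (t - 1)), K2_compact (Sc.radA_compact _) hA12, le_antisymm ?_ ?_, ?_⟩
  · exact (dimH_K2_le hA12).trans (add_one_ofReal ht1 hAle)
  · refine le_trans ?_ (le_dimH_K2 hA12)
    rwa [show 1 + (t - 1) = t by ring] at g1
  · intro v hv
    exact ⟨fun c => (dimH_K2_slice_le v hv c).trans hAle, g2.trans (le_dimH_K2_slice hA12 v hv)⟩

theorem core (t s : ℝ) (ht1 : 1 < t) (ht2 : t ≤ 2) (hs1 : t - 1 ≤ s) (hs2 : s ≤ (2 * t - 1) / 3) :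
    ∃ K : Set (ℝ × ℝ), IsCompact K ∧ dimH K = ENNReal.ofReal t ∧
      ∀ v ≠ 0, dimH (Hset K v s) = ENNReal.ofReal (min (2 * t - 3 * s) t) := by
  rcases lt_or_ge s (t / 3) with hlt | hge
  · obtain ⟨K, hKc, hKd, hK⟩ := interior t (t / 3) ht1 (by linarith) (by linarith) le_rfl
    refine ⟨K, hKc, hKd, fun v hv => le_antisymm ?_ ?_⟩
    · rw [min_eq_right (by linarith), ← hKd]
      exact dimH_mono fun p hp => hp.1
    · rw [min_eq_right (by linarith)]
      have := (hK v hv).2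
      rw [show 2 * t - 3 * (t / 3) = t by ring] at this
      exact this.trans (dimH_mono (Hset_mono K v hlt.le))
  have hmin : min (2 * t - 3 * s) t = 2 * t - 3 * s := min_eq_left (by linarith)
  rw [hmin]
  suffices h : ∃ K : Set (ℝ × ℝ), IsCompact K ∧ dimH K = ENNReal.ofReal t ∧
      ∀ v ≠ 0, dimH (Lset K v s) ≤ ENNReal.ofReal (2 * t - 3 * s - 1) ∧
        ENNReal.ofReal (2 * t - 3 * s) ≤ dimH (Hset K v s) by
    obtain ⟨K, hKc, hKd, hK⟩ := h
    refine ⟨K, hKc, hKd, fun v hv => le_antisymm ?_ (hK v hv).2⟩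
    exact (dimH_Hset_le K v hv s).trans (add_one_ofReal (by linarith) (hK v hv).1)
  rcases hs1.lt_or_eq with hs1 | hs1
  · exact interior t s ht1 hs1 hs2 hge
  rcases ht2.lt_or_eq with ht2 | rfl
  · -- boundary case
    have hb : ∀ n : ℕ, 0 < (2 - t) / 2 / ((n : ℝ) + 1) ∧ (2 - t) / 2 / ((n : ℝ) + 1) ≤ (2 - t) / 2 := by
      intro n
      refine ⟨div_pos (by linarith) (by positivity), div_le_self (by linarith) ?_⟩
      have : (0 : ℝ) ≤ n := by positivity
      linarith
    have hex : ∀ n : ℕ, _ := fun n => interior (t - (2 - t) / 2 / ((n : ℝ) + 1)) s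
      (by linarith [hb n]) (by linarith [hb n]) (by linarith [hb n]) (by linarith [hb n])
    choose Kn hKc hKd hK using hex
    obtain ⟨K, g1, g2, g3, g4, -⟩ := glue Kn hKc
    refine ⟨K, g1, ?_, fun v hv => ⟨?_, ?_⟩⟩
    · rw [g2]
      refine le_antisymm (iSup_le fun n => ?_) (ofReal_le_of_seq (b := (2 - t) / 2) fun n => ?_)
      · rw [hKd]; exact ENNReal.ofReal_le_ofReal (by linarith [hb n])
      · rw [← hKd n]; exact le_iSup (fun n => dimH (Kn n)) n
    · refine (g3 v s (by linarith)).trans (iSup_le fun n => ?_)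
      exact (hK n v hv).1.trans (ENNReal.ofReal_le_ofReal (by linarith [hb n]))
    · refine ofReal_le_of_seq (b := 2 - t) fun n => ?_
      refine le_trans (le_of_eq ?_) ((hK n v hv).2.trans (g4 v s n))
      congr 1; ring
  · -- the endpoint
    have hs : s = 1 := by linarith
    subst hs
    have hb : ∀ n : ℕ, 0 < 1 / ((n : ℝ) + 1) ∧ 1 / ((n : ℝ) + 1) ≤ 1 := by
      intro n
      refine ⟨by positivity, div_le_self (by norm_num) ?_⟩
      have : (0 : ℝ) ≤ n := by positivity
      linarith
    have hex : ∀ n : ℕ, _ := fun n => exists_rad (2 - 1 / ((n : ℝ) + 1))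
      (by linarith [hb n]) (by linarith [hb n])
    choose Kn hKc hKd hK using hex
    obtain ⟨K, g1, g2, g3, g4, g5⟩ := glue Kn hKc
    refine ⟨K, g1, ?_, fun v hv => ⟨?_, ?_⟩⟩
    · rw [g2]
      refine le_antisymm (iSup_le fun n => ?_) (ofReal_le_of_seq (b := 1) fun n => ?_)
      · rw [hKd]; exact ENNReal.ofReal_le_ofReal (by linarith [hb n])
      · rw [← hKd n]; exact le_iSup (fun n => dimH (Kn n)) n
    · refine (g3 v 1 one_pos).trans (iSup_le fun n => ?_)
      have hemp : Lset (Kn n) v 1 = ∅ := by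
        ext c
        simp only [mem_empty_iff_false, iff_false]
        intro hc
        have h5 := le_trans (show ENNReal.ofReal 1 ≤ _ from hc) ((hK n v hv).1 c)
        rw [ENNReal.ofReal_le_ofReal_iff (by linarith [hb n])] at h5
        linarith [hb n]
      rw [hemp, dimH_empty]; exact zero_le
    · have hu : (2 : ℝ) * 2 - 3 * 1 = 1 := by norm_num
      rw [hu]
      have h6 : ENNReal.ofReal 1 ≤ dimH (K ∩ {p | cross v p = 0}) := by
        refine ofReal_le_of_seq (b := 1) fun n => ?_
        refine le_trans (le_of_eq ?_) ((hK n v hv).2.trans (g5 v n))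
        congr 1; ring
      refine h6.trans (dimH_mono ?_)
      rintro p ⟨hp, hp0⟩
      refine ⟨hp, ?_⟩
      change cross v p = 0 at hp0
      rw [hp0]; exact h6

/-- The linear identification with the Euclidean plane. -/
def toPlane : (ℝ × ℝ) ≃L[ℝ] Plane :=
  (ContinuousLinearEquiv.finTwoArrow ℝ ℝ).symm.trans (EuclideanSpace.equiv (Fin 2) ℝ).symm

lemma cross_eq_iff {v : ℝ × ℝ} (hv : v ≠ 0) (p q : ℝ × ℝ) :
    cross v q = cross v p ↔ ∃ r : ℝ, q = p + r • v := by
  have hn0 := sq_pos_of_ne hv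
  constructor
  · intro h
    simp only [cross] at h
    refine ⟨((q.1 - p.1) * v.1 + (q.2 - p.2) * v.2) / (v.1 ^ 2 + v.2 ^ 2), Prod.ext ?_ ?_⟩
    · simp only [Prod.fst_add, Prod.smul_fst, smul_eq_mul]
      field_simp
      linear_combination -v.2 * h
    · simp only [Prod.snd_add, Prod.smul_snd, smul_eq_mul]
      field_simp
      linear_combination v.1 * h
  · rintro ⟨r, rfl⟩
    simp only [cross, Prod.fst_add, Prod.smul_fst, Prod.snd_add, Prod.smul_snd, smul_eq_mul]
    ring

lemma heavyPart_image (K : Set (ℝ × ℝ)) (e : Plane) (he : e ≠ 0) (s : ℝ) :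
    heavyPart (toPlane '' K) e s = toPlane '' Hset K (toPlane.symm e) s := by
  have hv : toPlane.symm e ≠ 0 := by simpa using he
  have hline : ∀ p : ℝ × ℝ, toPlane '' K ∩ lineThrough e (toPlane p) =
      toPlane '' (K ∩ {q | cross (toPlane.symm e) q = cross (toPlane.symm e) p}) := by
    intro p
    have hw : ∀ q : ℝ × ℝ, toPlane q ∈ lineThrough e (toPlane p) ↔
        cross (toPlane.symm e) q = cross (toPlane.symm e) p := by
      intro q
      rw [cross_eq_iff hv]
      refine exists_congr fun r => ?_
      rw [← toPlane.injective.eq_iff, map_add, map_smul, ContinuousLinearEquiv.apply_symm_apply]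
    ext w
    constructor
    · rintro ⟨⟨q, hq, rfl⟩, h⟩
      exact ⟨q, ⟨hq, (hw q).1 h⟩, rfl⟩
    · rintro ⟨q, ⟨hq, h⟩, rfl⟩
      exact ⟨⟨q, hq, rfl⟩, (hw q).2 h⟩
  ext w
  constructor
  · rintro ⟨⟨p, hp, rfl⟩, h⟩
    rw [hline, ContinuousLinearEquiv.dimH_image] at h
    exact ⟨p, ⟨hp, h⟩, rfl⟩
  · rintro ⟨p, ⟨hp, h⟩, rfl⟩
    refine ⟨⟨p, hp, rfl⟩, ?_⟩
    rw [hline, ContinuousLinearEquiv.dimH_image]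
    exact h

end HP

theorem statement3 (t s : ℝ) (ht1 : 1 < t) (ht2 : t ≤ 2)
    (hs1 : t - 1 ≤ s) (hs2 : s ≤ (2 * t - 1) / 3) :
    ∃ K : Set Plane, IsCompact K ∧ dimH K = ENNReal.ofReal t ∧
      ∀ e ∈ unitCircle,
        dimH (heavyPart K e s) = ENNReal.ofReal (min (2 * t - 3 * s) t) := by
  obtain ⟨K, hKc, hKd, hK⟩ := HP.core t s ht1 ht2 hs1 hs2
  refine ⟨HP.toPlane '' K, hKc.image HP.toPlane.continuous, ?_, ?_⟩
  · rw [ContinuousLinearEquiv.dimH_image]; exact hKd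
  · intro e he
    have he0 : e ≠ 0 := by
      rintro rfl
      simp [unitCircle] at he
    rw [HP.heavyPart_image K e he0 s, ContinuousLinearEquiv.dimH_image]
    exact hK _ (by simpa using he0)
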